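/- arXiv:1904.07571 — 2 statements merged into one kernel-verified Lean document; each statement's English description precedes it below -/
import Mathlib

section
/- Let n ≥ 2, let U be an open neighborhood of 0 in ℂ^n, and let f, g : U → ℂ be holomorphic with f(0) = g(0) = 0, neither of which is constant on any neighborhood of 0. Consider the real-analytic map h : U → ℂ, h(z) = f(z) · conj(g(z)), where conj denotes complex conjugation, and let Sing h be the set of points x ∈ U at which the Fréchet derivative over ℝ of h (viewing ℂ^n and ℂ as real vector spaces) is not surjective. Then h(Sing h) is well-defined as a set germ at 0: there exists ε₀ > 0 such that for all ε, ε' ∈ (0, ε₀) there exists δ > 0 with h(Sing h ∩ B_ε) ∩ B_δ = h(Sing h ∩ B_ε') ∩ B_δ. -/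
open Metric Function

section partA
open Filter Topology

variable {E : Type*} [NormedAddCommGroup E] [NormedSpace ℂ E]
variable {E' : Type*} [NormedAddCommGroup E'] [NormedSpace ℂ E']

theorem ana_comp0 {E'' : Type*} [NormedAddCommGroup E''] [NormedSpace ℂ E'']
    {F : E → E''} {π : E' → E} (hF : AnalyticAt ℂ F 0) (hπ : AnalyticAt ℂ π 0)
    (h0 : π 0 = 0) : AnalyticAt ℂ (fun x => F (π x)) 0 := by
  rw [← h0] at hF
  exact AnalyticAt.fun_comp hF hπ

theorem tendsto0 {π : E' → E} (hπ : AnalyticAt ℂ π 0) (h0 : π 0 = 0) :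
    Tendsto π (𝓝 0) (𝓝 0) := by
  have := hπ.continuousAt.tendsto
  rwa [h0] at this

theorem ana_integral (H : E → ℂ) (hH : AnalyticAt ℂ H 0) (A : ℝ → E →L[ℂ] E) (hA : Continuous A)
    (C : ℝ) (hC : 1 ≤ C) (hAC : ∀ s ∈ Set.Icc (0:ℝ) 1, ‖A s‖ ≤ C) :
    AnalyticAt ℂ (fun x => ∫ s in (0:ℝ)..1, H (A s x)) 0 := by
  obtain ⟨p, r0, hp⟩ := hH
  obtain ⟨r, hr0, hr⟩ : ∃ r : NNReal, 0 < r ∧ (C.toNNReal * r : NNReal) < r0 := by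
    obtain ⟨t, ht0, ht⟩ := ENNReal.lt_iff_exists_nnreal_btwn.1 hp.r_pos
    have hCpos : 0 < C.toNNReal := by simpa using by linarith
    refine ⟨t / C.toNNReal, div_pos (by exact_mod_cast ht0) hCpos, ?_⟩
    rwa [mul_div_cancel₀ _ hCpos.ne']
  have hC0 : 0 ≤ C := by linarith
  let K : ∀ n, ℝ → ContinuousMultilinearMap ℂ (fun _ : Fin n => E) ℂ :=
    fun n s => (p n).compContinuousLinearMap (fun _ => A s)
  have hKc : ∀ n, Continuous (K n) := by
    intro n
    have h1 : Continuous fun s => ContinuousMultilinearMap.compContinuousLinearMapContinuousMultilinear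
      ℂ (fun _ : Fin n => E) (fun _ : Fin n => E) ℂ (fun _ => A s) :=
      (ContinuousMultilinearMap.cont _).comp (continuous_pi fun _ => hA)
    exact h1.clm_apply continuous_const
  have hKn : ∀ n, ∀ s ∈ Set.Icc (0:ℝ) 1, ‖K n s‖ ≤ ‖p n‖ * C ^ n := by
    intro n s hs
    refine (ContinuousMultilinearMap.norm_compContinuousLinearMap_le _ _).trans ?_
    gcongr
    simpa using pow_le_pow_left₀ (norm_nonneg _) (hAC s hs) n
  let q : FormalMultilinearSeries ℂ E ℂ := fun n => ∫ s in (0:ℝ)..1, K n s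
  have hqn : ∀ n, ‖q n‖ ≤ ‖p n‖ * C ^ n := by
    intro n
    have := intervalIntegral.norm_integral_le_of_norm_le_const (a := (0:ℝ)) (b := 1) (f := K n)
      (C := ‖p n‖ * C ^ n) (fun s hs => hKn n s (by
        rw [Set.uIoc_of_le zero_le_one] at hs; exact ⟨hs.1.le, hs.2⟩))
    simpa using this
  have hsum : Summable fun n => ‖p n‖ * (C * r) ^ n := by
    have := p.summable_norm_mul_pow (r := C.toNNReal * r) (lt_of_lt_of_le hr hp.r_le)
    simpa [Real.coe_toNNReal _ hC0] using this
  refine ⟨q, r, ?_, by exact_mod_cast hr0, ?_⟩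
  · refine q.le_radius_of_summable_norm ?_
    refine Summable.of_nonneg_of_le (fun n => by positivity) (fun n => ?_) hsum
    rw [mul_pow, ← mul_assoc]
    gcongr
    exact hqn n
  · intro y hy
    have hy' : ‖y‖ < r := by
      simpa [edist_eq_enorm_sub, enorm_eq_nnnorm] using hy
    have hq : ∀ n, (q n fun _ => y) = ∫ s in (0:ℝ)..1, K n s (fun _ => y) := by
      intro n
      exact ((ContinuousMultilinearMap.apply ℂ (fun _ : Fin n => E) ℂ (fun _ => y)).intervalIntegral_comp_comm
        ((hKc n).intervalIntegrable 0 1)).symm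
    simp only [hq, zero_add]
    refine intervalIntegral.hasSum_integral_of_dominated_convergence
      (fun n _ => ‖p n‖ * (C * r) ^ n) ?_ ?_ ?_ ?_ ?_
    · intro n
      have : Continuous fun s => K n s (fun _ => y) :=
        (ContinuousMultilinearMap.apply ℂ (fun _ : Fin n => E) ℂ (fun _ => y)).continuous.comp (hKc n)
      exact this.aestronglyMeasurable
    · intro n
      refine Eventually.of_forall fun s hs => ?_
      rw [Set.uIoc_of_le zero_le_one] at hs
      refine ((K n s).le_opNorm _).trans ?_
      rw [mul_pow, ← mul_assoc]
      have := hKn n s ⟨hs.1.le, hs.2⟩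
      have h2 : ∏ i : Fin n, ‖y‖ ≤ (r:ℝ) ^ n := by
        simpa using pow_le_pow_left₀ (norm_nonneg _) hy'.le n
      gcongr
    · exact Eventually.of_forall fun s hs => hsum
    · exact intervalIntegrable_const
    · refine Eventually.of_forall fun s hs => ?_
      rw [Set.uIoc_of_le zero_le_one] at hs
      have hmem : A s y ∈ Metric.eball (0:E) r0 := by
        have h1 : ‖A s y‖ < (C.toNNReal * r : NNReal) := by
          refine ((A s).le_opNorm y).trans_lt ?_
          rw [NNReal.coe_mul, Real.coe_toNNReal _ hC0]
          have := hAC s ⟨hs.1.le, hs.2⟩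
          exact lt_of_le_of_lt (mul_le_mul_of_nonneg_right this (norm_nonneg _))
            (mul_lt_mul_of_pos_left hy' (by linarith))
        rw [Metric.mem_eball, edist_zero_right, enorm_eq_nnnorm]
        refine lt_trans ?_ hr
        exact_mod_cast h1
      have := hp.hasSum hmem
      simpa [K] using this

/-- Hadamard division lemma. -/
theorem ana_div (F : E → ℂ) (hF : AnalyticAt ℂ F 0) (l : E →L[ℂ] ℂ) (e : E) :
    ∃ Q : E → ℂ, AnalyticAt ℂ Q 0 ∧ ∀ᶠ x in 𝓝 (0:E), F x = F (x - l x • e) + l x * Q x := by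
  let A : ℝ → E →L[ℂ] E := fun s => ContinuousLinearMap.id ℂ E - (((1 - s : ℝ)) : ℂ) • l.smulRight e
  have hA : Continuous A := by
    refine continuous_const.sub ?_
    exact (Complex.continuous_ofReal.comp (by fun_prop)).smul continuous_const
  let C : ℝ := 1 + ‖l.smulRight e‖
  have hC : 1 ≤ C := by
    have := norm_nonneg (l.smulRight e)
    linarith
  have hAC : ∀ s ∈ Set.Icc (0:ℝ) 1, ‖A s‖ ≤ C := by
    intro s hs
    refine (norm_sub_le _ _).trans ?_
    refine add_le_add ContinuousLinearMap.norm_id_le ?_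
    rw [norm_smul, Complex.norm_real, Real.norm_eq_abs, abs_of_nonneg (by linarith [hs.2])]
    exact mul_le_of_le_one_left (norm_nonneg _) (by linarith [hs.1])
  have hH : AnalyticAt ℂ (fun y => fderiv ℂ F y e) 0 :=
    ((ContinuousLinearMap.apply ℂ ℂ e).analyticAt _).comp hF.fderiv
  refine ⟨_, ana_integral _ hH A hA C hC hAC, ?_⟩
  obtain ⟨r, hr, hball⟩ := Metric.eventually_nhds_iff_ball.1 hF.eventually_analyticAt
  have hev : ∀ᶠ x in 𝓝 (0:E), ‖x‖ < r / C := by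
    have := Metric.ball_mem_nhds (0:E) (div_pos hr (by linarith : 0 < C))
    filter_upwards [this] with x hx
    simpa using hx
  filter_upwards [hev] with x hx
  have hin : ∀ s ∈ Set.Icc (0:ℝ) 1, A s x ∈ ball (0:E) r := by
    intro s hs
    rw [mem_ball_zero_iff]
    refine ((A s).le_opNorm x).trans_lt ?_
    have := hAC s hs
    rw [lt_div_iff₀ (by linarith)] at hx
    nlinarith [norm_nonneg x]
  have hd : ∀ s ∈ Set.uIcc (0:ℝ) 1, HasDerivAt (fun s : ℝ => F (A s x)) (l x * fderiv ℂ F (A s x) e) s := by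
    intro s hs
    rw [Set.uIcc_of_le zero_le_one] at hs
    have h1 : HasFDerivAt F ((fderiv ℂ F (A s x)).restrictScalars ℝ) (A s x) :=
      (hball _ (hin s hs)).differentiableAt.hasFDerivAt.restrictScalars ℝ
    have h2 : HasDerivAt (fun s : ℝ => A s x) (l x • e) s := by
      have : (fun s : ℝ => A s x) = fun s : ℝ => x - ((((1 - s : ℝ)) : ℂ) * l x) • e := by
        funext s; simp [A, mul_smul]
      rw [this]
      have h3 : HasDerivAt (fun s : ℝ => ((1 - s : ℝ) : ℂ)) (-1) s := by
        have := ((hasDerivAt_id s).const_sub 1).ofReal_comp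
        simpa using this
      have := ((h3.mul_const (l x)).smul_const e).const_sub x
      simpa using this
    have := h1.comp_hasDerivAt s h2
    have h5 : ((fderiv ℂ F (A s x)).restrictScalars ℝ) (l x • e) = l x * fderiv ℂ F (A s x) e := by
      simp
    rw [h5] at this
    exact this
  have hcont : ContinuousOn (fun s : ℝ => l x * fderiv ℂ F (A s x) e) (Set.uIcc 0 1) := by
    rw [Set.uIcc_of_le zero_le_one]
    intro s hs
    refine ContinuousAt.continuousWithinAt ?_
    have h1 : ContinuousAt (fderiv ℂ F) (A s x) := (hball _ (hin s hs)).fderiv.continuousAt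
    have h2 : ContinuousAt (fun s : ℝ => A s x) s := (hA.clm_apply continuous_const).continuousAt
    have h3 : ContinuousAt (fun s => fderiv ℂ F (A s x)) s := ContinuousAt.comp (f := fun s => A s x) h1 h2
    exact continuousAt_const.mul (h3.clm_apply continuousAt_const)
  have := intervalIntegral.integral_eq_sub_of_hasDerivAt hd hcont.intervalIntegrable
  rw [intervalIntegral.integral_const_mul] at this
  have hA1 : A 1 x = x := by simp [A]
  have hA0 : A 0 x = x - l x • e := by simp [A]
  rw [hA1, hA0] at this
  rw [this]; ring

theorem ana_domain {F G : E → ℂ} (hF : AnalyticAt ℂ F 0) (hG : AnalyticAt ℂ G 0)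
    (h : ∀ᶠ x in 𝓝 (0:E), F x * G x = 0) :
    (∀ᶠ x in 𝓝 (0:E), F x = 0) ∨ (∀ᶠ x in 𝓝 (0:E), G x = 0) := by
  obtain ⟨r, hr, hball⟩ := Metric.eventually_nhds_iff_ball.1
    (hF.eventually_analyticAt.and (hG.eventually_analyticAt.and h))
  by_cases hz : ∀ x ∈ ball (0:E) r, F x = 0
  · left
    filter_upwards [Metric.ball_mem_nhds (0:E) hr] with x hx using hz x hx
  · right
    push Not at hz
    obtain ⟨a, ha, hFa⟩ := hz
    have h1 : G =ᶠ[𝓝 a] 0 := by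
      filter_upwards [(hball a ha).1.continuousAt.eventually_ne hFa, isOpen_ball.mem_nhds ha] with x hx hx'
      exact (mul_eq_zero.1 (hball x hx').2.2).resolve_left hx
    have h2 := AnalyticOnNhd.eqOn_zero_of_preconnected_of_eventuallyEq_zero (f := G) (U := ball (0:E) r)
      (fun x hx => (hball x hx).2.1) (convex_ball _ _).isPreconnected ha h1
    filter_upwards [Metric.ball_mem_nhds (0:E) hr] with x hx using h2 hx

theorem ana_prod_ne {ι : Type*} (s : Finset ι) (F : ι → E → ℂ) (hF : ∀ i ∈ s, AnalyticAt ℂ (F i) 0)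
    (hn : ∀ i ∈ s, ¬ ∀ᶠ x in 𝓝 (0:E), F i x = 0) :
    AnalyticAt ℂ (fun x => ∏ i ∈ s, F i x) 0 ∧ ¬ ∀ᶠ x in 𝓝 (0:E), ∏ i ∈ s, F i x = 0 := by
  classical
  induction s using Finset.induction_on with
  | empty => 
    refine ⟨by simpa using analyticAt_const, ?_⟩
    intro h
    simpa using h.self_of_nhds
  | insert a s ha ih =>
    obtain ⟨h1, h2⟩ := ih (fun i hi => hF i (by simp [hi])) (fun i hi => hn i (by simp [hi]))
    have h3 := hF a (by simp)
    simp only [Finset.prod_insert ha]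
    refine ⟨h3.mul h1, fun h => ?_⟩
    rcases ana_domain h3 h1 h with h | h
    · exact hn a (by simp) h
    · exact h2 h

/-- uniqueness of one variable expansion -/
theorem taylor_unique (d : ℕ) (a : ℕ → ℂ) (r : ℂ → ℂ) (hr : ContinuousAt r 0)
    (h : ∀ᶠ t in 𝓝 (0:ℂ), ∑ j ∈ Finset.range d, a j * t ^ j = t ^ d * r t) : ∀ j < d, a j = 0 := by
  induction d generalizing a with
  | zero => simp
  | succ d ih =>
    have h0 : a 0 = 0 := by
      have := h.self_of_nhds
      rw [Finset.sum_range_succ'] at this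
      simpa using this
    have h1 : ∀ᶠ t in 𝓝[≠] (0:ℂ), ∑ j ∈ Finset.range d, a (j+1) * t ^ j = t ^ d * r t := by
      filter_upwards [h.filter_mono nhdsWithin_le_nhds, self_mem_nhdsWithin] with t ht ht0
      rw [Finset.sum_range_succ', h0] at ht
      have ht0 : t ≠ 0 := ht0
      apply mul_left_cancel₀ ht0
      rw [Finset.mul_sum]
      calc _ = ∑ j ∈ Finset.range d, a (j+1) * t ^ (j+1) := by
            refine Finset.sum_congr rfl fun j _ => by ring
        _ = _ := by rw [pow_succ] at ht; simp at ht; rw [ht]; ring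
    have h2 : ContinuousAt (fun t => ∑ j ∈ Finset.range d, a (j+1) * t ^ j) 0 := by fun_prop
    have h3 : ContinuousAt (fun t : ℂ => t ^ d * r t) 0 := by fun_prop
    have h4 : ∀ᶠ t in 𝓝 (0:ℂ), ∑ j ∈ Finset.range d, a (j+1) * t ^ j = t ^ d * r t := by
      have h5 : ∑ j ∈ Finset.range d, a (j+1) * (0:ℂ) ^ j = (0:ℂ) ^ d * r 0 := by
        refine tendsto_nhds_unique_of_eventuallyEq (h2.tendsto.mono_left nhdsWithin_le_nhds)
          (h3.tendsto.mono_left nhdsWithin_le_nhds) h1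
      rw [eventually_nhdsWithin_iff] at h1
      filter_upwards [h1] with t ht
      by_cases htt : t = 0
      · rw [htt]; exact h5
      · exact ht htt
    have h5 := ih (fun j => a (j+1)) h4
    intro j hj
    cases j with
    | zero => exact h0
    | succ j => exact h5 j (by omega)

/-- Taylor expansion in the last variable. -/
theorem taylor_expand (F : E × ℂ → ℂ) (hF : AnalyticAt ℂ F 0) (d : ℕ) :
    ∃ (a : ℕ → E → ℂ) (u : E × ℂ → ℂ), (∀ j, AnalyticAt ℂ (a j) 0) ∧ AnalyticAt ℂ u 0 ∧
      ∀ᶠ p in 𝓝 (0 : E × ℂ), F p = ∑ j ∈ Finset.range d, a j p.1 * p.2 ^ j + p.2 ^ d * u p := by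
  induction d with
  | zero => exact ⟨fun _ _ => 0, F, fun _ => analyticAt_const, hF, by simp⟩
  | succ d ih =>
    obtain ⟨a, u, ha, hu, h⟩ := ih
    obtain ⟨Q, hQ, hQe⟩ := ana_div u hu (ContinuousLinearMap.snd ℂ E ℂ) ((0:E), (1:ℂ))
    have hu0 : AnalyticAt ℂ (fun x : E => u (x, 0)) 0 := by
      have h1 : AnalyticAt ℂ (fun x : E => (x, (0:ℂ))) 0 := analyticAt_id.prod analyticAt_const
      exact ana_comp0 hu h1 rfl
    refine ⟨fun j => if j = d then fun x => u (x, 0) else a j, Q, ?_, hQ, ?_⟩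
    · intro j
      by_cases hj : j = d
      · simp [hj, hu0]
      · simp [hj, ha]
    · filter_upwards [h, hQe] with p hp hq
      rw [hp, hq, Finset.sum_range_succ]
      have : p - (ContinuousLinearMap.snd ℂ E ℂ) p • ((0:E), (1:ℂ)) = (p.1, 0) := by
        ext <;> simp
      rw [this]
      have h2 : ∑ j ∈ Finset.range d, (if j = d then fun x => u (x, 0) else a j) p.1 * p.2 ^ j
          = ∑ j ∈ Finset.range d, a j p.1 * p.2 ^ j := by
        refine Finset.sum_congr rfl fun j hj => ?_
        rw [if_neg (by have := Finset.mem_range.1 hj; omega)]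
      rw [h2]
      simp
      ring

end partA

section partB
open Filter Topology

variable {E : Type*} [NormedAddCommGroup E] [NormedSpace ℂ E]
variable {E' : Type*} [NormedAddCommGroup E'] [NormedSpace ℂ E']

/-- monomial -/
noncomputable def mnm {n : ℕ} (α : Fin n → ℕ) (x : Fin n → ℂ) : ℂ := ∏ i, x i ^ α i

theorem mnm_ana {n : ℕ} (α : Fin n → ℕ) (x : Fin n → ℂ) : AnalyticAt ℂ (mnm α) x := by
  unfold mnm
  refine Finset.analyticAt_fun_prod _ fun i _ => ?_
  exact ((ContinuousLinearMap.proj (R := ℂ) (φ := fun _ : Fin n => ℂ) i).analyticAt x).pow _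

theorem coord_ana {n : ℕ} (i : Fin n) (x : Fin n → ℂ) : AnalyticAt ℂ (fun x : Fin n → ℂ => x i) x :=
  (ContinuousLinearMap.proj (R := ℂ) (φ := fun _ : Fin n => ℂ) i).analyticAt x

theorem mnm_add {n : ℕ} (α β : Fin n → ℕ) (x : Fin n → ℂ) : mnm (α + β) x = mnm α x * mnm β x := by
  simp [mnm, pow_add, Finset.prod_mul_distrib]

theorem mnm_single {n : ℕ} (i : Fin n) (k : ℕ) (x : Fin n → ℂ) :
    mnm (Pi.single i k) x = x i ^ k := by
  unfold mnm
  rw [Finset.prod_eq_single i]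
  · simp
  · intro j _ hj; simp [Pi.single_eq_of_ne hj]
  · simp

theorem mnm_zero {n : ℕ} (x : Fin n → ℂ) : mnm 0 x = 1 := by simp [mnm]

theorem mnm_smul {n : ℕ} (k : ℕ) (α : Fin n → ℕ) (x : Fin n → ℂ) : mnm (k • α) x = mnm α x ^ k := by
  simp [mnm, Finset.prod_pow, mul_comm k, pow_mul]

theorem mnm_eq_zero {n : ℕ} (α : Fin n → ℕ) (x : Fin n → ℂ) :
    mnm α x = 0 ↔ ∃ i, x i = 0 ∧ α i ≠ 0 := by
  simp [mnm, Finset.prod_eq_zero_iff]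

theorem mnm_at_zero {n : ℕ} {α : Fin n → ℕ} (h : α ≠ 0) : mnm α 0 = 0 := by
  rw [mnm_eq_zero]
  by_contra hc
  push Not at hc
  exact h (funext fun i => hc i rfl)

/-- constant vector small -/
theorem small_pt {n : ℕ} (S : Fin n → Prop) {P : (Fin n → ℂ) → Prop} (h : ∀ᶠ x in 𝓝 (0 : Fin n → ℂ), P x) :
    ∃ x, P x ∧ ∀ i, x i = 0 ↔ S i := by
  classical
  have hc : Continuous (fun s : ℂ => fun i => if S i then 0 else s : ℂ → Fin n → ℂ) := by
    refine continuous_pi fun i => ?_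
    by_cases hi : S i <;> simp [hi] <;> fun_prop
  have h1 : Tendsto (fun s : ℂ => fun i => if S i then 0 else s : ℂ → Fin n → ℂ) (𝓝[≠] 0) (𝓝 0) := by
    have := hc.tendsto 0
    simp only [ite_self] at this
    exact this.mono_left nhdsWithin_le_nhds
  obtain ⟨s, hs, hs0⟩ := ((h1.eventually h).and self_mem_nhdsWithin).exists
  refine ⟨_, hs, fun i => ?_⟩
  have hs0 : s ≠ 0 := hs0
  by_cases hi : S i <;> simp [hi, hs0]

theorem mnm_ne {n : ℕ} (α : Fin n → ℕ) : ¬ ∀ᶠ x in 𝓝 (0 : Fin n → ℂ), mnm α x = 0 := by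
  intro h
  obtain ⟨x, hx, hx'⟩ := small_pt (fun _ => False) h
  rw [mnm_eq_zero] at hx
  obtain ⟨i, hi, -⟩ := hx
  exact (hx' i).1 hi

/-- locally a monomial times a unit. -/
def IsMono {n : ℕ} (F : (Fin n → ℂ) → ℂ) : Prop :=
  ∃ (α : Fin n → ℕ) (u : (Fin n → ℂ) → ℂ), AnalyticAt ℂ u 0 ∧ u 0 ≠ 0 ∧
    ∀ᶠ x in 𝓝 (0 : Fin n → ℂ), F x = mnm α x * u x

theorem IsMono.congr {n : ℕ} {F G : (Fin n → ℂ) → ℂ} (h : IsMono F)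
    (hFG : ∀ᶠ x in 𝓝 (0 : Fin n → ℂ), G x = F x) : IsMono G := by
  obtain ⟨α, u, hu, hu0, h⟩ := h
  refine ⟨α, u, hu, hu0, ?_⟩
  filter_upwards [h, hFG] with x h1 h2
  rw [h2, h1]

theorem IsMono.ne {n : ℕ} {F : (Fin n → ℂ) → ℂ} (h : IsMono F) : ¬ ∀ᶠ x in 𝓝 (0 : Fin n → ℂ), F x = 0 := by
  obtain ⟨α, u, hu, hu0, h⟩ := h
  intro hz
  refine mnm_ne α ?_
  filter_upwards [h, hz, hu.continuousAt.eventually_ne hu0] with x h1 h2 h3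
  rw [h2] at h1
  exact (mul_eq_zero.1 h1.symm).resolve_right h3

theorem IsMono.mul {n : ℕ} {F G : (Fin n → ℂ) → ℂ} (hF : IsMono F) (hG : IsMono G) :
    IsMono (fun x => F x * G x) := by
  obtain ⟨α, u, hu, hu0, h⟩ := hF
  obtain ⟨β, v, hv, hv0, h'⟩ := hG
  refine ⟨α + β, fun x => u x * v x, hu.mul hv, mul_ne_zero hu0 hv0, ?_⟩
  filter_upwards [h, h'] with x h1 h2
  rw [h1, h2, mnm_add]; ring

theorem div_coord {n : ℕ} {F : (Fin n → ℂ) → ℂ} (hF : AnalyticAt ℂ F 0) (i : Fin n)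
    (h : ∀ᶠ x in 𝓝 (0 : Fin n → ℂ), F (x - x i • Pi.single i 1) = 0) :
    ∃ Q : (Fin n → ℂ) → ℂ, AnalyticAt ℂ Q 0 ∧ ∀ᶠ x in 𝓝 (0 : Fin n → ℂ), F x = x i * Q x := by
  obtain ⟨Q, hQ, hQe⟩ := ana_div F hF (ContinuousLinearMap.proj (R := ℂ) (φ := fun _ : Fin n => ℂ) i)
    (Pi.single i 1)
  refine ⟨Q, hQ, ?_⟩
  filter_upwards [h, hQe] with x h1 h2
  rw [h2]
  simp only [ContinuousLinearMap.proj_apply]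
  rw [h1, zero_add]

theorem factor_aux {n : ℕ} (m : ℕ) : ∀ (F G : (Fin n → ℂ) → ℂ) (α : Fin n → ℕ) (u : (Fin n → ℂ) → ℂ),
    ∑ i, α i = m → AnalyticAt ℂ F 0 → AnalyticAt ℂ G 0 → AnalyticAt ℂ u 0 → u 0 ≠ 0 →
    (∀ᶠ x in 𝓝 (0 : Fin n → ℂ), F x * G x = mnm α x * u x) → IsMono F ∧ IsMono G := by
  induction m with
  | zero =>
    intro F G α u hα hF hG hu hu0 h
    have hα : α = 0 := by
      funext i
      simpa using (Finset.sum_eq_zero_iff.1 hα) i (Finset.mem_univ i)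
    have h0 := h.self_of_nhds
    rw [hα, mnm_zero, one_mul] at h0
    rw [← h0] at hu0
    refine ⟨⟨0, F, hF, left_ne_zero_of_mul hu0, ?_⟩, ⟨0, G, hG, right_ne_zero_of_mul hu0, ?_⟩⟩ <;>
      simp [mnm_zero]
  | succ m ih =>
    intro F G α u hα hF hG hu hu0 h
    obtain ⟨i, hi⟩ : ∃ i, α i ≠ 0 := by
      by_contra hc
      push Not at hc
      simp [hc] at hα
    obtain ⟨β, hβ⟩ : ∃ β : Fin n → ℕ, α = Pi.single i 1 + β := by
      refine ⟨α - Pi.single i 1, ?_⟩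
      funext j
      have : (Pi.single i 1 : Fin n → ℕ) j ≤ α j := by
        by_cases hj : j = i
        · subst hj; simp only [Pi.single_eq_same]; omega
        · simp only [Pi.single_eq_of_ne hj]; omega
      simp only [Pi.add_apply, Pi.sub_apply]
      omega
    have hβm : ∑ i, β i = m := by
      rw [hβ] at hα
      simp [Finset.sum_add_distrib] at hα
      omega
    have main : ∀ F G : (Fin n → ℂ) → ℂ, AnalyticAt ℂ F 0 → AnalyticAt ℂ G 0 → 
        (∀ᶠ x in 𝓝 (0 : Fin n → ℂ), F x * G x = mnm α x * u x) → 
        (∀ᶠ x in 𝓝 (0 : Fin n → ℂ), F (x - x i • Pi.single i 1) = 0) → IsMono F ∧ IsMono G := by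
      intro F G hF hG h hz
      obtain ⟨Q, hQ, hFQ⟩ := div_coord hF i hz
      have h1 : ∀ᶠ x in 𝓝 (0 : Fin n → ℂ), x i * (Q x * G x - mnm β x * u x) = 0 := by
        filter_upwards [h, hFQ] with x h1 h2
        rw [h2, hβ, mnm_add, mnm_single, pow_one] at h1
        linear_combination h1
      have h2 : ∀ᶠ x in 𝓝 (0 : Fin n → ℂ), Q x * G x - mnm β x * u x = 0 := by
        refine (ana_domain (coord_ana i 0) ((hQ.mul hG).sub ((mnm_ana β 0).mul hu)) h1).resolve_left ?_
        have := mnm_ne (Pi.single i 1 : Fin n → ℕ)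
        simpa [mnm_single] using this
      obtain ⟨h3, h4⟩ := ih Q G β u hβm hQ hG hu hu0 (h2.mono fun x hx => sub_eq_zero.1 hx)
      refine ⟨?_, h4⟩
      have hxi : IsMono (fun x : Fin n → ℂ => x i) :=
        ⟨Pi.single i 1, fun _ => 1, analyticAt_const, one_ne_zero, by simp [mnm_single]⟩
      exact (hxi.mul h3).congr hFQ
    let P : (Fin n → ℂ) → (Fin n → ℂ) := fun x => x - x i • Pi.single i 1
    have hP : AnalyticAt ℂ P 0 := analyticAt_id.sub ((coord_ana i 0).smul analyticAt_const)
    have hP0 : P 0 = 0 := by simp [P]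
    have hPi : ∀ x, P x i = 0 := by intro x; simp [P]
    have hz : ∀ᶠ x in 𝓝 (0 : Fin n → ℂ), F (P x) * G (P x) = 0 := by
      filter_upwards [(tendsto0 hP hP0).eventually h] with x hx
      rw [hx, (mnm_eq_zero _ _).2 ⟨i, hPi x, hi⟩, zero_mul]
    rcases ana_domain (ana_comp0 hF hP hP0) (ana_comp0 hG hP hP0) hz with h1 | h1
    · exact main F G hF hG h h1
    · exact (main G F hG hF (by simpa only [mul_comm] using h) h1).symm

theorem IsMono.factor {n : ℕ} {F G : (Fin n → ℂ) → ℂ} (hF : AnalyticAt ℂ F 0) (hG : AnalyticAt ℂ G 0)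
    (h : IsMono (fun x => F x * G x)) : IsMono F ∧ IsMono G := by
  obtain ⟨α, u, hu, hu0, h⟩ := h
  exact factor_aux _ F G α u rfl hF hG hu hu0 h

theorem IsMono.factor_prod {n : ℕ} {ι : Type*} (s : Finset ι) {F : ι → (Fin n → ℂ) → ℂ}
    (hF : ∀ i ∈ s, AnalyticAt ℂ (F i) 0)
    (h : IsMono (fun x => ∏ i ∈ s, F i x)) : ∀ i ∈ s, IsMono (F i) := by
  classical
  intro i hi
  have h1 : (fun x => ∏ i ∈ s, F i x) = fun x => F i x * ∏ j ∈ s.erase i, F j x := by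
    funext x
    exact (Finset.mul_prod_erase s (fun j => F j x) hi).symm
  rw [h1] at h
  refine (IsMono.factor (hF i hi) ?_ h).1
  exact Finset.analyticAt_fun_prod _ fun j hj => hF j (Finset.mem_of_mem_erase hj)

theorem mono_compare {n : ℕ} (α β : Fin n → ℕ) (u v : (Fin n → ℂ) → ℂ) (hu : AnalyticAt ℂ u 0)
    (hv : AnalyticAt ℂ v 0) (hu0 : u 0 ≠ 0) (hv0 : v 0 ≠ 0)
    (h : (∀ᶠ x in 𝓝 (0 : Fin n → ℂ), mnm α x * u x - mnm β x * v x = 0) ∨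
      IsMono (fun x => mnm α x * u x - mnm β x * v x)) : α ≤ β ∨ β ≤ α := by
  by_contra hcon
  push Not at hcon
  obtain ⟨μ, α', β', hα, hβ, hdis, hα', hβ'⟩ : ∃ μ α' β' : Fin n → ℕ, α = μ + α' ∧ β = μ + β' ∧
      (∀ i, α' i = 0 ∨ β' i = 0) ∧ α' ≠ 0 ∧ β' ≠ 0 := by
    refine ⟨fun i => min (α i) (β i), fun i => α i - β i, fun i => β i - α i, ?_, ?_, ?_, ?_, ?_⟩
    · funext i; simp; omega
    · funext i; simp; omega
    · intro i; dsimp; omega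
    · intro h0
      exact hcon.1 fun i => Nat.le_of_sub_eq_zero (congrFun h0 i)
    · intro h0
      exact hcon.2 fun i => Nat.le_of_sub_eq_zero (congrFun h0 i)
  have hR : AnalyticAt ℂ (fun x => mnm α' x * u x - mnm β' x * v x) 0 :=
    ((mnm_ana _ _).mul hu).sub ((mnm_ana _ _).mul hv)
  have hfac : (fun x => mnm α x * u x - mnm β x * v x) =
      fun x => mnm μ x * (mnm α' x * u x - mnm β' x * v x) := by
    funext x; rw [hα, hβ, mnm_add, mnm_add]; ring
  have hkey : ∃ k : Fin n → Prop, (¬ ((∃ i, k i ∧ α' i ≠ 0) ∧ (∃ i, k i ∧ β' i ≠ 0))) ∧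
      ∀ᶠ x in 𝓝 (0 : Fin n → ℂ), (∀ i, k i → x i = 0) → mnm α' x * u x - mnm β' x * v x = 0 := by
    rcases h with h | h
    · refine ⟨fun _ => False, by simp, ?_⟩
      have h' : ∀ᶠ x in 𝓝 (0 : Fin n → ℂ), mnm μ x * (mnm α' x * u x - mnm β' x * v x) = 0 := by
        filter_upwards [h] with x hx
        have := congrFun hfac x
        rw [← this, hx]
      have := (ana_domain (mnm_ana μ 0) hR h').resolve_left (mnm_ne μ)
      filter_upwards [this] with x hx _ using hx
    · rw [hfac] at h
      obtain ⟨κ, w, hw, hw0, hk⟩ := (IsMono.factor (mnm_ana μ 0) hR h).2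
      have hκ : κ ≠ 0 := by
        intro hκ
        have := hk.self_of_nhds
        simp only at this
        rw [hκ, mnm_at_zero hα', mnm_at_zero hβ', mnm_zero] at this
        simp at this
        exact hw0 this.symm
      obtain ⟨k, hk0⟩ : ∃ k, κ k ≠ 0 := by
        by_contra hc; push Not at hc; exact hκ (funext hc)
      refine ⟨fun i => i = k, ?_, ?_⟩
      · rintro ⟨⟨i, rfl, h1⟩, ⟨j, rfl, h2⟩⟩
        rcases hdis j with h | h
        · exact h1 h
        · exact h2 h
      · filter_upwards [hk] with x hx hxk
        rw [hx, (mnm_eq_zero κ x).2 ⟨k, hxk k rfl, hk0⟩, zero_mul]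
  obtain ⟨k, hk1, hk2⟩ := hkey
  have hex : ∀ α' β' : Fin n → ℕ, (∀ i, α' i = 0 ∨ β' i = 0) → β' ≠ 0 → (¬ ∃ i, k i ∧ α' i ≠ 0) → 
      ∀ u v : (Fin n → ℂ) → ℂ, AnalyticAt ℂ u 0 → u 0 ≠ 0 →
      (∀ᶠ x in 𝓝 (0 : Fin n → ℂ), (∀ i, k i → x i = 0) → mnm α' x * u x - mnm β' x * v x = 0) → False := by
    intro α' β' hd hb hk u v hu hu0 hev
    obtain ⟨x, ⟨hx1, hx2⟩, hx⟩ := small_pt (fun i => k i ∨ β' i ≠ 0)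
      (hev.and (hu.continuousAt.eventually_ne hu0))
    have h1 := hx1 (fun i hi => (hx i).2 (Or.inl hi))
    have h2 : mnm β' x = 0 := by
      rw [mnm_eq_zero]
      obtain ⟨i, hi⟩ : ∃ i, β' i ≠ 0 := by
        by_contra hc; push Not at hc; exact hb (funext hc)
      exact ⟨i, (hx i).2 (Or.inr hi), hi⟩
    rw [h2, zero_mul, sub_zero] at h1
    have h3 := (mul_eq_zero.1 h1).resolve_right hx2
    rw [mnm_eq_zero] at h3
    obtain ⟨i, hi, hi'⟩ := h3
    rcases (hx i).1 hi with h4 | h4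
    · exact hk ⟨i, h4, hi'⟩
    · exact (hd i).elim hi' h4
  by_cases hc : ∃ i, k i ∧ α' i ≠ 0
  · refine hex β' α' (fun i => (hdis i).symm) hα' (fun h => hk1 ⟨hc, h⟩) v u hv hv0 ?_
    filter_upwards [hk2] with x hx hx'
    rw [← neg_sub, hx hx', neg_zero]
  · exact hex α' β' hdis hβ' hc u v hu hu0 hk2

/-- `π` is an analytic germ, `ρ` a section along the ultrafilter. -/
def Lifts (U : Ultrafilter E) (π : E' → E) (ρ : E → E') : Prop :=
  AnalyticAt ℂ π 0 ∧ π 0 = 0 ∧ Tendsto ρ U (𝓝 0) ∧ ∀ᶠ x in (U : Filter E), π (ρ x) = x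

/-- `F` can be monomialised along `U`. -/
def Res (n : ℕ) (F : E → ℂ) (U : Ultrafilter E) : Prop :=
  ∃ (π : (Fin n → ℂ) → E) (ρ : E → (Fin n → ℂ)), Lifts U π ρ ∧ IsMono (fun x => F (π x))

theorem Lifts.trans {E'' : Type*} [NormedAddCommGroup E''] [NormedSpace ℂ E'']
    {U : Ultrafilter E} {π : E' → E} {ρ : E → E'} {π' : E'' → E'} {ρ' : E' → E''}
    (h : Lifts U π ρ) (h' : Lifts (U.map ρ) π' ρ') :
    Lifts U (fun x => π (π' x)) (fun x => ρ' (ρ x)) := by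
  obtain ⟨h1, h2, h3, h4⟩ := h
  obtain ⟨k1, k2, k3, k4⟩ := h'
  refine ⟨ana_comp0 h1 k1 k2, by simp only [k2, h2], ?_, ?_⟩
  · rw [Ultrafilter.coe_map] at k3
    exact k3.comp tendsto_map
  · rw [Ultrafilter.coe_map, eventually_map] at k4
    filter_upwards [h4, k4] with x hx hx'
    rw [hx', hx]

theorem Res.trans {n : ℕ} {F : E → ℂ} {U : Ultrafilter E} {π : E' → E} {ρ : E → E'}
    (h : Lifts U π ρ) (h' : Res n (fun x => F (π x)) (U.map ρ)) : Res n F U := by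
  obtain ⟨π', ρ', h1, h2⟩ := h'
  exact ⟨_, _, h.trans h1, h2⟩

theorem Lifts.le {U : Ultrafilter E} {π : E' → E} {ρ : E → E'} (h : Lifts U π ρ) :
    ((U.map ρ : Ultrafilter E') : Filter E') ≤ 𝓝 0 := h.2.2.1

theorem Res.congr {n : ℕ} {F G : E → ℂ} {U : Ultrafilter E} (h : Res n F U)
    (hFG : ∀ᶠ x in 𝓝 (0 : E), G x = F x) : Res n G U := by
  obtain ⟨π, ρ, h1, h2⟩ := h
  exact ⟨π, ρ, h1, h2.congr ((tendsto0 h1.1 h1.2.1).eventually hFG)⟩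

end partB

section partC
open Filter Topology

variable {E : Type*} [NormedAddCommGroup E] [NormedSpace ℂ E]
variable {E' : Type*} [NormedAddCommGroup E'] [NormedSpace ℂ E']

theorem ultra_dich {X : Type*} (U : Ultrafilter X) (φ : X → ℂ) :
    (∃ c, Tendsto φ U (𝓝 c)) ∨ Tendsto φ U (Bornology.cobounded ℂ) := by
  by_cases h : Tendsto φ U (Bornology.cobounded ℂ)
  · exact Or.inr h
  left
  have h' : ¬ ((U.map φ : Ultrafilter ℂ) : Filter ℂ) ≤ Bornology.cobounded ℂ := h
  rw [Filter.not_le] at h'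
  obtain ⟨s, hs, hs'⟩ := h'
  have h1 : sᶜ ∈ U.map φ := Ultrafilter.compl_mem_iff_notMem.2 hs'
  have hb : Bornology.IsBounded sᶜ := by
    rw [Bornology.isBounded_def, compl_compl]; exact hs
  obtain ⟨c, _, hc⟩ := hb.isCompact_closure.ultrafilter_le_nhds' (U.map φ)
    (mem_of_superset h1 subset_closure)
  exact ⟨c, hc⟩

theorem Lifts.of_cont {U : Ultrafilter E} (hU : (U : Filter E) ≤ 𝓝 0) {π : E' → E} {ρ : E → E'}
    (hπ : AnalyticAt ℂ π 0) (h0 : π 0 = 0) (hρ : ContinuousAt ρ 0) (hρ0 : ρ 0 = 0)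
    (h : ∀ᶠ x in 𝓝 (0 : E), π (ρ x) = x) : Lifts U π ρ := by
  refine ⟨hπ, h0, ?_, hU h⟩
  have : Tendsto ρ (𝓝 0) (𝓝 0) := by simpa [ContinuousAt, hρ0] using hρ
  exact this.mono_left hU

theorem ana_fst {n : ℕ} (p : (Fin n → ℂ) × ℂ) :
    AnalyticAt ℂ (fun p : (Fin n → ℂ) × ℂ => p.1) p := analyticAt_fst

theorem ana_c {n : ℕ} (i : Fin n) (p : (Fin n → ℂ) × ℂ) :
    AnalyticAt ℂ (fun p : (Fin n → ℂ) × ℂ => p.1 i) p :=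
  AnalyticAt.fun_comp (coord_ana i p.1) analyticAt_fst

theorem ana_m {n : ℕ} (α : Fin n → ℕ) (p : (Fin n → ℂ) × ℂ) :
    AnalyticAt ℂ (fun p : (Fin n → ℂ) × ℂ => mnm α p.1) p :=
  AnalyticAt.fun_comp (mnm_ana α p.1) analyticAt_fst

theorem Res_final {n : ℕ} {F : (Fin n → ℂ) × ℂ → ℂ} {U : Ultrafilter ((Fin n → ℂ) × ℂ)}
    (hU : (U : Filter ((Fin n → ℂ) × ℂ)) ≤ 𝓝 0) (α : Fin n → ℕ) (k : ℕ) (w : (Fin n → ℂ) × ℂ → ℂ)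
    (hw : AnalyticAt ℂ w 0) (hw0 : w 0 ≠ 0)
    (h : ∀ᶠ p in 𝓝 0, F p = mnm α p.1 * p.2 ^ k * w p) : Res (n + 1) F U := by
  let π : (Fin (n + 1) → ℂ) → (Fin n → ℂ) × ℂ := fun x => (fun i => x i.succ, x 0)
  have hπ : AnalyticAt ℂ π 0 := by
    refine AnalyticAt.prod ?_ (coord_ana 0 0)
    rw [analyticAt_pi_iff]
    exact fun i => coord_ana _ _
  have hπ0 : π 0 = 0 := rfl
  refine ⟨π, fun p => Fin.cons p.2 p.1, Lifts.of_cont hU hπ hπ0 ?_ ?_ ?_, ?_⟩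
  · refine Continuous.continuousAt ?_
    refine continuous_pi fun i => ?_
    refine Fin.cases ?_ (fun j => ?_) i
    · simpa using continuous_snd
    · simp only [Fin.cons_succ]; fun_prop
  · funext i
    refine Fin.cases ?_ (fun j => ?_) i <;> simp
  · exact Eventually.of_forall fun x => by simp [π]
  · refine ⟨Fin.cons k α, fun x => w (π x), ana_comp0 hw hπ hπ0, (by simpa only [hπ0] using hw0), ?_⟩
    filter_upwards [(tendsto0 hπ hπ0).eventually h] with x hx
    rw [hx]
    simp only [mnm, Fin.prod_univ_succ, Fin.cons_zero, Fin.cons_succ, π]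
    ring

/-- order of vanishing along the last axis -/
def OrdC {n : ℕ} (F : (Fin n → ℂ) × ℂ → ℂ) (d : ℕ) : Prop :=
  ∃ q : ℂ → ℂ, AnalyticAt ℂ q 0 ∧ q 0 ≠ 0 ∧ ∀ᶠ t in 𝓝 (0 : ℂ), F (0, t) = t ^ d * q t

theorem ordC_lt {n : ℕ} (F : (Fin n → ℂ) × ℂ → ℂ) (hF : AnalyticAt ℂ F 0) (d : ℕ)
    (h : ∀ r : ℂ → ℂ, ContinuousAt r 0 → ¬ ∀ᶠ t in 𝓝 (0 : ℂ), F (0, t) = t ^ d * r t) :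
    ∃ d' < d, OrdC F d' := by
  have h1 : AnalyticAt ℂ (fun t : ℂ => F (0, t)) 0 := by
    have : AnalyticAt ℂ (fun t : ℂ => ((0 : Fin n → ℂ), t)) 0 := analyticAt_const.prod analyticAt_id
    exact ana_comp0 hF this rfl
  have h2 : ¬ ∀ᶠ t in 𝓝 (0 : ℂ), F (0, t) = 0 := by
    intro h3
    exact h (fun _ => 0) continuousAt_const (by simpa using h3)
  obtain ⟨m, q, hq, hq0, hm⟩ := h1.exists_eventuallyEq_pow_smul_nonzero_iff.2 h2
  simp only [sub_zero, smul_eq_mul] at hm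
  refine ⟨m, ?_, q, hq, hq0, hm⟩
  by_contra hlt
  refine h (fun t => t ^ (m - d) * q t) ((continuousAt_id.pow _).mul hq.continuousAt) ?_
  filter_upwards [hm] with t ht
  rw [ht, ← mul_assoc, ← pow_add]
  congr 2; omega

/-- The statement of monomialisation for regular functions of order `d`. -/
def PS (n d : ℕ) : Prop :=
  ∀ (F : (Fin n → ℂ) × ℂ → ℂ) (G : (Fin n → ℂ) → ℂ) (U : Ultrafilter ((Fin n → ℂ) × ℂ)),
    AnalyticAt ℂ F 0 → AnalyticAt ℂ G 0 → (¬ ∀ᶠ x in 𝓝 (0 : Fin n → ℂ), G x = 0) →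
    (U : Filter ((Fin n → ℂ) × ℂ)) ≤ 𝓝 0 → OrdC F d → Res (n + 1) (fun p => G p.1 * F p) U

theorem mono_ne {n : ℕ} (κ : Fin n → ℕ) (v : (Fin n → ℂ) → ℂ) (hv : AnalyticAt ℂ v 0) (hv0 : v 0 ≠ 0) :
    ¬ ∀ᶠ x in 𝓝 (0 : Fin n → ℂ), mnm κ x * v x = 0 := by
  have : IsMono (fun x => mnm κ x * v x) := ⟨κ, v, hv, hv0, Eventually.of_forall fun _ => rfl⟩
  exact this.ne

theorem poly_aux (d : ℕ) (hd : 1 ≤ d) (β : ℕ → ℂ) (hβ : β (d - 1) = 0) (u c : ℂ) (hu : u ≠ 0) (hc : c ≠ 0)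
    (r : ℂ → ℂ) (hr : ContinuousAt r 0)
    (h : ∀ᶠ t in 𝓝 (0 : ℂ), ∑ j ∈ Finset.range d, β j * (t + c) ^ j + (t + c) ^ d * u = t ^ d * r t) :
    False := by
  open Polynomial in
  let p : ℂ[X] := ∑ j ∈ Finset.range d, C (β j) * (X + C c) ^ j + C u * (X + C c) ^ d
  have hp : p.natDegree < d + 1 := by
    rw [Nat.lt_succ_iff]
    refine Polynomial.natDegree_add_le_of_degree_le (Polynomial.natDegree_sum_le_of_forall_le _ _ ?_) ?_
    · intro j hj
      refine (Polynomial.natDegree_C_mul_le _ _).trans ?_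
      refine Polynomial.natDegree_pow_le.trans ?_
      rw [Polynomial.natDegree_X_add_C, mul_one]
      exact (Finset.mem_range.1 hj).le
    · refine (Polynomial.natDegree_C_mul_le _ _).trans ?_
      refine Polynomial.natDegree_pow_le.trans ?_
      rw [Polynomial.natDegree_X_add_C, mul_one]
  have hev : ∀ t, p.eval t = ∑ j ∈ Finset.range d, β j * (t + c) ^ j + (t + c) ^ d * u := by
    intro t
    simp [p, Polynomial.eval_finsetSum, mul_comm]
  have h1 := taylor_unique d (fun j => p.coeff j) (fun t => r t - p.coeff d) (hr.sub continuousAt_const) (by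
    filter_upwards [h] with t ht
    rw [← hev, Polynomial.eval_eq_sum_range' hp, Finset.sum_range_succ] at ht
    linear_combination ht) (d - 1) (by omega)
  simp only [p, Polynomial.coeff_add, Polynomial.finsetSum_coeff, Polynomial.coeff_C_mul,
    Polynomial.coeff_X_add_C_pow] at h1
  rw [Finset.sum_eq_zero, zero_add] at h1
  · have h2 : d - (d - 1) = 1 := by omega
    have h3 : d.choose (d - 1) = d := by
      rw [← Nat.choose_symm (by omega : d - 1 ≤ d), h2, Nat.choose_one_right]
    rw [h2, h3, pow_one] at h1
    have : (d : ℂ) ≠ 0 := by exact_mod_cast (by omega : d ≠ 0)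
    exact (mul_ne_zero hu (mul_ne_zero hc this)) h1
  · intro j hj
    rw [Finset.mem_range] at hj
    by_cases hjd : j = d - 1
    · subst hjd; simp [hβ]
    · rw [Nat.choose_eq_zero_of_lt (by omega)]; simp

end partC

section partD
open Filter Topology

theorem mnm_update {n : ℕ} (κ : Fin n → ℕ) (x : Fin n → ℂ) (i : Fin n) (t : ℂ) :
    mnm κ (update x i (t * x i)) = mnm κ x * t ^ κ i := by
  classical
  unfold mnm
  rw [← Finset.mul_prod_erase Finset.univ _ (Finset.mem_univ i),
    ← Finset.mul_prod_erase Finset.univ (fun j => x j ^ κ j) (Finset.mem_univ i)]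
  rw [update_self, mul_pow]
  have : ∏ j ∈ Finset.univ.erase i, update x i (t * x i) j ^ κ j =
      ∏ j ∈ Finset.univ.erase i, x j ^ κ j := by
    refine Finset.prod_congr rfl fun j hj => ?_
    rw [update_of_ne (Finset.ne_of_mem_erase hj)]
  rw [this]; ring

theorem ana_update {n : ℕ} {E : Type*} [NormedAddCommGroup E] [NormedSpace ℂ E] (i : Fin n)
    (a : E → (Fin n → ℂ)) (b : E → ℂ) (z : E) (ha : AnalyticAt ℂ a z) (hb : AnalyticAt ℂ b z) :
    AnalyticAt ℂ (fun p => update (a p) i (b p)) z := by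
  rw [analyticAt_pi_iff] at ha ⊢
  intro j
  by_cases hj : j = i
  · subst hj; simpa using hb
  · simpa [update_of_ne hj] using ha j

section
variable {n : ℕ} {U : Ultrafilter ((Fin n → ℂ) × ℂ)}

theorem chart1 (hU : (U : Filter ((Fin n → ℂ) × ℂ)) ≤ 𝓝 0)
    (i : Fin n) (c : ℂ)
    (h1 : ∀ᶠ p in (U : Filter ((Fin n → ℂ) × ℂ)), p.1 i ≠ 0 ∨ p.2 = 0)
    (h2 : Tendsto (fun p : (Fin n → ℂ) × ℂ => p.2 / p.1 i) U (𝓝 c)) :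
    Lifts U (fun p : (Fin n → ℂ) × ℂ => (p.1, p.1 i * (p.2 + c)))
      (fun p : (Fin n → ℂ) × ℂ => (p.1, p.2 / p.1 i - c)) := by
  refine ⟨?_, ?_, ?_, ?_⟩
  · exact analyticAt_fst.prod ((ana_c i 0).mul (analyticAt_snd.add analyticAt_const))
  · simp
  · have h3 : Tendsto (fun p : (Fin n → ℂ) × ℂ => p.1) U (𝓝 0) :=
      (continuous_fst.tendsto' 0 0 rfl).mono_left hU
    have h4 : Tendsto (fun p : (Fin n → ℂ) × ℂ => p.2 / p.1 i - c) U (𝓝 0) := by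
      simpa using h2.sub_const c
    exact h3.prodMk_nhds h4
  · filter_upwards [h1] with p hp
    rcases p with ⟨x, t⟩
    simp only [sub_add_cancel, Prod.mk.injEq, true_and] at hp ⊢
    rcases hp with hp | hp
    · field_simp
    · simp [hp]

theorem chart2 (hU : (U : Filter ((Fin n → ℂ) × ℂ)) ≤ 𝓝 0)
    (i : Fin n)
    (h1 : ∀ᶠ p in (U : Filter ((Fin n → ℂ) × ℂ)), p.2 ≠ 0)
    (h2 : Tendsto (fun p : (Fin n → ℂ) × ℂ => p.1 i / p.2) U (𝓝 0)) :
    Lifts U (fun p : (Fin n → ℂ) × ℂ => (update p.1 i (p.2 * p.1 i), p.2))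
      (fun p : (Fin n → ℂ) × ℂ => (update p.1 i (p.1 i / p.2), p.2)) := by
  refine ⟨?_, ?_, ?_, ?_⟩
  · exact (ana_update i _ _ _ analyticAt_fst (analyticAt_snd.mul (ana_c i 0))).prod analyticAt_snd
  · simp
  · have h3 : Tendsto (fun p : (Fin n → ℂ) × ℂ => p.1) U (𝓝 0) :=
      (continuous_fst.tendsto' 0 0 rfl).mono_left hU
    have h4 : Tendsto (fun p : (Fin n → ℂ) × ℂ => p.2) U (𝓝 0) :=
      (continuous_snd.tendsto' 0 0 rfl).mono_left hU
    refine Tendsto.prodMk_nhds ?_ h4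
    rw [tendsto_pi_nhds] at h3 ⊢
    intro j
    by_cases hj : j = i
    · subst hj; simpa using h2
    · simpa [update_of_ne hj] using h3 j
  · filter_upwards [h1] with p hp
    rcases p with ⟨x, t⟩
    simp only [Prod.mk.injEq, and_true] at hp ⊢
    rw [update_self, update_idem, mul_div_cancel₀ _ hp, update_eq_self]

theorem charts (i : Fin n) :
    (∃ c : ℂ, (∀ᶠ p in (U : Filter ((Fin n → ℂ) × ℂ)), p.1 i ≠ 0 ∨ p.2 = 0) ∧
      Tendsto (fun p : (Fin n → ℂ) × ℂ => p.2 / p.1 i) U (𝓝 c)) ∨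
    ((∀ᶠ p in (U : Filter ((Fin n → ℂ) × ℂ)), p.2 ≠ 0) ∧
      Tendsto (fun p : (Fin n → ℂ) × ℂ => p.1 i / p.2) U (𝓝 0)) := by
  rcases Ultrafilter.em U (fun p => p.1 i ≠ 0 ∨ p.2 = 0) with h | h
  · rcases ultra_dich U (fun p : (Fin n → ℂ) × ℂ => p.2 / p.1 i) with ⟨c, hc⟩ | hc
    · exact Or.inl ⟨c, h, hc⟩
    · right
      constructor
      · have : ∀ᶠ z in Bornology.cobounded ℂ, z ≠ 0 := by
          exact Bornology.eventually_ne_cobounded 0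
        filter_upwards [hc.eventually this] with p hp h0
        simp [h0] at hp
      · have := (tendsto_inv₀_cobounded (α := ℂ)).comp hc
        refine this.congr fun p => ?_
        simp
  · right
    push Not at h
    refine ⟨h.mono fun p hp => hp.2, ?_⟩
    refine tendsto_const_nhds.congr' ?_
    filter_upwards [h] with p hp
    simp [hp.1]

end

set_option maxHeartbeats 400000 in
theorem descent {n d : ℕ} (hd : 1 ≤ d) (IH : ∀ d' < d, PS n d') :
    ∀ (N : ℕ) (α : Fin n → ℕ), ∑ i, α i = N → ∀ (b : ℕ → (Fin n → ℂ) → ℂ) (u : (Fin n → ℂ) × ℂ → ℂ)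
      (κ : Fin n → ℕ) (v : (Fin n → ℂ) → ℂ) (U : Ultrafilter ((Fin n → ℂ) × ℂ)),
      (U : Filter ((Fin n → ℂ) × ℂ)) ≤ 𝓝 0 →
      (∀ j, AnalyticAt ℂ (b j) 0) → AnalyticAt ℂ u 0 → u 0 ≠ 0 → AnalyticAt ℂ v 0 → v 0 ≠ 0 →
      b (d - 1) 0 = 0 → (∃ j < d, b j 0 ≠ 0) →
      Res (n + 1) (fun p => (mnm κ p.1 * v p.1) *
        (∑ j ∈ Finset.range d, mnm ((d - j) • α) p.1 * b j p.1 * p.2 ^ j + p.2 ^ d * u p)) U := by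
  intro N
  induction N with
  | zero =>
    intro α hα b u κ v U hU hb hu hu0 hv hv0 hbd ⟨j0, hj0, hbj0⟩
    have hα0 : α = 0 := by
      funext i
      exact (Finset.sum_eq_zero_iff.1 hα) i (Finset.mem_univ i)
    subst hα0
    have hF : AnalyticAt ℂ (fun p : (Fin n → ℂ) × ℂ =>
        ∑ j ∈ Finset.range d, mnm ((d - j) • (0 : Fin n → ℕ)) p.1 * b j p.1 * p.2 ^ j + p.2 ^ d * u p) 0 := by
      refine AnalyticAt.add (Finset.analyticAt_fun_sum _ fun j _ => ?_) ((analyticAt_snd.pow d).mul hu)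
      exact ((ana_m _ 0).mul (ana_comp0 (hb j) analyticAt_fst rfl)).mul (analyticAt_snd.pow j)
    obtain ⟨d', hd', hO⟩ := ordC_lt _ hF d (by
      intro r hr h
      refine hbj0 (taylor_unique d (fun j => b j 0) (fun t => r t - u (0, t)) (hr.sub ?_) ?_ j0 hj0)
      · have : ContinuousAt (fun t : ℂ => ((0 : Fin n → ℂ), t)) 0 := by fun_prop
        exact ContinuousAt.comp (f := fun t : ℂ => ((0 : Fin n → ℂ), t)) hu.continuousAt this
      · filter_upwards [h] with t ht
        simp only [smul_zero, mnm_zero, one_mul] at ht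
        linear_combination ht)
    exact IH d' hd' _ (fun x => mnm κ x * v x) U hF ((mnm_ana κ 0).mul hv) (mono_ne κ v hv hv0) hU hO
  | succ N ih =>
    intro α hα b u κ v U hU hb hu hu0 hv hv0 hbd hex
    obtain ⟨i, hi⟩ : ∃ i, α i ≠ 0 := by
      by_contra hc
      push Not at hc
      simp [hc] at hα
    rcases charts (U := U) i with ⟨c, h1, h2⟩ | ⟨h1, h2⟩
    · have hl := chart1 hU i c h1 h2
      obtain ⟨α', rfl⟩ : ∃ α' : Fin n → ℕ, α = α' + Pi.single i 1 := by
        refine ⟨α - Pi.single i 1, ?_⟩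
        funext j
        by_cases hj : j = i
        · subst hj; simp; omega
        · simp [Pi.single_eq_of_ne hj]
      have hα' : ∑ j, α' j = N := by
        simp [Finset.sum_add_distrib] at hα
        exact hα
      refine Res.trans hl ?_
      set π : (Fin n → ℂ) × ℂ → (Fin n → ℂ) × ℂ := fun p => (p.1, p.1 i * (p.2 + c)) with hπ
      have key : (fun p : (Fin n → ℂ) × ℂ => (mnm κ p.1 * v p.1) *
        (∑ j ∈ Finset.range d, mnm ((d - j) • (α' + Pi.single i 1)) p.1 * b j p.1 * (p.1 i * (p.2 + c)) ^ j
          + (p.1 i * (p.2 + c)) ^ d * u (π p))) = fun p => (mnm (κ + Pi.single i d) p.1 * v p.1) *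
          (∑ j ∈ Finset.range d, mnm ((d - j) • α') p.1 * b j p.1 * (p.2 + c) ^ j
          + (p.2 + c) ^ d * u (π p)) := by
        funext p
        rw [mnm_add, mnm_single]
        have : ∑ j ∈ Finset.range d, mnm ((d - j) • (α' + Pi.single i 1)) p.1 * b j p.1 * (p.1 i * (p.2 + c)) ^ j
          = p.1 i ^ d * ∑ j ∈ Finset.range d, mnm ((d - j) • α') p.1 * b j p.1 * (p.2 + c) ^ j := by
          rw [Finset.mul_sum]
          refine Finset.sum_congr rfl fun j hj => ?_
          rw [Finset.mem_range] at hj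
          have e : p.1 i ^ d = p.1 i ^ (d - j) * p.1 i ^ j := by
            rw [← pow_add]; congr 1; omega
          have e2 : (d - j) • (Pi.single i 1 : Fin n → ℕ) = Pi.single i (d - j) := by
            rw [← Pi.single_smul]; simp
          rw [smul_add, mnm_add, e2, mnm_single, e, mul_pow]
          ring
        rw [this, mul_pow]
        ring
      show Res (n + 1) (fun p : (Fin n → ℂ) × ℂ => (mnm κ p.1 * v p.1) *
        (∑ j ∈ Finset.range d, mnm ((d - j) • (α' + Pi.single i 1)) p.1 * b j p.1 * (p.1 i * (p.2 + c)) ^ j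
          + (p.1 i * (p.2 + c)) ^ d * u (π p))) _
      rw [key]
      have hu' : AnalyticAt ℂ (fun p => u (π p)) 0 := ana_comp0 hu hl.1 hl.2.1
      have hu0' : u (π 0) ≠ 0 := by rw [hl.2.1]; exact hu0
      by_cases hc : c = 0
      · subst hc
        have := ih α' hα' b (fun p => u (π p)) (κ + Pi.single i d) v (U.map _) hl.le hb hu' hu0' hv hv0
          hbd hex
        simpa only [add_zero] using this
      · have hF : AnalyticAt ℂ (fun p : (Fin n → ℂ) × ℂ =>
            ∑ j ∈ Finset.range d, mnm ((d - j) • α') p.1 * b j p.1 * (p.2 + c) ^ j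
              + (p.2 + c) ^ d * u (π p)) 0 := by
          have hc' : AnalyticAt ℂ (fun p : (Fin n → ℂ) × ℂ => p.2 + c) 0 :=
            analyticAt_snd.add analyticAt_const
          refine AnalyticAt.add (Finset.analyticAt_fun_sum _ fun j _ => ?_) ((hc'.pow d).mul hu')
          exact ((ana_m _ 0).mul (ana_comp0 (hb j) analyticAt_fst rfl)).mul (hc'.pow j)
        obtain ⟨d', hd', hO⟩ := ordC_lt _ hF d (by
          intro r hr h
          refine poly_aux d hd (fun j => mnm ((d - j) • α') 0 * b j 0) (by simp [hbd]) (u 0) c hu0 hc r hr ?_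
          filter_upwards [h] with t ht
          have : π (0, t) = 0 := by simp [π]
          simpa only [this] using ht)
        have hG1 : AnalyticAt ℂ (fun x => mnm (κ + Pi.single i d) x * v x) 0 := (mnm_ana _ 0).mul hv
        have hG2 := mono_ne (κ + Pi.single i d) v hv hv0
        have hle := hl.le
        have := IH d' hd' _ _ _ hF hG1 hG2 hle hO
        exact this
    · have hl := chart2 hU i h1 h2
      refine Res.trans hl ?_
      set π : (Fin n → ℂ) × ℂ → (Fin n → ℂ) × ℂ := fun p => (update p.1 i (p.2 * p.1 i), p.2) with hπ
      have hπ1 : AnalyticAt ℂ (fun p => (π p).1) 0 := analyticAt_fst.comp hl.1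
      have hπ10 : (π 0).1 = 0 := by rw [hl.2.1]; rfl
      refine Res_final hl.le κ (κ i + d) (fun p => v (π p).1 *
        (∑ j ∈ Finset.range d, p.2 ^ ((d - j) * (α i - 1)) * mnm ((d - j) • α) p.1 * b j (π p).1
          + u (π p))) ?_ ?_ (Eventually.of_forall ?_)
      · refine (ana_comp0 hv hπ1 hπ10).mul (AnalyticAt.add (Finset.analyticAt_fun_sum _ fun j _ => ?_)
          (ana_comp0 hu hl.1 hl.2.1))
        exact ((analyticAt_snd.pow _).mul (ana_m _ 0)).mul (ana_comp0 (hb j) hπ1 hπ10)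
      · rw [hπ10, hl.2.1, Finset.sum_eq_zero, zero_add]
        · exact mul_ne_zero hv0 hu0
        · intro j hj
          rw [Finset.mem_range] at hj
          have : mnm ((d - j) • α) (0 : (Fin n → ℂ) × ℂ).1 = 0 := by
            rw [mnm_eq_zero]
            refine ⟨i, rfl, ?_⟩
            simp only [Pi.smul_apply, smul_eq_mul]
            exact Nat.mul_ne_zero (by omega) hi
          rw [this]; ring
      · intro p
        have e1 : ∀ κ, mnm κ (π p).1 = mnm κ p.1 * p.2 ^ κ i := fun κ => mnm_update κ p.1 i p.2
        have e2 : (π p).2 = p.2 := rfl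
        show mnm κ (π p).1 * v (π p).1 * (∑ j ∈ Finset.range d, mnm ((d - j) • α) (π p).1 * b j (π p).1
          * (π p).2 ^ j + (π p).2 ^ d * u (π p)) = _
        simp only [e1, e2]
        have : ∑ j ∈ Finset.range d, mnm ((d - j) • α) p.1 * p.2 ^ ((d - j) • α) i * b j (π p).1 * p.2 ^ j
          = p.2 ^ d * ∑ j ∈ Finset.range d, p.2 ^ ((d - j) * (α i - 1)) * mnm ((d - j) • α) p.1 * b j (π p).1 := by
          rw [Finset.mul_sum]
          refine Finset.sum_congr rfl fun j hj => ?_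
          rw [Finset.mem_range] at hj
          have e : p.2 ^ ((d - j) • α) i * p.2 ^ j = p.2 ^ d * p.2 ^ ((d - j) * (α i - 1)) := by
            rw [← pow_add, ← pow_add]; congr 1
            simp only [Pi.smul_apply, smul_eq_mul]
            obtain ⟨a, ha⟩ := Nat.exists_eq_succ_of_ne_zero hi
            rw [ha, Nat.succ_sub_one, Nat.mul_succ]; omega
          linear_combination mnm ((d - j) • α) p.1 * b j (π p).1 * e
        rw [this, pow_add]
        ring

end partD

section partE
open Filter Topology
open scoped ContDiff

variable {E : Type*} [NormedAddCommGroup E] [NormedSpace ℂ E]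

theorem implicit_ana [CompleteSpace E] (A : E × ℂ → ℂ) (hA : AnalyticAt ℂ A 0) (hA0 : A 0 = 0)
    (hd : deriv (fun s : ℂ => A (0, s)) 0 ≠ 0) :
    ∃ φ : E → ℂ, AnalyticAt ℂ φ 0 ∧ φ 0 = 0 ∧ ∀ᶠ x in 𝓝 (0 : E), A (x, φ x) = 0 := by
  have cdf : ContDiffAt ℂ ω A 0 := hA.contDiffAt
  have hder : HasDerivAt (fun s : ℂ => A (0, s)) (fderiv ℂ A 0 (0, 1)) 0 := by
    have h1 : HasFDerivAt A (fderiv ℂ A 0) ((0 : E), (0 : ℂ)) := hA.differentiableAt.hasFDerivAt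
    have h2 : HasDerivAt (fun s : ℂ => ((0 : E), s)) ((0 : E), (1 : ℂ)) 0 :=
      (hasDerivAt_const _ _).prodMk (hasDerivAt_id _)
    exact h1.comp_hasDerivAt (0 : ℂ) h2
  rw [hder.deriv] at hd
  have inv : (fderiv ℂ A 0 ∘L .inr ℂ E ℂ).IsInvertible := by
    refine ⟨ContinuousLinearEquiv.unitsEquivAut ℂ (Units.mk0 _ hd), ?_⟩
    ext
    simp
  refine ⟨cdf.implicitFunction (by simp) inv, ?_, ?_, ?_⟩
  · exact (cdf.contDiffAt_implicitFunction (by simp) inv).analyticAt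
  · exact cdf.implicitFunction_apply_self (by simp) inv
  · have := cdf.eventually_apply_implicitFunction (by simp) inv
    rw [hA0] at this
    exact this

theorem tsch1 (d : ℕ) (hd : 1 ≤ d) (q : ℂ → ℂ) (hq : AnalyticAt ℂ q 0)
    (A : ℕ → ℂ → ℂ) (hA : ∀ j, AnalyticAt ℂ (A j) 0) (u : ℂ × ℂ → ℂ) (hu : AnalyticAt ℂ u 0)
    (h : ∀ᶠ p in 𝓝 (0 : ℂ × ℂ), (p.1 + p.2) ^ d * q (p.1 + p.2) =
      ∑ j ∈ Finset.range d, A j p.1 * p.2 ^ j + p.2 ^ d * u p) :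
    (∀ j < d, A j 0 = 0) ∧ deriv (A (d - 1)) 0 = d * q 0 ∧ u 0 = q 0 := by
  have hi : Tendsto (fun t : ℂ => ((0 : ℂ), t)) (𝓝 0) (𝓝 0) := by
    have : Continuous (fun t : ℂ => ((0 : ℂ), t)) := by fun_prop
    exact this.tendsto' _ _ rfl
  have h0 := hi.eventually h
  have hu1 : ContinuousAt (fun t : ℂ => u (0, t)) 0 := by
    have : ContinuousAt u ((0 : ℂ), (0 : ℂ)) := hu.continuousAt
    exact ContinuousAt.comp (f := fun t : ℂ => ((0 : ℂ), t)) this (by fun_prop)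
  have c1 : ∀ j < d, A j 0 = 0 := by
    refine taylor_unique d (fun j => A j 0) (fun t => q t - u (0, t)) (hq.continuousAt.sub hu1) ?_
    filter_upwards [h0] with t ht
    simp only [zero_add] at ht
    linear_combination -ht
  refine ⟨c1, ?_, ?_⟩
  · have hfd : ContinuousAt (fun t : ℂ => fderiv ℂ u (0, t) (1, 0)) 0 := by
      have h1 : ContinuousAt (fderiv ℂ u) ((0 : ℂ), (0 : ℂ)) := hu.fderiv.continuousAt
      have h2 := ContinuousAt.comp (f := fun t : ℂ => ((0 : ℂ), t)) h1 (by fun_prop)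
      exact h2.clm_apply continuousAt_const
    have hds : ContinuousAt (dslope q 0) 0 := continuousAt_dslope_same.2 hq.differentiableAt
    have key : ∀ᶠ t in 𝓝 (0 : ℂ), d * t ^ (d - 1) * q t + t ^ d * deriv q t =
        ∑ j ∈ Finset.range d, deriv (A j) 0 * t ^ j + t ^ d * fderiv ℂ u (0, t) (1, 0) := by
      have e1 := hi.eventually h.eventually_nhds
      have e2 := hi.eventually hu.eventually_analyticAt
      filter_upwards [e1, e2, hq.eventually_analyticAt] with t ht hut hqt
      have hj : Tendsto (fun s : ℂ => (s, t)) (𝓝 0) (𝓝 (0, t)) := by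
        have : Continuous (fun s : ℂ => (s, t)) := by fun_prop
        exact this.tendsto' _ _ rfl
      have h1 := hj.eventually ht
      have d1 : HasDerivAt (fun s : ℂ => (s + t) ^ d * q (s + t))
          (d * t ^ (d - 1) * q t + t ^ d * deriv q t) 0 := by
        have a1 : HasDerivAt (fun s : ℂ => s + t) 1 0 := (hasDerivAt_id _).add_const t
        have a2 : HasDerivAt q (deriv q t) (0 + t) := by
          rw [zero_add]; exact hqt.differentiableAt.hasDerivAt
        have a3 := (a1.fun_pow d).mul (a2.comp (0 : ℂ) a1)
        refine HasDerivAt.congr_deriv (f := fun s : ℂ => (s + t) ^ d * q (s + t)) a3 ?_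
        simp
      have d2 : HasDerivAt (fun s : ℂ => ∑ j ∈ Finset.range d, A j s * t ^ j + t ^ d * u (s, t))
          (∑ j ∈ Finset.range d, deriv (A j) 0 * t ^ j + t ^ d * fderiv ℂ u (0, t) (1, 0)) 0 := by
        refine HasDerivAt.add (HasDerivAt.fun_sum fun j _ =>
          (hA j).differentiableAt.hasDerivAt.mul_const _) (HasDerivAt.const_mul _ ?_)
        have h2 : HasDerivAt (fun s : ℂ => (s, t)) ((1 : ℂ), (0 : ℂ)) 0 :=
          (hasDerivAt_id _).prodMk (hasDerivAt_const _ _)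
        exact hut.differentiableAt.hasFDerivAt.comp_hasDerivAt (0 : ℂ) h2
      exact d1.unique (d2.congr_of_eventuallyEq h1)
    have := taylor_unique d (fun j => deriv (A j) 0 - if j = d - 1 then d * q 0 else 0)
      (fun t => deriv q t + d * dslope q 0 t - fderiv ℂ u (0, t) (1, 0))
      (((hq.deriv.continuousAt).add (continuousAt_const.mul hds)).sub hfd) (by
        filter_upwards [key] with t ht
        have e : ∑ j ∈ Finset.range d, (deriv (A j) 0 - if j = d - 1 then d * q 0 else 0) * t ^ j =
            ∑ j ∈ Finset.range d, deriv (A j) 0 * t ^ j - d * q 0 * t ^ (d - 1) := by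
          simp only [sub_mul, Finset.sum_sub_distrib, ite_mul, zero_mul, Finset.sum_ite_eq',
            Finset.mem_range]
          rw [if_pos (by omega)]
        have e3 : q t - q 0 = t * dslope q 0 t := by
          have := sub_smul_dslope q 0 t
          simpa using this.symm
        have e4 : t ^ d = t ^ (d - 1) * t := by rw [← pow_succ]; congr 1; omega
        rw [e]
        rw [e4] at ht ⊢
        linear_combination -ht + d * t ^ (d - 1) * e3) (d - 1) (by omega)
    simpa [sub_eq_zero] using this
  · have h2 : ∀ᶠ t in 𝓝[≠] (0 : ℂ), u (0, t) = q t := by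
      filter_upwards [h0.filter_mono nhdsWithin_le_nhds, self_mem_nhdsWithin] with t ht ht0
      rw [Finset.sum_eq_zero (fun j hj => by rw [c1 j (Finset.mem_range.1 hj), zero_mul])] at ht
      simp only [zero_add] at ht
      exact (mul_left_cancel₀ (pow_ne_zero d ht0) ht).symm
    have l1 := hu1.tendsto.mono_left (nhdsWithin_le_nhds (s := {0}ᶜ))
    have l2 := hq.continuousAt.tendsto.mono_left (nhdsWithin_le_nhds (s := {0}ᶜ))
    exact tendsto_nhds_unique_of_eventuallyEq l1 l2 h2

theorem tsch {n : ℕ} (d : ℕ) (hd : 1 ≤ d) (F : (Fin n → ℂ) × ℂ → ℂ) (hF : AnalyticAt ℂ F 0)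
    (hO : OrdC F d) : ∃ (φ : (Fin n → ℂ) → ℂ) (a : ℕ → (Fin n → ℂ) → ℂ) (u : (Fin n → ℂ) × ℂ → ℂ),
      AnalyticAt ℂ φ 0 ∧ φ 0 = 0 ∧ (∀ j, AnalyticAt ℂ (a j) 0) ∧ AnalyticAt ℂ u 0 ∧ u 0 ≠ 0 ∧
      (∀ᶠ x in 𝓝 (0 : Fin n → ℂ), a (d - 1) x = 0) ∧
      ∀ᶠ p in 𝓝 (0 : (Fin n → ℂ) × ℂ), F (p.1, p.2 + φ p.1) =
        ∑ j ∈ Finset.range d, a j p.1 * p.2 ^ j + p.2 ^ d * u p := by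
  obtain ⟨q, hq, hq0, hqe⟩ := hO
  let H : ((Fin n → ℂ) × ℂ) × ℂ → ℂ := fun w => F (w.1.1, w.1.2 + w.2)
  have hH : AnalyticAt ℂ H 0 := by
    refine ana_comp0 (π := fun w : ((Fin n → ℂ) × ℂ) × ℂ => (w.1.1, w.1.2 + w.2)) hF ?_ (by simp)
    exact (analyticAt_fst.comp analyticAt_fst).prod
      ((analyticAt_snd.comp analyticAt_fst).add analyticAt_snd)
  obtain ⟨A, u, hA, hu, hHe⟩ := taylor_expand H hH d
  have hj : AnalyticAt ℂ (fun s : ℂ => ((0 : Fin n → ℂ), s)) 0 := analyticAt_const.prod analyticAt_id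
  have hk : AnalyticAt ℂ (fun p : ℂ × ℂ => (((0 : Fin n → ℂ), p.1), p.2)) 0 :=
    (analyticAt_const.prod analyticAt_fst).prod analyticAt_snd
  obtain ⟨t1, t2, t3⟩ := tsch1 d hd q hq (fun j s => A j (0, s)) (fun j => ana_comp0 (hA j) hj rfl)
    (fun p => u ((0, p.1), p.2)) (ana_comp0 hu hk rfl) (by
      have hs : Tendsto (fun p : ℂ × ℂ => p.1 + p.2) (𝓝 0) (𝓝 0) := by
        have : Continuous (fun p : ℂ × ℂ => p.1 + p.2) := by fun_prop
        exact this.tendsto' _ _ (by simp)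
      filter_upwards [(tendsto0 hk rfl).eventually hHe, hs.eventually hqe] with p hp hp'
      rw [← hp']
      exact hp)
  obtain ⟨φ, hφ, hφ0, hφe⟩ := implicit_ana (A (d - 1)) (hA _) (t1 (d - 1) (by omega)) (by
    rw [t2]
    exact mul_ne_zero (by exact_mod_cast (by omega : d ≠ 0)) hq0)
  have hm : AnalyticAt ℂ (fun x : Fin n → ℂ => (x, φ x)) 0 := analyticAt_id.prod hφ
  have hm0 : ((0 : Fin n → ℂ), φ 0) = 0 := by rw [hφ0]; rfl
  have hw : AnalyticAt ℂ (fun p : (Fin n → ℂ) × ℂ => ((p.1, φ p.1), p.2)) 0 :=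
    (analyticAt_fst.prod (ana_comp0 hφ analyticAt_fst rfl)).prod analyticAt_snd
  have hw0 : (((0 : (Fin n → ℂ) × ℂ).1, φ (0 : (Fin n → ℂ) × ℂ).1), (0 : (Fin n → ℂ) × ℂ).2) = 0 := by
    simp [hφ0]
  refine ⟨φ, fun j x => A j (x, φ x), fun p => u ((p.1, φ p.1), p.2), hφ, hφ0,
    fun j => ana_comp0 (hA j) hm hm0, ana_comp0 hu hw hw0, ?_, hφe, ?_⟩
  · simp only [hw0]
    have : u 0 = q 0 := t3
    rw [this]; exact hq0
  · filter_upwards [(tendsto0 hw hw0).eventually hHe] with p hp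
    rw [← hp]
    simp only [H, add_comm]

end partE

section partF
open Filter Topology

/-- Monomialisation statement in dimension `n`. -/
def MS (n : ℕ) : Prop := ∀ (F : (Fin n → ℂ) → ℂ) (U : Ultrafilter (Fin n → ℂ)),
  AnalyticAt ℂ F 0 → (¬ ∀ᶠ x in 𝓝 (0 : Fin n → ℂ), F x = 0) →
  (U : Filter (Fin n → ℂ)) ≤ 𝓝 0 → Res n F U

theorem Lifts.prod {n m : ℕ} {U : Ultrafilter ((Fin n → ℂ) × ℂ)}
    (hU : (U : Filter ((Fin n → ℂ) × ℂ)) ≤ 𝓝 0)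
    {π : (Fin m → ℂ) → (Fin n → ℂ)} {ρ : (Fin n → ℂ) → (Fin m → ℂ)} (h : Lifts (U.map Prod.fst) π ρ) :
    Lifts U (fun p : (Fin m → ℂ) × ℂ => (π p.1, p.2)) (fun p : (Fin n → ℂ) × ℂ => (ρ p.1, p.2)) := by
  obtain ⟨h1, h2, h3, h4⟩ := h
  refine ⟨(ana_comp0 h1 analyticAt_fst rfl).prod analyticAt_snd, ?_, ?_, ?_⟩
  · simp [h2]
  · have h5 : Tendsto (fun p : (Fin n → ℂ) × ℂ => p.2) U (𝓝 0) :=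
      (continuous_snd.tendsto' 0 0 rfl).mono_left hU
    rw [Ultrafilter.coe_map] at h3
    exact (h3.comp tendsto_map).prodMk_nhds h5
  · rw [Ultrafilter.coe_map, eventually_map] at h4
    filter_upwards [h4] with p hp
    rw [hp]

theorem fst_le {n : ℕ} {U : Ultrafilter ((Fin n → ℂ) × ℂ)}
    (hU : (U : Filter ((Fin n → ℂ) × ℂ)) ≤ 𝓝 0) :
    ((U.map Prod.fst : Ultrafilter (Fin n → ℂ)) : Filter (Fin n → ℂ)) ≤ 𝓝 0 :=
  (continuous_fst.tendsto' (0 : (Fin n → ℂ) × ℂ) 0 rfl).mono_left hU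

theorem mnm_pw {n : ℕ} (m : ℕ) (γ : Fin n → ℕ) (y : Fin n → ℂ) :
    mnm γ (fun i => y i ^ m) = mnm (m • γ) y := by
  simp [mnm, pow_mul]

theorem Lifts.pw {n : ℕ} (m : ℕ) (hm : m ≠ 0) {U : Ultrafilter (Fin n → ℂ)}
    (hU : (U : Filter (Fin n → ℂ)) ≤ 𝓝 0) :
    Lifts U (fun y : Fin n → ℂ => fun i => y i ^ m) (fun x : Fin n → ℂ => fun i => x i ^ ((m : ℂ)⁻¹)) := by
  refine Lifts.of_cont hU ?_ ?_ ?_ ?_ ?_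
  · rw [analyticAt_pi_iff]
    exact fun i => (coord_ana i 0).pow m
  · funext i; simp [hm]
  · rw [continuousAt_pi]
    intro i
    have h1 : ContinuousAt (fun z : ℂ => z ^ ((m : ℂ)⁻¹)) 0 := by
      refine Complex.continuousAt_cpow_const_of_re_pos (Or.inl (by simp)) ?_
      have : ((m : ℂ)⁻¹) = ((m : ℝ)⁻¹ : ℝ) := by push_cast; rfl
      rw [this, Complex.ofReal_re]
      have : 0 < m := Nat.pos_of_ne_zero hm
      positivity
    exact ContinuousAt.comp (f := fun x : Fin n → ℂ => x i) (g := fun z : ℂ => z ^ ((m : ℂ)⁻¹)) (by simpa using h1)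
      (continuous_apply i).continuousAt
  · funext i; simp [hm]
  · refine Eventually.of_forall fun x => ?_
    funext i
    exact Complex.cpow_nat_inv_pow _ hm

theorem caseA {n : ℕ} (hMS : MS n) (d : ℕ) (u : (Fin n → ℂ) × ℂ → ℂ) (hu : AnalyticAt ℂ u 0)
    (hu0 : u 0 ≠ 0) (G : (Fin n → ℂ) → ℂ) (hG : AnalyticAt ℂ G 0)
    (hGn : ¬ ∀ᶠ x in 𝓝 (0 : Fin n → ℂ), G x = 0) (U : Ultrafilter ((Fin n → ℂ) × ℂ))
    (hU : (U : Filter ((Fin n → ℂ) × ℂ)) ≤ 𝓝 0) :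
    Res (n + 1) (fun p => G p.1 * (p.2 ^ d * u p)) U := by
  obtain ⟨π, ρ, hl, κ, v, hv, hv0, hκ⟩ := hMS G (U.map Prod.fst) hG hGn (fst_le hU)
  have hl' := hl.prod hU
  refine Res.trans hl' ?_
  refine Res_final hl'.le κ d (fun p => v p.1 * u (π p.1, p.2)) ?_ ?_ ?_
  · exact (ana_comp0 hv analyticAt_fst rfl).mul (ana_comp0 hu hl'.1 hl'.2.1)
  · have := hl'.2.1
    simp only at this
    rw [this]
    exact mul_ne_zero hv0 hu0
  · have := (continuous_fst.tendsto' (0 : (Fin n → ℂ) × ℂ) 0 rfl).eventually hκ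
    filter_upwards [this] with p hp
    rw [hp]; ring

theorem prep {n d : ℕ} (hd : 1 ≤ d) (hMS : MS n) (IH : ∀ d' < d, PS n d')
    (a : ℕ → (Fin n → ℂ) → ℂ) (ha : ∀ j, AnalyticAt ℂ (a j) 0)
    (u : (Fin n → ℂ) × ℂ → ℂ) (hu : AnalyticAt ℂ u 0)
    (hu0 : u 0 ≠ 0) (G : (Fin n → ℂ) → ℂ) (hG : AnalyticAt ℂ G 0)
    (hGn : ¬ ∀ᶠ x in 𝓝 (0 : Fin n → ℂ), G x = 0)
    (had : ∀ᶠ x in 𝓝 (0 : Fin n → ℂ), a (d - 1) x = 0) (U : Ultrafilter ((Fin n → ℂ) × ℂ))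
    (hU : (U : Filter ((Fin n → ℂ) × ℂ)) ≤ 𝓝 0) :
    Res (n + 1) (fun p => G p.1 * (∑ j ∈ Finset.range d, a j p.1 * p.2 ^ j + p.2 ^ d * u p)) U := by
  classical
  let J : Finset ℕ := (Finset.range d).filter fun j => ¬ ∀ᶠ x in 𝓝 (0 : Fin n → ℂ), a j x = 0
  have hJ : ∀ j, j ∈ J ↔ j < d ∧ ¬ ∀ᶠ x in 𝓝 (0 : Fin n → ℂ), a j x = 0 := by
    intro j; simp only [J, Finset.mem_filter, Finset.mem_range]
  have hJ0 : ∀ᶠ x in 𝓝 (0 : Fin n → ℂ), ∀ j ∈ Finset.range d, j ∉ J → a j x = 0 := by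
    rw [Filter.eventually_all_finset]
    intro j hj
    by_cases h : j ∈ J
    · simp [h]
    · rw [hJ] at h
      push Not at h
      exact (h (Finset.mem_range.1 hj)).mono fun x hx _ => hx
  by_cases hJe : J.Nonempty
  swap
  · rw [Finset.not_nonempty_iff_eq_empty] at hJe
    refine (caseA hMS d u hu hu0 G hG hGn U hU).congr ?_
    filter_upwards [(continuous_fst.tendsto' (0 : (Fin n → ℂ) × ℂ) 0 rfl).eventually hJ0] with p hp
    rw [Finset.sum_eq_zero, zero_add]
    intro j hj
    rw [hp j hj (by simp [hJe]), zero_mul]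
  -- main case
  let m := d.factorial
  have hm : m ≠ 0 := Nat.factorial_ne_zero d
  let e : ℕ → ℕ := fun j => m / (d - j)
  have he : ∀ j < d, (d - j) * e j = m := fun j hj =>
    Nat.mul_div_cancel' (Nat.dvd_factorial (by omega) (by omega))
  let D : ℕ × ℕ → (Fin n → ℂ) → ℂ := fun jk x => a jk.1 x ^ e jk.1 - a jk.2 x ^ e jk.2
  have hD : ∀ jk, AnalyticAt ℂ (D jk) 0 := fun jk => ((ha _).pow _).sub ((ha _).pow _)
  let K : Finset (ℕ × ℕ) := (J ×ˢ J).filter fun jk => ¬ ∀ᶠ x in 𝓝 (0 : Fin n → ℂ), D jk x = 0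
  obtain ⟨hP1, hP1n⟩ := ana_prod_ne J a (fun j _ => ha j) (fun j hj => ((hJ j).1 hj).2)
  obtain ⟨hP2, hP2n⟩ := ana_prod_ne K D (fun j _ => hD j) (fun j hj => (Finset.mem_filter.1 hj).2)
  have hGP1 : AnalyticAt ℂ (fun x => G x * ∏ j ∈ J, a j x) 0 := hG.mul hP1
  have hGP1n : ¬ ∀ᶠ x in 𝓝 (0 : Fin n → ℂ), G x * ∏ j ∈ J, a j x = 0 := fun h =>
    (ana_domain hG hP1 h).elim hGn hP1n
  have hHn : ¬ ∀ᶠ x in 𝓝 (0 : Fin n → ℂ), (G x * ∏ j ∈ J, a j x) * ∏ k ∈ K, D k x = 0 := fun h =>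
    (ana_domain hGP1 hP2 h).elim hGP1n hP2n
  obtain ⟨π, ρ, hl, hM⟩ := hMS (fun x => (G x * ∏ j ∈ J, a j x) * ∏ k ∈ K, D k x) (U.map Prod.fst)
    (hGP1.mul hP2) hHn (fst_le hU)
  have hcomp : ∀ {F : (Fin n → ℂ) → ℂ}, AnalyticAt ℂ F 0 → AnalyticAt ℂ (fun x => F (π x)) 0 :=
    fun h => ana_comp0 h hl.1 hl.2.1
  obtain ⟨hM1, hM2⟩ := IsMono.factor (F := fun x => G (π x) * ∏ j ∈ J, a j (π x))
    (G := fun x => ∏ k ∈ K, D k (π x)) (hcomp hGP1) (hcomp hP2) hM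
  obtain ⟨hM3, hM4⟩ := IsMono.factor (F := fun x => G (π x)) (G := fun x => ∏ j ∈ J, a j (π x))
    (hcomp hG) (hcomp hP1) hM1
  have hM5 := IsMono.factor_prod J (F := fun j x => a j (π x)) (fun j _ => hcomp (ha j)) hM4
  have hM6 := IsMono.factor_prod K (F := fun j x => D j (π x)) (fun j _ => hcomp (hD j)) hM2
  obtain ⟨κ, v, hv, hv0, hκ⟩ := hM3
  have hM5' : ∀ j, ∃ (α : Fin n → ℕ) (w : (Fin n → ℂ) → ℂ), AnalyticAt ℂ w 0 ∧ w 0 ≠ 0 ∧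
      (j ∈ J → ∀ᶠ x in 𝓝 (0 : Fin n → ℂ), a j (π x) = mnm α x * w x) := by
    intro j
    by_cases hj : j ∈ J
    · obtain ⟨α, w, h1, h2, h3⟩ := hM5 j hj
      exact ⟨α, w, h1, h2, fun _ => h3⟩
    · exact ⟨0, fun _ => 1, analyticAt_const, one_ne_zero, fun h => absurd h hj⟩
  choose α w hw hw0 hαw using hM5'
  have hcmp : ∀ j ∈ J, ∀ k ∈ J, e j • α j ≤ e k • α k ∨ e k • α k ≤ e j • α j := by
    intro j hj k hk
    refine mono_compare _ _ (fun x => w j x ^ e j) (fun x => w k x ^ e k) ((hw j).pow _) ((hw k).pow _)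
      (pow_ne_zero _ (hw0 j)) (pow_ne_zero _ (hw0 k)) ?_
    have heq : ∀ᶠ x in 𝓝 (0 : Fin n → ℂ), mnm (e j • α j) x * w j x ^ e j - mnm (e k • α k) x * w k x ^ e k
        = D (j, k) (π x) := by
      filter_upwards [hαw j hj, hαw k hk] with x h1 h2
      simp only [D, h1, h2, mnm_smul, mul_pow]
    by_cases hK : (j, k) ∈ K
    · exact Or.inr ((hM6 _ hK).congr heq)
    · left
      have : ∀ᶠ x in 𝓝 (0 : Fin n → ℂ), D (j, k) x = 0 := by
        by_contra hc
        exact hK (Finset.mem_filter.2 ⟨Finset.mk_mem_product hj hk, hc⟩)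
      filter_upwards [heq, (tendsto0 hl.1 hl.2.1).eventually this] with x h1 h2
      rw [h1, h2]
  obtain ⟨j0, hj0, hmin⟩ : ∃ j0 ∈ J, ∀ j ∈ J, e j0 • α j0 ≤ e j • α j := by
    obtain ⟨j0, hj0, hmin⟩ := exists_minimalFor_of_wellFoundedLT (fun j => j ∈ J) (fun j => e j • α j) hJe
    exact ⟨j0, hj0, fun j hj => (hcmp j0 hj0 j hj).elim id fun h => hmin hj h⟩
  have hj0d := ((hJ j0).1 hj0).1
  -- power substitution
  have hl2 := hl.trans (Lifts.pw m hm hl.le)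
  have hl3 := hl2.prod hU
  refine Res.trans hl3 ?_
  let P : (Fin n → ℂ) → (Fin n → ℂ) := fun y i => y i ^ m
  have hP : AnalyticAt ℂ P 0 := (Lifts.pw m hm hl.le).1
  have hP0 : P 0 = 0 := (Lifts.pw m hm hl.le).2.1
  let A : Fin n → ℕ := e j0 • α j0
  let b : ℕ → (Fin n → ℂ) → ℂ := fun j => if j ∈ J then
    (fun y => mnm ((d - j) • (e j • α j - A)) y * w j (P y)) else fun _ => 0
  have hb : ∀ j, AnalyticAt ℂ (b j) 0 := by
    intro j
    by_cases hj : j ∈ J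
    · simp only [b, if_pos hj]
      exact (mnm_ana _ 0).mul (ana_comp0 (hw j) hP hP0)
    · simp only [b, if_neg hj]; exact analyticAt_const
  have hdes := descent hd IH _ A rfl b (fun p => u (π (P p.1), p.2)) (m • κ) (fun y => v (P y)) _ hl3.le hb
    (ana_comp0 hu hl3.1 hl3.2.1)
    (by
      have : (π (P (0 : (Fin n → ℂ) × ℂ).1), (0 : (Fin n → ℂ) × ℂ).2) = 0 := hl3.2.1
      rw [this]; exact hu0)
    (ana_comp0 hv hP hP0) (by simp only [hP0]; exact hv0)
    (by
      have : d - 1 ∉ J := by rw [hJ]; exact fun h => h.2 had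
      simp only [b, if_neg this])
    ⟨j0, hj0d, by
      simp only [b, if_pos hj0, A]
      rw [tsub_self, smul_zero, mnm_zero, one_mul, hP0]
      exact hw0 j0⟩
  refine hdes.congr ?_
  have hfst : Tendsto (fun p : (Fin n → ℂ) × ℂ => P p.1) (𝓝 0) (𝓝 0) :=
    (tendsto0 hP hP0).comp (continuous_fst.tendsto' (0 : (Fin n → ℂ) × ℂ) 0 rfl)
  have hall : ∀ᶠ x in 𝓝 (0 : Fin n → ℂ), ∀ j ∈ J, a j (π x) = mnm (α j) x * w j x := by
    rw [Filter.eventually_all_finset]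
    exact fun j hj => hαw j hj
  filter_upwards [hfst.eventually hκ, hfst.eventually hall,
    hfst.eventually ((tendsto0 hl.1 hl.2.1).eventually hJ0)] with p h1 h2 h3
  show G (π (P p.1)) * (∑ j ∈ Finset.range d, a j (π (P p.1)) * p.2 ^ j + p.2 ^ d * u (π (P p.1), p.2)) = _
  have h1' : G (π (P p.1)) = mnm (m • κ) p.1 * v (P p.1) := by
    rw [h1]
    congr 1
    exact mnm_pw m κ p.1
  rw [h1']
  congr 2
  refine Finset.sum_congr rfl fun j hj => ?_
  congr 1
  by_cases hjJ : j ∈ J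
  · rw [h2 j hjJ]
    simp only [b, if_pos hjJ]
    rw [← mul_assoc, ← mnm_add, ← smul_add, add_tsub_cancel_of_le (hmin j hjJ), ← mul_smul,
      he j (Finset.mem_range.1 hj)]
    congr 1
    exact mnm_pw m (α j) p.1
  · rw [h3 j hj hjJ]
    simp only [b, if_neg hjJ, mul_zero]

theorem PS_all {n : ℕ} (hMS : MS n) : ∀ d, PS n d := by
  intro d
  induction d using Nat.strong_induction_on with
  | _ d IH =>
    intro F G U hF hG hGn hU hO
    rcases Nat.eq_zero_or_pos d with rfl | hd
    · obtain ⟨q, hq, hq0, hqe⟩ := hO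
      have hF0 : F 0 ≠ 0 := by
        have := hqe.self_of_nhds
        rw [pow_zero, one_mul] at this
        have h2 : F 0 = q 0 := this
        rw [h2]; exact hq0
      have := caseA hMS 0 F hF hF0 G hG hGn U hU
      simpa only [pow_zero, one_mul] using this
    · obtain ⟨φ, a, u, hφ, hφ0, ha, hu, hu0, had, hFe⟩ := tsch d hd F hF hO
      have hφ' : AnalyticAt ℂ (fun p : (Fin n → ℂ) × ℂ => φ p.1) 0 := ana_comp0 hφ analyticAt_fst rfl
      have hl : Lifts U (fun p : (Fin n → ℂ) × ℂ => (p.1, p.2 + φ p.1))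
          (fun p : (Fin n → ℂ) × ℂ => (p.1, p.2 - φ p.1)) := by
        refine Lifts.of_cont hU (analyticAt_fst.prod (analyticAt_snd.add hφ')) (by simp [hφ0])
          (continuousAt_fst.prodMk (continuousAt_snd.sub hφ'.continuousAt)) (by simp [hφ0]) ?_
        exact Eventually.of_forall fun p => by simp
      refine Res.trans hl ?_
      refine (prep hd hMS IH a ha u hu hu0 G hG hGn had _ hl.le).congr ?_
      filter_upwards [hFe] with p hp
      rw [hp]

theorem line_ne {E : Type*} [NormedAddCommGroup E] [NormedSpace ℂ E] (F : E → ℂ)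
    (hF : AnalyticAt ℂ F 0) (hFn : ¬ ∀ᶠ x in 𝓝 (0 : E), F x = 0) :
    ∃ v : E, ¬ ∀ᶠ t in 𝓝 (0 : ℂ), F (t • v) = 0 := by
  by_contra hc
  push Not at hc
  apply hFn
  obtain ⟨r, hr, hball⟩ := Metric.eventually_nhds_iff_ball.1 hF.eventually_analyticAt
  filter_upwards [Metric.ball_mem_nhds (0 : E) hr] with x hx
  let T : Set ℂ := {t | t • x ∈ Metric.ball (0 : E) r}
  have hT : IsPreconnected T := by
    have h1 : Convex ℝ (Metric.ball (0 : E) r) := convex_ball 0 r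
    have h2 : Convex ℝ T := by
      intro s hs t ht a b ha hb hab
      have := h1 hs ht ha hb hab
      simp only [T, Set.mem_ofPred_eq]
      convert this using 1
      rw [add_smul, smul_assoc, smul_assoc]
    exact h2.isPreconnected
  have han : AnalyticOnNhd ℂ (fun t : ℂ => F (t • x)) T := by
    intro t ht
    have h1 : AnalyticAt ℂ (fun t : ℂ => t • x) t := analyticAt_id.smul analyticAt_const
    exact AnalyticAt.fun_comp (hball _ ht) h1
  have := han.eqOn_zero_of_preconnected_of_eventuallyEq_zero hT
    (show (0 : ℂ) ∈ T by simp [T, hr]) (hc x)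
  have h3 := this (show (1 : ℂ) ∈ T by simpa [T] using hx)
  simpa using h3

theorem Res_unit {n : ℕ} (F : (Fin n → ℂ) → ℂ) (U : Ultrafilter (Fin n → ℂ))
    (hF : AnalyticAt ℂ F 0) (hF0 : F 0 ≠ 0) (hU : (U : Filter (Fin n → ℂ)) ≤ 𝓝 0) : Res n F U :=
  ⟨id, id, Lifts.of_cont hU analyticAt_id rfl continuousAt_id rfl (Eventually.of_forall fun _ => rfl),
    0, F, hF, hF0, Eventually.of_forall fun x => by simp [mnm_zero]⟩

theorem MS_all : ∀ n, MS n := by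
  intro n
  induction n with
  | zero =>
    intro F U hF hFn hU
    refine Res_unit F U hF ?_ hU
    intro h0
    exact hFn (Eventually.of_forall fun x => by rw [Subsingleton.elim x 0, h0])
  | succ n ih =>
    intro F U hF hFn hU
    by_cases hF0 : F 0 = 0
    swap
    · exact Res_unit F U hF hF0 hU
    obtain ⟨v, hv⟩ := line_ne F hF hFn
    obtain ⟨k, hk⟩ : ∃ k, v k ≠ 0 := by
      by_contra hc
      push Not at hc
      have : v = 0 := funext hc
      subst this
      exact hv (Eventually.of_forall fun t => by rw [smul_zero, hF0])
    let π : (Fin n → ℂ) × ℂ → (Fin (n + 1) → ℂ) := fun p => p.2 • v + k.insertNth 0 p.1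
    let ρ : (Fin (n + 1) → ℂ) → (Fin n → ℂ) × ℂ := fun w =>
      (fun i => (w - (w k / v k) • v) (k.succAbove i), w k / v k)
    have hins0 : (k.insertNth (0 : ℂ) (0 : Fin n → ℂ) : Fin (n + 1) → ℂ) = 0 := by
      funext i
      refine Fin.succAboveCases k ?_ (fun j => ?_) i <;> simp
    have hπ : AnalyticAt ℂ π 0 := by
      refine (analyticAt_snd.smul analyticAt_const).add ?_
      rw [analyticAt_pi_iff]
      intro i
      refine Fin.succAboveCases k ?_ (fun j => ?_) i
      · simpa using analyticAt_const
      · simpa using ana_c j 0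
    have hl : Lifts U π ρ := by
      refine Lifts.of_cont hU hπ ?_ ?_ ?_ ?_
      · simp only [π, Prod.fst_zero, Prod.snd_zero, hins0]; simp
      · refine Continuous.continuousAt ?_
        have h1 : Continuous fun w : Fin (n + 1) → ℂ => w k / v k := (continuous_apply k).div_const _
        refine Continuous.prodMk (continuous_pi fun i => ?_) h1
        simp only [Pi.sub_apply, Pi.smul_apply]
        exact (continuous_apply _).sub (h1.smul continuous_const)
      · simp [ρ]; rfl
      · refine Eventually.of_forall fun w => ?_
        funext i
        refine Fin.succAboveCases k ?_ (fun j => ?_) i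
        · simp [π, ρ, hk]
        · simp [π, ρ]
    refine Res.trans hl ?_
    have hFπ : AnalyticAt ℂ (fun p => F (π p)) 0 := ana_comp0 hF hπ hl.2.1
    have h2 : ¬ ∀ᶠ t in 𝓝 (0 : ℂ), F (π (0, t)) = 0 := by
      simpa only [π, hins0, add_zero] using hv
    have h1 : AnalyticAt ℂ (fun t : ℂ => F (π (0, t))) 0 := by
      have : AnalyticAt ℂ (fun t : ℂ => ((0 : Fin n → ℂ), t)) 0 := analyticAt_const.prod analyticAt_id
      exact ana_comp0 (F := fun p => F (π p)) hFπ this rfl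
    obtain ⟨d, q, hq, hq0, hm⟩ := h1.exists_eventuallyEq_pow_smul_nonzero_iff.2 h2
    simp only [sub_zero, smul_eq_mul] at hm
    have := PS_all ih d (fun p => F (π p)) (fun _ => 1) (U.map ρ) hFπ analyticAt_const
      (fun h => one_ne_zero h.self_of_nhds) hl.le ⟨q, hq, hq0, hm⟩
    simpa only [one_mul] using this

end partF

section partG
open Filter Topology
open scoped ContDiff

variable {E : Type*} [NormedAddCommGroup E] [NormedSpace ℂ E]

theorem implicit_ana2 [CompleteSpace E] (A : E × ℂ → ℂ) (hA : AnalyticAt ℂ A 0) (hA0 : A 0 = 0)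
    (hd : deriv (fun s : ℂ => A (0, s)) 0 ≠ 0) :
    ∃ φ : E → ℂ, AnalyticAt ℂ φ 0 ∧ φ 0 = 0 ∧ (∀ᶠ x in 𝓝 (0 : E), A (x, φ x) = 0) ∧
      ∀ᶠ p in 𝓝 (0 : E × ℂ), A p = 0 → φ p.1 = p.2 := by
  have cdf : ContDiffAt ℂ ω A 0 := hA.contDiffAt
  have hder : HasDerivAt (fun s : ℂ => A (0, s)) (fderiv ℂ A 0 (0, 1)) 0 := by
    have h1 : HasFDerivAt A (fderiv ℂ A 0) ((0 : E), (0 : ℂ)) := hA.differentiableAt.hasFDerivAt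
    have h2 : HasDerivAt (fun s : ℂ => ((0 : E), s)) ((0 : E), (1 : ℂ)) 0 :=
      (hasDerivAt_const _ _).prodMk (hasDerivAt_id _)
    exact h1.comp_hasDerivAt (0 : ℂ) h2
  rw [hder.deriv] at hd
  have inv : (fderiv ℂ A 0 ∘L .inr ℂ E ℂ).IsInvertible := by
    refine ⟨ContinuousLinearEquiv.unitsEquivAut ℂ (Units.mk0 _ hd), ?_⟩
    ext
    simp
  refine ⟨cdf.implicitFunction (by simp) inv, ?_, ?_, ?_, ?_⟩
  · exact (cdf.contDiffAt_implicitFunction (by simp) inv).analyticAt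
  · exact cdf.implicitFunction_apply_self (by simp) inv
  · have := cdf.eventually_apply_implicitFunction (by simp) inv
    rw [hA0] at this
    exact this
  · have := cdf.eventually_apply_eq_iff_implicitFunction (by simp) inv
    rw [hA0] at this
    exact this.mono fun p hp => hp.1

theorem ana_root (v : E → ℂ) (hv : AnalyticAt ℂ v 0) (hv0 : v 0 ≠ 0) (m : ℕ) (hm : m ≠ 0) :
    ∃ r : E → ℂ, AnalyticAt ℂ r 0 ∧ r 0 ≠ 0 ∧ ∀ x, r x ^ m = v x := by
  refine ⟨fun x => (v 0) ^ ((m : ℂ)⁻¹) * (v x / v 0) ^ ((m : ℂ)⁻¹), ?_, ?_, ?_⟩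
  · refine analyticAt_const.mul (AnalyticAt.cpow (hv.div analyticAt_const hv0) analyticAt_const ?_)
    simp [hv0]
  · simp [hv0]
  · intro x
    rw [mul_pow, Complex.cpow_nat_inv_pow _ hm, Complex.cpow_nat_inv_pow _ hm]
    field_simp

theorem normalise {n : ℕ} (γ : Fin n → ℕ) (v : (Fin n → ℂ) → ℂ) (hv : AnalyticAt ℂ v 0) (hv0 : v 0 ≠ 0)
    (i₀ : Fin n) (hi : γ i₀ ≠ 0) (W : Ultrafilter (Fin n → ℂ)) (hW : (W : Filter (Fin n → ℂ)) ≤ 𝓝 0) :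
    ∃ Φ Ψ : (Fin n → ℂ) → (Fin n → ℂ), Lifts W Φ Ψ ∧
      (∀ᶠ y in 𝓝 (0 : Fin n → ℂ), mnm γ (Φ y) * v (Φ y) = mnm γ y) ∧
      ∀ F : (Fin n → ℂ) → ℂ, IsMono F → IsMono (fun y => F (Φ y)) := by
  obtain ⟨r, hr, hr0, hrv⟩ := ana_root v hv hv0 (γ i₀) hi
  let s₀ : ℂ := (r 0)⁻¹
  have hs₀ : s₀ ≠ 0 := inv_ne_zero hr0
  let B : (Fin n → ℂ) × ℂ → (Fin n → ℂ) := fun p => update p.1 i₀ ((p.2 + s₀) * p.1 i₀)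
  have hB : AnalyticAt ℂ B 0 := ana_update i₀ _ _ _ analyticAt_fst
    ((analyticAt_snd.add analyticAt_const).mul (ana_c i₀ 0))
  have hB0 : ∀ s, B (0, s) = 0 := by intro s; simp [B]
  let A : (Fin n → ℂ) × ℂ → ℂ := fun p => (p.2 + s₀) * r (B p) - 1
  have hA : AnalyticAt ℂ A 0 :=
    ((analyticAt_snd.add analyticAt_const).mul (ana_comp0 hr hB (hB0 0))).sub analyticAt_const
  have hAs : ∀ s, A (0, s) = (s + s₀) * r 0 - 1 := by intro s; simp only [A, hB0]
  obtain ⟨φ, hφ, hφ0, h1, h2⟩ := implicit_ana2 A hA (by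
      have := hAs 0
      rw [zero_add, inv_mul_cancel₀ hr0, sub_self] at this
      exact this) (by
      simp only [hAs]
      have : HasDerivAt (fun s : ℂ => (s + s₀) * r 0 - 1) (1 * r 0) 0 :=
        (((hasDerivAt_id (0 : ℂ)).add_const s₀).mul_const (r 0)).sub_const 1
      rw [this.deriv, one_mul]; exact hr0)
  let η : (Fin n → ℂ) → ℂ := fun y => φ y + s₀
  have hη : AnalyticAt ℂ η 0 := hφ.add analyticAt_const
  have hη0 : η 0 ≠ 0 := by simp only [η, hφ0, zero_add]; exact hs₀
  let Φ : (Fin n → ℂ) → (Fin n → ℂ) := fun y => update y i₀ (η y * y i₀)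
  let Ψ : (Fin n → ℂ) → (Fin n → ℂ) := fun x => update x i₀ (r x * x i₀)
  have hΦ : AnalyticAt ℂ Φ 0 := ana_update i₀ _ _ _ analyticAt_id (hη.mul (coord_ana i₀ 0))
  have hΨ : AnalyticAt ℂ Ψ 0 := ana_update i₀ _ _ _ analyticAt_id (hr.mul (coord_ana i₀ 0))
  have hΦ0 : Φ 0 = 0 := by simp [Φ]
  have hΨ0 : Ψ 0 = 0 := by simp [Ψ]
  have hl : Lifts W Φ Ψ := by
    refine Lifts.of_cont hW hΦ hΦ0 hΨ.continuousAt hΨ0 ?_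
    have ht : Tendsto (fun x => (Ψ x, (r x)⁻¹ - s₀)) (𝓝 0) (𝓝 ((0 : Fin n → ℂ), (0 : ℂ))) := by
      refine (tendsto0 hΨ hΨ0).prodMk_nhds ?_
      have := (hr.continuousAt.tendsto.inv₀ hr0).sub_const s₀
      simpa only [s₀, sub_self] using this
    filter_upwards [ht.eventually h2, hr.continuousAt.eventually_ne hr0] with x hx hrx
    have hBx : B (Ψ x, (r x)⁻¹ - s₀) = x := by
      simp only [B, Ψ, sub_add_cancel, update_self, update_idem]
      rw [inv_mul_cancel_left₀ hrx, update_eq_self]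
    have hAx : A (Ψ x, (r x)⁻¹ - s₀) = 0 := by
      simp only [A, hBx, sub_add_cancel]
      rw [inv_mul_cancel₀ hrx, sub_self]
    have h3 : φ (Ψ x) = (r x)⁻¹ - s₀ := hx hAx
    show B (Ψ x, φ (Ψ x)) = x
    rw [h3, hBx]
  refine ⟨Φ, Ψ, hl, ?_, ?_⟩
  · filter_upwards [h1] with y hy
    have e1 : mnm γ (Φ y) = mnm γ y * η y ^ γ i₀ := mnm_update γ y i₀ (η y)
    have e2 : η y * r (Φ y) = 1 := by
      have : η y * r (Φ y) - 1 = 0 := hy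
      exact sub_eq_zero.1 this
    rw [e1, ← hrv, mul_assoc, ← mul_pow, e2, one_pow, mul_one]
  · rintro F ⟨β, u, hu, hu0, hF⟩
    refine ⟨β, fun y => η y ^ β i₀ * u (Φ y), (hη.pow _).mul (ana_comp0 hu hΦ hΦ0), ?_, ?_⟩
    · simp only [hΦ0]; exact mul_ne_zero (pow_ne_zero _ hη0) hu0
    · filter_upwards [(tendsto0 hΦ hΦ0).eventually hF] with y hy
      have e1 : mnm β (Φ y) = mnm β y * η y ^ β i₀ := mnm_update β y i₀ (η y)
      rw [hy, e1, mul_assoc]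

/-- Good sets. -/
def Good (h : E → ℂ) (Sg A : Set E) : Prop :=
  ∀ ε > 0, ∃ δ > 0, ∀ z ∈ A ∩ Sg, ‖h z‖ < δ → ∃ z' ∈ Sg ∩ ball 0 ε, h z' = h z

theorem good_main (h : E → ℂ) (Sg : Set E)
    (H : ∀ W : Ultrafilter E, (W : Filter E) ≤ 𝓝 0 → ∃ A ∈ W, Good h Sg A) :
    ∃ ε₀ > 0, ∀ ε ε', 0 < ε → ε < ε₀ → 0 < ε' → ε' < ε₀ → ∃ δ > 0,
      h '' (Sg ∩ ball 0 ε) ∩ ball 0 δ = h '' (Sg ∩ ball 0 ε') ∩ ball 0 δ := by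
  have hex : ∃ N ∈ 𝓝 (0 : E), Good h Sg N := by
    by_contra hc
    push Not at hc
    let 𝓖 : Filter E := Filter.comk (Good h Sg)
      (by intro ε hε; exact ⟨1, one_pos, by simp⟩)
      (by
        intro t ht s hst ε hε
        obtain ⟨δ, hδ, h1⟩ := ht ε hε
        exact ⟨δ, hδ, fun z hz => h1 z ⟨hst hz.1, hz.2⟩⟩)
      (by
        intro s hs t ht ε hε
        obtain ⟨δ, hδ, h1⟩ := hs ε hε
        obtain ⟨δ', hδ', h2⟩ := ht ε hε
        refine ⟨min δ δ', lt_min hδ hδ', ?_⟩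
        rintro z ⟨hz | hz, hzs⟩ hlt
        · exact h1 z ⟨hz, hzs⟩ (hlt.trans_le (min_le_left _ _))
        · exact h2 z ⟨hz, hzs⟩ (hlt.trans_le (min_le_right _ _)))
    have hne : NeBot (𝓝 (0 : E) ⊓ 𝓖) := by
      rw [Filter.neBot_iff]
      intro hbot
      rw [← disjoint_iff, Filter.disjoint_iff] at hbot
      obtain ⟨s, hs, t, ht, hst⟩ := hbot
      have ht' : Good h Sg tᶜ := ht
      refine hc s hs fun ε hε => ?_
      obtain ⟨δ, hδ, h1⟩ := ht' ε hε
      exact ⟨δ, hδ, fun z hz => h1 z ⟨Set.disjoint_left.1 hst hz.1, hz.2⟩⟩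
    obtain ⟨W, hW⟩ := Ultrafilter.exists_le (𝓝 (0 : E) ⊓ 𝓖)
    obtain ⟨A, hA, hAg⟩ := H W (hW.trans inf_le_left)
    have : Aᶜ ∈ 𝓖 := by
      show Good h Sg Aᶜᶜ
      rw [compl_compl]; exact hAg
    exact Ultrafilter.compl_notMem_iff.2 hA (hW.trans inf_le_right this)
  obtain ⟨N, hN, hg⟩ := hex
  obtain ⟨ε₀, hε₀, hb⟩ := Metric.mem_nhds_iff.1 hN
  refine ⟨ε₀, hε₀, fun ε ε' hε hε1 hε' hε1' => ?_⟩
  obtain ⟨δ, hδ, h1⟩ := hg ε hε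
  obtain ⟨δ', hδ', h2⟩ := hg ε' hε'
  refine ⟨min δ δ', lt_min hδ hδ', ?_⟩
  ext y
  constructor
  · rintro ⟨⟨z, ⟨hz, hzb⟩, rfl⟩, hy⟩
    rw [mem_ball_zero_iff] at hy
    obtain ⟨z', hz', he⟩ := h2 z ⟨hb (ball_subset_ball hε1.le hzb), hz⟩ (hy.trans_le (min_le_right _ _))
    exact ⟨⟨z', hz', he⟩, by rw [mem_ball_zero_iff]; exact hy⟩
  · rintro ⟨⟨z, ⟨hz, hzb⟩, rfl⟩, hy⟩
    rw [mem_ball_zero_iff] at hy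
    obtain ⟨z', hz', he⟩ := h1 z ⟨hb (ball_subset_ball hε1'.le hzb), hz⟩ (hy.trans_le (min_le_left _ _))
    exact ⟨⟨z', hz', he⟩, by rw [mem_ball_zero_iff]; exact hy⟩

end partG

section partH
open Filter Topology
open scoped ComplexConjugate

variable {E : Type*} [NormedAddCommGroup E] [NormedSpace ℂ E]

theorem fderiv_h {f g : E → ℂ} {z : E} (hf : DifferentiableAt ℂ f z) (hg : DifferentiableAt ℂ g z) (v : E) :
    fderiv ℝ (fun x => f x * (starRingEnd ℂ) (g x)) z v =
      fderiv ℂ f z v * conj (g z) + f z * conj (fderiv ℂ g z v) := by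
  have h1 : HasFDerivAt f ((fderiv ℂ f z).restrictScalars ℝ) z := hf.hasFDerivAt.restrictScalars ℝ
  have h2 : HasFDerivAt g ((fderiv ℂ g z).restrictScalars ℝ) z := hg.hasFDerivAt.restrictScalars ℝ
  have h3 : HasFDerivAt (fun x => (starRingEnd ℂ) (g x))
      ((Complex.conjCLE : ℂ →L[ℝ] ℂ).comp ((fderiv ℂ g z).restrictScalars ℝ)) z :=
    (Complex.conjCLE : ℂ →L[ℝ] ℂ).hasFDerivAt.comp z h2
  have h4 : HasFDerivAt (fun x => f x * (starRingEnd ℂ) (g x)) _ z := h1.mul h3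
  rw [h4.fderiv]
  simp
  ring

theorem sing_of {f g : E → ℂ} {z : E} (hf : DifferentiableAt ℂ f z) (hg : DifferentiableAt ℂ g z)
    (hf0 : f z ≠ 0) (hg0 : g z ≠ 0) (lam : ℂ) (hl : ‖lam‖ = 1)
    (h : ∀ v, g z * fderiv ℂ f z v = lam * f z * fderiv ℂ g z v) :
    ¬ Function.Surjective (fderiv ℝ (fun x => f x * (starRingEnd ℂ) (g x)) z) := by
  intro hs
  obtain ⟨μ, hμ⟩ := IsAlgClosed.exists_pow_nat_eq (lam * conj (g z) / g z) (n := 2) (by norm_num)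
  have hgn : ‖g z‖ ≠ 0 := norm_ne_zero_iff.2 hg0
  have hμn : ‖μ‖ = 1 := by
    have : ‖μ‖ ^ 2 = 1 := by
      rw [← norm_pow, hμ, norm_div, norm_mul, hl, RCLike.norm_conj, one_mul, div_self hgn]
    exact (pow_eq_one_iff_of_nonneg (norm_nonneg _) (by norm_num)).1 this
  have hμc : μ * conj μ = 1 := by
    rw [Complex.mul_conj, Complex.normSq_eq_norm_sq, hμn]; simp
  have hμ0 : μ ≠ 0 := by intro h0; simp [h0] at hμc
  obtain ⟨v, hv⟩ := hs (f z * μ * Complex.I)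
  rw [fderiv_h hf hg] at hv
  have h1 : fderiv ℂ f z v = lam * f z * fderiv ℂ g z v / g z := by
    rw [eq_div_iff hg0, ← h v, mul_comm]
  set w := fderiv ℂ g z v with hw
  have h2 : f z * μ * (μ * w + conj (μ * w)) = f z * μ * Complex.I := by
    rw [← hv, h1, map_mul]
    have e : μ * μ = lam * conj (g z) / g z := by rw [← hμ]; ring
    linear_combination f z * w * e + f z * conj w * hμc
  have h3 := mul_left_cancel₀ (mul_ne_zero hf0 hμ0) h2
  have h4 := congrArg Complex.im h3
  simp at h4
  linarith

theorem sing_to {f g : E → ℂ} {z : E} (hf : DifferentiableAt ℂ f z) (hg : DifferentiableAt ℂ g z)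
    (hf0 : f z ≠ 0) (hg0 : g z ≠ 0)
    (hs : ¬ Function.Surjective (fderiv ℝ (fun x => f x * (starRingEnd ℂ) (g x)) z)) :
    ∃ lam : ℂ, ‖lam‖ = 1 ∧ ∀ v, g z * fderiv ℂ f z v = lam * f z * fderiv ℂ g z v := by
  set D := fderiv ℝ (fun x => f x * (starRingEnd ℂ) (g x)) z with hD
  have hlt : (D : E →ₗ[ℝ] ℂ).range < ⊤ := by
    rw [lt_top_iff_ne_top]
    intro h
    exact hs (LinearMap.range_eq_top.1 h)
  obtain ⟨φ, hφ, hle⟩ := Submodule.exists_le_ker_of_lt_top _ hlt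
  have hφe : ∀ w : ℂ, φ w = w.re * φ 1 + w.im * φ Complex.I := by
    intro w
    conv_lhs => rw [← Complex.re_add_im w]
    have e1 : (w.re : ℂ) = w.re • (1 : ℂ) := by simp
    have e2 : (w.im : ℂ) * Complex.I = w.im • Complex.I := by simp
    rw [map_add, e2, map_smul, e1, map_smul]
    simp
  let c : ℂ := ⟨φ 1, - φ Complex.I⟩
  have hc : c ≠ 0 := by
    intro h
    have h1 : φ 1 = 0 := congrArg Complex.re h
    have h2 : - φ Complex.I = 0 := congrArg Complex.im h
    apply hφ
    ext w
    rw [hφe, h1, neg_eq_zero.1 h2]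
    simp
  have hre : ∀ v, (c * D v).re = 0 := by
    intro v
    have : φ (D v) = 0 := hle ⟨v, rfl⟩
    rw [hφe] at this
    simp only [Complex.mul_re, c]
    linarith
  have hlin : ∀ v, (c * conj (g z) * fderiv ℂ f z v + conj (c * f z) * fderiv ℂ g z v).re = 0 := by
    intro v
    have h1 := hre v
    rw [hD, fderiv_h hf hg] at h1
    simp only [Complex.mul_re, Complex.mul_im, Complex.add_re, Complex.add_im, Complex.conj_re,
      Complex.conj_im] at h1 ⊢
    linarith
  have hz : ∀ v, c * conj (g z) * fderiv ℂ f z v + conj (c * f z) * fderiv ℂ g z v = 0 := by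
    intro v
    apply Complex.ext
    · exact hlin v
    · have := hlin (Complex.I • v)
      rw [map_smul, map_smul, smul_eq_mul, smul_eq_mul] at this
      have e : c * conj (g z) * (Complex.I * fderiv ℂ f z v) + conj (c * f z) * (Complex.I * fderiv ℂ g z v)
        = Complex.I * (c * conj (g z) * fderiv ℂ f z v + conj (c * f z) * fderiv ℂ g z v) := by ring
      rw [e, Complex.I_mul_re] at this
      rw [Complex.zero_im]
      exact neg_eq_zero.1 this
  have hcg : c * conj (g z) ≠ 0 := mul_ne_zero hc (by simpa using hg0)
  refine ⟨- (conj (c * f z) * g z) / (c * conj (g z) * f z), ?_, ?_⟩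
  · have h1 : ‖c‖ ≠ 0 := norm_ne_zero_iff.2 hc
    have h2 : ‖f z‖ ≠ 0 := norm_ne_zero_iff.2 hf0
    have h3 : ‖g z‖ ≠ 0 := norm_ne_zero_iff.2 hg0
    simp only [norm_div, norm_neg, norm_mul, RCLike.norm_conj, map_mul]
    field_simp
  · intro v
    have := hz v
    have h1 : conj (g z) ≠ 0 := by simpa using hg0
    field_simp
    linear_combination this

theorem sing_zero {f g : E → ℂ} {z : E} (hf : DifferentiableAt ℂ f z) (hg : DifferentiableAt ℂ g z)
    (hf0 : f z = 0) (hg0 : g z = 0) :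
    ¬ Function.Surjective (fderiv ℝ (fun x => f x * (starRingEnd ℂ) (g x)) z) := by
  intro hs
  obtain ⟨v, hv⟩ := hs 1
  rw [fderiv_h hf hg, hf0, hg0] at hv
  simp at hv

end partH

section partI
open Filter Topology

theorem path_deriv {n : ℕ} (u : (Fin n → ℂ) → ℂ) (x y : Fin n → ℂ) (τ : ℝ)
    (hu : DifferentiableAt ℂ u (fun i => x i * Complex.exp (τ * y i))) :
    HasDerivAt (fun t : ℝ => u (fun i => x i * Complex.exp (t * y i)))
      (fderiv ℂ u (fun i => x i * Complex.exp (τ * y i))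
        (fun i => y i * (x i * Complex.exp (τ * y i)))) τ := by
  have h1 : HasDerivAt (fun t : ℝ => fun i => x i * Complex.exp (t * y i))
      (fun i => y i * (x i * Complex.exp (τ * y i))) τ := by
    rw [hasDerivAt_pi]
    intro i
    have h2 : HasDerivAt (fun t : ℝ => (t : ℂ)) 1 τ := Complex.ofRealCLM.hasDerivAt
    have h3 := ((h2.mul_const (y i)).cexp).const_mul (x i)
    refine h3.congr_deriv ?_
    ring
  have h4 : HasFDerivAt u ((fderiv ℂ u (fun i => x i * Complex.exp (τ * y i))).restrictScalars ℝ)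
      (fun i => x i * Complex.exp (τ * y i)) := hu.hasFDerivAt.restrictScalars ℝ
  exact h4.comp_hasDerivAt τ h1

theorem conserve {n : ℕ} (γ : Fin n → ℕ) (i₀ : Fin n) (hi : γ i₀ ≠ 0) (I : Set (Fin n))
    (u : (Fin n → ℂ) → ℂ) (r : ℝ) (hu : ∀ x ∈ ball (0 : Fin n → ℂ) r, DifferentiableAt ℂ u x)
    (hR : ∀ x ∈ ball (0 : Fin n → ℂ) r, (∀ i, x i = 0 ↔ i ∈ I) → ∀ k l,
      fderiv ℂ u x (Pi.single k (x k)) * γ l = fderiv ℂ u x (Pi.single l (x l)) * γ k)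
    (x y : Fin n → ℂ) (hx : x ∈ ball (0 : Fin n → ℂ) r) (hxI : ∀ i, x i = 0 ↔ i ∈ I)
    (hy : ∑ i, (γ i : ℂ) * y i = 0)
    (hx' : (fun i => x i * Complex.exp (y i)) ∈ ball (0 : Fin n → ℂ) r) :
    u (fun i => x i * Complex.exp (y i)) = u x := by
  have hr : 0 < r := pos_of_mem_ball hx
  have hb : ∀ τ ∈ Set.Icc (0 : ℝ) 1, (fun i => x i * Complex.exp (τ * y i)) ∈ ball (0 : Fin n → ℂ) r := by
    intro τ hτ
    rw [mem_ball_zero_iff, pi_norm_lt_iff hr] at hx hx' ⊢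
    intro i
    have h1 := hx i
    have h2 := hx' i
    rw [norm_mul, Complex.norm_exp] at h2 ⊢
    have e : ((τ : ℂ) * y i).re = τ * (y i).re := by simp
    rw [e]
    rcases le_total 0 (y i).re with h | h
    · refine lt_of_le_of_lt ?_ h2
      gcongr
      nlinarith [hτ.2]
    · refine lt_of_le_of_lt ?_ h1
      have : Real.exp (τ * (y i).re) ≤ 1 := by
        rw [Real.exp_le_one_iff]; nlinarith [hτ.1]
      nlinarith [norm_nonneg (x i)]
  have key : ∀ τ ∈ Set.Icc (0 : ℝ) 1,
      HasDerivAt (fun t : ℝ => u (fun i => x i * Complex.exp (t * y i))) 0 τ := by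
    intro τ hτ
    refine (path_deriv u x y τ (hu _ (hb τ hτ))).congr_deriv ?_
    set p : Fin n → ℂ := fun i => x i * Complex.exp (τ * y i) with hp
    have hpI : ∀ i, p i = 0 ↔ i ∈ I := by
      intro i; rw [← hxI i]; simp [hp]
    have hγ : (γ i₀ : ℂ) ≠ 0 := by exact_mod_cast hi
    have e : (fun i => y i * p i) = ∑ i, y i • Pi.single i (p i) := by
      ext j
      simp [Finset.sum_apply, Pi.single_apply]
    have h1 := hR p (hb τ hτ) hpI
    show fderiv ℂ u p (fun i => y i * p i) = 0
    rw [e, map_sum]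
    simp only [map_smul, smul_eq_mul]
    apply mul_right_cancel₀ hγ
    rw [zero_mul, Finset.sum_mul]
    have : ∀ i ∈ Finset.univ, y i * fderiv ℂ u p (Pi.single i (p i)) * (γ i₀ : ℂ)
        = fderiv ℂ u p (Pi.single i₀ (p i₀)) * (γ i * y i) := by
      intro i _
      linear_combination y i * h1 i i₀
    rw [Finset.sum_congr rfl this, ← Finset.mul_sum, hy, mul_zero]
  have h := constant_of_has_deriv_right_zero (a := (0 : ℝ)) (b := 1)
    (fun τ hτ => (key τ hτ).continuousAt.continuousWithinAt)
    (fun τ hτ => (key τ ⟨hτ.1, hτ.2.le⟩).hasDerivWithinAt) 1 (by simp)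
  simpa using h

theorem conserve' {n : ℕ} (γ : Fin n → ℕ) (i₀ : Fin n) (hi : γ i₀ ≠ 0) (I : Set (Fin n))
    (u : (Fin n → ℂ) → ℂ) (r : ℝ) (hu : ∀ x ∈ ball (0 : Fin n → ℂ) r, DifferentiableAt ℂ u x)
    (hR : ∀ x ∈ ball (0 : Fin n → ℂ) r, (∀ i, x i = 0 ↔ i ∈ I) → ∀ k l,
      fderiv ℂ u x (Pi.single k (x k)) * γ l = fderiv ℂ u x (Pi.single l (x l)) * γ k)
    (x y : Fin n → ℂ) (hx : x ∈ ball (0 : Fin n → ℂ) r) (hxI : ∀ i, x i = 0 ↔ i ∈ I)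
    (hy : ∑ i, (γ i : ℂ) * y i = 0) (x' : Fin n → ℂ) (hxx : x' = fun i => x i * Complex.exp (y i))
    (hx' : x' ∈ ball (0 : Fin n → ℂ) r) :
    u x' = u x ∧ fderiv ℂ u x' (Pi.single i₀ (x' i₀)) = fderiv ℂ u x (Pi.single i₀ (x i₀)) := by
  constructor
  · subst hxx
    exact conserve γ i₀ hi I u r hu hR x y hx hxI hy hx'
  · have hd : ∀ x ∈ ball (0 : Fin n → ℂ) r,
        HasDerivAt (fun t : ℝ => u (fun i => x i * Complex.exp (t * (Pi.single i₀ 1 : Fin n → ℂ) i)))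
        (fderiv ℂ u x (Pi.single i₀ (x i₀))) 0 := by
      intro x hx
      have e0 : (fun i => x i * Complex.exp (((0 : ℝ) : ℂ) * (Pi.single i₀ 1 : Fin n → ℂ) i)) = x := by
        ext i; simp
      have h := path_deriv u x (Pi.single i₀ 1) 0 (by rw [e0]; exact hu x hx)
      rw [e0] at h
      refine h.congr_deriv ?_
      congr 1
      ext j
      by_cases hj : j = i₀
      · subst hj; simp
      · simp [hj]
    have hnear : ∀ x ∈ ball (0 : Fin n → ℂ) r, ∀ᶠ t : ℝ in 𝓝 0,
        (fun i => x i * Complex.exp (t * (Pi.single i₀ 1 : Fin n → ℂ) i)) ∈ ball (0 : Fin n → ℂ) r := by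
      intro x hx
      have hc : ContinuousAt (fun t : ℝ => fun i => x i * Complex.exp (t * (Pi.single i₀ 1 : Fin n → ℂ) i)) 0 := by
        fun_prop
      apply hc.eventually_mem
      apply isOpen_ball.mem_nhds
      simpa using hx
    have hev : (fun t : ℝ => u (fun i => x' i * Complex.exp (t * (Pi.single i₀ 1 : Fin n → ℂ) i))) =ᶠ[𝓝 0]
        (fun t : ℝ => u (fun i => x i * Complex.exp (t * (Pi.single i₀ 1 : Fin n → ℂ) i))) := by
      filter_upwards [hnear x hx, hnear x' hx'] with t h1 h2
      have e : (fun i => x' i * Complex.exp (t * (Pi.single i₀ 1 : Fin n → ℂ) i)) =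
          fun i => (x i * Complex.exp (t * (Pi.single i₀ 1 : Fin n → ℂ) i)) * Complex.exp (y i) := by
        ext i; rw [hxx]; ring
      rw [e] at h2 ⊢
      exact conserve γ i₀ hi I u r hu hR _ y h1 (by intro i; rw [← hxI i]; simp) hy h2
    exact (hd x' hx').unique ((hd x hx).congr_of_eventuallyEq hev)

theorem mnm_fderiv {n : ℕ} (β : Fin n → ℕ) (x : Fin n → ℂ) (k : Fin n) :
    fderiv ℂ (mnm β) x (Pi.single k (x k)) = β k * mnm β x := by
  have h1 : HasDerivAt (fun t : ℂ => x + t • (Pi.single k (x k) : Fin n → ℂ)) (Pi.single k (x k)) 0 := by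
    have := ((hasDerivAt_id (0 : ℂ)).smul_const (Pi.single k (x k) : Fin n → ℂ)).const_add x
    simpa using this
  have e0 : x + (0 : ℂ) • (Pi.single k (x k) : Fin n → ℂ) = x := by simp
  have h2 : HasDerivAt (fun t : ℂ => mnm β (x + t • (Pi.single k (x k) : Fin n → ℂ)))
      (fderiv ℂ (mnm β) x (Pi.single k (x k))) 0 := by
    have h3 : HasFDerivAt (mnm β) (fderiv ℂ (mnm β) x) (x + (0 : ℂ) • (Pi.single k (x k) : Fin n → ℂ)) := by
      rw [e0]; exact (mnm_ana β x).differentiableAt.hasFDerivAt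
    have h5 := h3.comp_hasDerivAt (0 : ℂ) h1
    exact h5
  have h4 : HasDerivAt (fun t : ℂ => mnm β x * (t + 1) ^ β k) (β k * mnm β x) 0 := by
    have := (((hasDerivAt_id (0 : ℂ)).add_const 1).pow (β k)).const_mul (mnm β x)
    refine this.congr_deriv ?_
    simp [mul_comm]
  have e : (fun t : ℂ => mnm β (x + t • (Pi.single k (x k) : Fin n → ℂ))) =
      fun t : ℂ => mnm β x * (t + 1) ^ β k := by
    ext t
    rw [← mnm_update]
    congr 1
    ext j
    by_cases hj : j = k
    · subst hj; simp; ring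
    · simp [hj]
  rw [e] at h2
  exact h2.unique h4

/-- Derivative of `mnm β * u` along the `k`-th Euler field. -/
theorem mnm_mul_fderiv {n : ℕ} (β : Fin n → ℕ) (u F : (Fin n → ℂ) → ℂ) (x : Fin n → ℂ)
    (hu : DifferentiableAt ℂ u x) (hF : ∀ᶠ y in 𝓝 x, F y = mnm β y * u y) (k : Fin n) :
    fderiv ℂ F x (Pi.single k (x k)) =
      mnm β x * (β k * u x + fderiv ℂ u x (Pi.single k (x k))) := by
  have h1 := (mnm_ana β x).differentiableAt.hasFDerivAt.mul hu.hasFDerivAt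
  have h2 : HasFDerivAt F _ x := h1.congr_of_eventuallyEq hF
  rw [h2.fderiv]
  simp [mnm_fderiv]
  ring

end partI

section partJ
open Filter Topology

variable {E : Type*} [NormedAddCommGroup E] [NormedSpace ℂ E]

theorem mnm_norm_le {n : ℕ} (γ : Fin n → ℕ) (x : Fin n → ℂ) : ‖mnm γ x‖ ≤ ‖x‖ ^ (∑ i, γ i) := by
  rw [mnm, norm_prod, ← Finset.prod_pow_eq_pow_sum]
  refine Finset.prod_le_prod (fun i _ => norm_nonneg _) fun i _ => ?_
  rw [norm_pow]
  exact pow_le_pow_left₀ (norm_nonneg _) (norm_le_pi_norm x i) _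

theorem core {n : ℕ} (U : Set E) (f g : E → ℂ)
    (hf : ∀ z ∈ U, DifferentiableAt ℂ f z) (hg : ∀ z ∈ U, DifferentiableAt ℂ g z)
    (h0U : (0 : E) ∈ U) (hf0 : f 0 = 0) (hg0 : g 0 = 0)
    (π : (Fin n → ℂ) → E) (ρ : E → (Fin n → ℂ)) (γ : Fin n → ℕ) (i₀ : Fin n) (hi : γ i₀ ≠ 0)
    (I : Set (Fin n)) (hγI : ∀ i ∈ I, γ i = 0) (u : (Fin n → ℂ) → ℂ) (r m : ℝ) (hm : 0 < m)
    (hr : 0 < r)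
    (hπ : ∀ x ∈ ball (0 : Fin n → ℂ) r, DifferentiableAt ℂ π x) (hπ0 : π 0 = 0)
    (hπU : ∀ x ∈ ball (0 : Fin n → ℂ) r, π x ∈ U)
    (hu : ∀ x ∈ ball (0 : Fin n → ℂ) r, DifferentiableAt ℂ u x)
    (hum : ∀ x ∈ ball (0 : Fin n → ℂ) r, m ≤ ‖u x‖)
    (hfπ : ∀ x ∈ ball (0 : Fin n → ℂ) r, f (π x) = mnm γ x * u x)
    (hgπ : ∀ x ∈ ball (0 : Fin n → ℂ) r, g (π x) = mnm γ x)
    (hmin : ∀ x ∈ ball (0 : Fin n → ℂ) r, (∀ i, x i = 0 ↔ i ∈ I) → ∀ v w,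
      fderiv ℂ f (π x) v * fderiv ℂ g (π x) w = fderiv ℂ f (π x) w * fderiv ℂ g (π x) v) :
    Good (fun x => f x * (starRingEnd ℂ) (g x))
      {x ∈ U | ¬ Function.Surjective (fderiv ℝ (fun x => f x * (starRingEnd ℂ) (g x)) x)}
      {z | π (ρ z) = z ∧ ρ z ∈ ball (0 : Fin n → ℂ) r ∧ ∀ i, ρ z i = 0 ↔ i ∈ I} := by
  have cf : ∀ x ∈ ball (0 : Fin n → ℂ) r, ∀ k,
      fderiv ℂ f (π x) (fderiv ℂ π x (Pi.single k (x k))) =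
        mnm γ x * (γ k * u x + fderiv ℂ u x (Pi.single k (x k))) := by
    intro x hx k
    rw [← mnm_mul_fderiv γ u (fun y => f (π y)) x (hu x hx)
      (eventually_of_mem (isOpen_ball.mem_nhds hx) hfπ)]
    rw [fderiv_fun_comp x (hf _ (hπU x hx)) (hπ x hx)]
    rfl
  have cg : ∀ x ∈ ball (0 : Fin n → ℂ) r, ∀ k,
      fderiv ℂ g (π x) (fderiv ℂ π x (Pi.single k (x k))) = mnm γ x * γ k := by
    intro x hx k
    have h1 := mnm_mul_fderiv γ (fun _ => 1) (fun y => g (π y)) x (by fun_prop)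
      (by
        filter_upwards [isOpen_ball.mem_nhds hx] with y hy
        rw [hgπ y hy, mul_one]) k
    rw [fderiv_fun_comp x (hg _ (hπU x hx)) (hπ x hx)] at h1
    simpa using h1
  have hP : ∀ x : Fin n → ℂ, (∀ i, x i = 0 ↔ i ∈ I) → mnm γ x ≠ 0 := by
    intro x hxI h
    obtain ⟨i, h1, h2⟩ := (mnm_eq_zero γ x).1 h
    exact h2 (hγI i ((hxI i).1 h1))
  have hR : ∀ x ∈ ball (0 : Fin n → ℂ) r, (∀ i, x i = 0 ↔ i ∈ I) → ∀ k l,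
      fderiv ℂ u x (Pi.single k (x k)) * γ l = fderiv ℂ u x (Pi.single l (x l)) * γ k := by
    intro x hx hxI k l
    have h1 := hmin x hx hxI (fderiv ℂ π x (Pi.single k (x k))) (fderiv ℂ π x (Pi.single l (x l)))
    rw [cf x hx, cf x hx, cg x hx, cg x hx] at h1
    have h2 := hP x hxI
    apply mul_left_cancel₀ (mul_ne_zero h2 h2)
    linear_combination h1
  have hi₀I : i₀ ∉ I := fun h => hi (hγI _ h)
  set N := ∑ i, γ i with hN
  have hN0 : N ≠ 0 := by
    intro h
    exact hi (Finset.sum_eq_zero_iff.1 h i₀ (Finset.mem_univ _))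
  intro ε hε
  have hcont : ContinuousAt π 0 := (hπ 0 (mem_ball_self hr)).continuousAt
  obtain ⟨η, hη, hηε⟩ : ∃ η > 0, ∀ x ∈ ball (0 : Fin n → ℂ) η, π x ∈ ball (0 : E) ε := by
    have : ∀ᶠ x in 𝓝 (0 : Fin n → ℂ), π x ∈ ball (0 : E) ε :=
      hcont.eventually_mem (by rw [hπ0]; exact ball_mem_nhds _ hε)
    exact Metric.eventually_nhds_iff_ball.1 this
  refine ⟨m * η ^ (2 * N), by positivity, ?_⟩
  rintro z ⟨⟨hπρ, hxr, hxI⟩, hzU, hzS⟩ hlt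
  by_cases hz0 : f z * (starRingEnd ℂ) (g z) = 0
  · refine ⟨0, ⟨⟨h0U, sing_zero (hf 0 h0U) (hg 0 h0U) hf0 hg0⟩, mem_ball_self hε⟩, ?_⟩
    simp only [hf0, zero_mul, hz0]
  have hfz : f z ≠ 0 := fun h => hz0 (by rw [h, zero_mul])
  have hgz : g z ≠ 0 := fun h => hz0 (by rw [h, map_zero, mul_zero])
  set x := ρ z with hx
  classical
  let S : ℂ := (∑ i, (γ i : ℂ) * Complex.log (x i)) / N
  let s : ℂ := Complex.exp S
  let x' : Fin n → ℂ := fun i => if i ∈ I then 0 else s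
  let y : Fin n → ℂ := fun i => if i ∈ I then 0 else S - Complex.log (x i)
  have hNc : (N : ℂ) ≠ 0 := by exact_mod_cast hN0
  have hNS : (N : ℂ) * S = ∑ i, (γ i : ℂ) * Complex.log (x i) := by
    simp only [S]; field_simp
  have hxx : x' = fun i => x i * Complex.exp (y i) := by
    ext i
    by_cases h : i ∈ I
    · simp [x', h, (hxI i).2 h]
    · have h1 : x i ≠ 0 := fun h2 => h ((hxI i).1 h2)
      simp only [x', y, h, if_false, s]
      rw [Complex.exp_sub, Complex.exp_log h1]
      field_simp
  have hy : ∑ i, (γ i : ℂ) * y i = 0 := by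
    have : ∀ i ∈ Finset.univ, (γ i : ℂ) * y i = (γ i : ℂ) * S - (γ i : ℂ) * Complex.log (x i) := by
      intro i _
      by_cases h : i ∈ I
      · simp [hγI i h]
      · simp only [y, h, if_false]; ring
    rw [Finset.sum_congr rfl this, Finset.sum_sub_distrib, ← Finset.sum_mul, ← hNS, hN]
    push_cast; ring
  have hmx : mnm γ x = s ^ N := by
    rw [← Complex.exp_nat_mul, hNS, Complex.exp_sum]
    refine Finset.prod_congr rfl fun i _ => ?_
    by_cases h : i ∈ I
    · simp [hγI i h]
    · have h1 : x i ≠ 0 := fun h2 => h ((hxI i).1 h2)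
      rw [Complex.exp_nat_mul, Complex.exp_log h1]
  have hmx' : mnm γ x' = s ^ N := by
    rw [hN, ← Finset.prod_pow_eq_pow_sum]
    refine Finset.prod_congr rfl fun i _ => ?_
    by_cases h : i ∈ I
    · simp [hγI i h]
    · simp [x', h]
  have hsx : ‖s‖ ≤ ‖x‖ := by
    have h1 := mnm_norm_le γ x
    rw [hmx, norm_pow, ← hN] at h1
    exact (pow_le_pow_iff_left₀ (norm_nonneg _) (norm_nonneg _) hN0).1 h1
  have hx's : ‖x'‖ ≤ ‖s‖ := by
    rw [pi_norm_le_iff_of_nonneg (norm_nonneg _)]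
    intro i
    by_cases h : i ∈ I <;> simp [x', h]
  have hx'r : x' ∈ ball (0 : Fin n → ℂ) r := by
    rw [mem_ball_zero_iff] at hxr ⊢
    exact (hx's.trans hsx).trans_lt hxr
  have hx'I : ∀ i, x' i = 0 ↔ i ∈ I := by
    intro i; rw [← hxI i, hxx]; simp
  obtain ⟨hux, hθ⟩ := conserve' γ i₀ hi I u r hu hR x y hxr hxI hy x' hxx hx'r
  have hfe : f (π x') = f z := by
    rw [hfπ x' hx'r, ← hπρ, hfπ x hxr, hux, hmx, hmx']
  have hge : g (π x') = g z := by
    rw [hgπ x' hx'r, ← hπρ, hgπ x hxr, hmx, hmx']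
  have hsη : ‖s‖ < η := by
    by_contra hc
    push Not at hc
    have h1 : ‖f z * (starRingEnd ℂ) (g z)‖ = ‖s‖ ^ (2 * N) * ‖u x‖ := by
      rw [norm_mul, RCLike.norm_conj, ← hπρ, hfπ x hxr, hgπ x hxr, hmx, norm_mul, norm_pow]
      ring
    have h2 : η ^ (2 * N) ≤ ‖s‖ ^ (2 * N) := pow_le_pow_left₀ hη.le hc _
    have h3 := hum x hxr
    have h4 : m * η ^ (2 * N) ≤ ‖u x‖ * ‖s‖ ^ (2 * N) :=
      mul_le_mul h3 h2 (by positivity) (by positivity)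
    simp only [h1] at hlt
    linarith
  refine ⟨π x', ⟨⟨hπU x' hx'r, ?_⟩, hηε x' ?_⟩, ?_⟩
  · obtain ⟨lam, hl, hlv⟩ := sing_to (hf z hzU) (hg z hzU) hfz hgz hzS
    have hPx := hP x hxI
    have hPx' : mnm γ x' = mnm γ x := by rw [hmx, hmx']
    have hu0 : u x ≠ 0 := by
      intro h
      have := hum x hxr
      rw [h, norm_zero] at this
      linarith
    have hγ0 : (γ i₀ : ℂ) ≠ 0 := by exact_mod_cast hi
    have h1 : γ i₀ * u x + fderiv ℂ u x (Pi.single i₀ (x i₀)) = lam * u x * γ i₀ := by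
      have h2 := hlv (fderiv ℂ π x (Pi.single i₀ (x i₀)))
      rw [← hπρ, cf x hxr, cg x hxr, hfπ x hxr, hgπ x hxr] at h2
      apply mul_left_cancel₀ (mul_ne_zero hPx hPx)
      linear_combination h2
    refine sing_of (hf _ (hπU x' hx'r)) (hg _ (hπU x' hx'r)) (by rw [hfe]; exact hfz)
      (by rw [hge]; exact hgz) lam hl ?_
    intro v
    have h2 := hmin x' hx'r hx'I v (fderiv ℂ π x' (Pi.single i₀ (x' i₀)))
    rw [cf x' hx'r, cg x' hx'r, hPx', hux, hθ, h1] at h2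
    rw [hfπ x' hx'r, hgπ x' hx'r, hPx', hux]
    apply mul_right_cancel₀ hγ0
    linear_combination h2
  · rw [mem_ball_zero_iff]
    exact hx's.trans_lt hsη
  · simp only [hfe, hge]

end partJ

section partK
open Filter Topology

variable {E : Type*} [NormedAddCommGroup E] [NormedSpace ℂ E]

theorem minors_all {n : ℕ} (e : E ≃L[ℂ] (Fin n → ℂ)) (φ ψ : E →L[ℂ] ℂ)
    (h : ∀ a b : Fin n, φ (e.symm (Pi.single a 1)) * ψ (e.symm (Pi.single b 1)) =
      φ (e.symm (Pi.single b 1)) * ψ (e.symm (Pi.single a 1))) (v w : E) :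
    φ v * ψ w = φ w * ψ v := by
  have hv : ∀ v : E, v = ∑ a, e v a • e.symm (Pi.single a 1) := by
    intro v
    apply e.injective
    simp only [map_sum, map_smul, ContinuousLinearEquiv.apply_symm_apply]
    ext j
    simp [Finset.sum_apply, Pi.single_apply]
  have h1 : ∀ (χ : E →L[ℂ] ℂ) (v : E), χ v = ∑ a, e v a * χ (e.symm (Pi.single a 1)) := by
    intro χ v
    conv_lhs => rw [hv v]
    simp only [map_sum, map_smul, smul_eq_mul]
  rw [h1 φ v, h1 φ w, h1 ψ v, h1 ψ w, Finset.sum_mul_sum, Finset.sum_mul_sum, Finset.sum_comm]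
  refine Finset.sum_congr rfl fun b _ => Finset.sum_congr rfl fun a _ => ?_
  linear_combination e v a * e w b * h a b

theorem setup {n : ℕ} (e : E ≃L[ℂ] (Fin n → ℂ)) (W : Ultrafilter E) (hW : (W : Filter E) ≤ 𝓝 0)
    (f g : E → ℂ) (hf : AnalyticAt ℂ f 0) (hg : AnalyticAt ℂ g 0) (hg0 : g 0 = 0)
    (hfn : ¬ ∀ᶠ x in 𝓝 (0 : E), f x = 0) (hgn : ¬ ∀ᶠ x in 𝓝 (0 : E), g x = 0)
    {ι : Type*} [Fintype ι] (m : ι → E → ℂ) (hm : ∀ j, AnalyticAt ℂ (m j) 0) :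
    ∃ (π : (Fin n → ℂ) → E) (ρ : E → (Fin n → ℂ)) (γ : Fin n → ℕ) (i₀ : Fin n),
      Lifts W π ρ ∧ γ i₀ ≠ 0 ∧ (∀ᶠ x in 𝓝 (0 : Fin n → ℂ), g (π x) = mnm γ x) ∧
      IsMono (fun x => f (π x)) ∧
      ∀ j, (∀ᶠ x in 𝓝 (0 : E), m j x = 0) ∨ IsMono (fun x => m j (π x)) := by
  classical
  let s : Finset ι := Finset.univ.filter fun j => ¬ ∀ᶠ x in 𝓝 (0 : E), m j x = 0
  obtain ⟨hpa, hpn⟩ := ana_prod_ne s m (fun j _ => hm j) (fun j hj => (Finset.mem_filter.1 hj).2)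
  let F : E → ℂ := fun x => (f x * g x) * ∏ j ∈ s, m j x
  have hF : AnalyticAt ℂ F 0 := (hf.mul hg).mul hpa
  have hFn : ¬ ∀ᶠ x in 𝓝 (0 : E), F x = 0 := by
    intro h
    rcases ana_domain (hf.mul hg) hpa h with h1 | h1
    · rcases ana_domain hf hg h1 with h2 | h2
      · exact hfn h2
      · exact hgn h2
    · exact hpn h1
  have he : Lifts W (fun x => e.symm x) (fun x => e x) :=
    Lifts.of_cont hW (e.symm.toContinuousLinearMap.analyticAt 0) (by simp) e.continuous.continuousAt
      (by simp) (by simp)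
  have hres : Res n F W := by
    refine Res.trans he (MS_all n _ _ ?_ ?_ he.le)
    · exact ana_comp0 hF he.1 he.2.1
    · intro h
      apply hFn
      have ht : Tendsto (fun x => e x) (𝓝 (0 : E)) (𝓝 0) := by
        have := e.continuous.tendsto 0
        rwa [map_zero] at this
      filter_upwards [ht.eventually h] with x hx
      simpa using hx
  obtain ⟨π, ρ, hL, hmono⟩ := hres
  have af := ana_comp0 hf hL.1 hL.2.1
  have ag := ana_comp0 hg hL.1 hL.2.1
  have ap := ana_comp0 hpa hL.1 hL.2.1
  obtain ⟨h1, h2⟩ := IsMono.factor (af.mul ag) ap hmono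
  obtain ⟨mf, mg⟩ := IsMono.factor af ag h1
  have mm := IsMono.factor_prod s (F := fun j x => m j (π x))
    (fun j _ => ana_comp0 (hm j) hL.1 hL.2.1) h2
  obtain ⟨γ, v, hv, hv0, hgv⟩ := mg
  have hγ : γ ≠ 0 := by
    intro h
    have := hgv.self_of_nhds
    beta_reduce at this
    rw [h, mnm_zero, hL.2.1, hg0, one_mul] at this
    exact hv0 this.symm
  obtain ⟨i₀, hi⟩ := Function.ne_iff.1 hγ
  obtain ⟨Φ, Ψ, hL', hΦ, hΦm⟩ := normalise γ v hv hv0 i₀ hi _ hL.le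
  refine ⟨fun x => π (Φ x), fun x => Ψ (ρ x), γ, i₀, hL.trans hL', hi, ?_, hΦm _ mf, ?_⟩
  · filter_upwards [hΦ, (tendsto0 hL'.1 hL'.2.1).eventually hgv] with y h1 h2
    rw [h2, h1]
  · intro j
    by_cases hj : ∀ᶠ x in 𝓝 (0 : E), m j x = 0
    · exact Or.inl hj
    · exact Or.inr (hΦm _ (mm j (Finset.mem_filter.2 ⟨Finset.mem_univ _, hj⟩)))

theorem main_good [CompleteSpace E] {n : ℕ} (e : E ≃L[ℂ] (Fin n → ℂ)) (U : Set E) (hU : IsOpen U) (h0U : (0 : E) ∈ U)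
    (f g : E → ℂ) (hf : AnalyticOnNhd ℂ f U) (hg : AnalyticOnNhd ℂ g U)
    (hf0 : f 0 = 0) (hg0 : g 0 = 0)
    (hfn : ¬ ∀ᶠ x in 𝓝 (0 : E), f x = 0) (hgn : ¬ ∀ᶠ x in 𝓝 (0 : E), g x = 0)
    (W : Ultrafilter E) (hW : (W : Filter E) ≤ 𝓝 0) :
    ∃ A ∈ W, Good (fun x => f x * (starRingEnd ℂ) (g x))
      {x ∈ U | ¬ Function.Surjective (fderiv ℝ (fun x => f x * (starRingEnd ℂ) (g x)) x)} A := by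
  have df : ∀ z ∈ U, DifferentiableAt ℂ f z := fun z hz => (hf z hz).differentiableAt
  have dg : ∀ z ∈ U, DifferentiableAt ℂ g z := fun z hz => (hg z hz).differentiableAt
  set Sg := {x ∈ U | ¬ Function.Surjective (fderiv ℝ (fun x => f x * (starRingEnd ℂ) (g x)) x)} with hSg
  let M : Set E := {z | z ∈ Sg ∧ f z ≠ 0 ∧ g z ≠ 0}
  by_cases hM : M ∈ W
  swap
  · refine ⟨Mᶜ, Ultrafilter.compl_mem_iff_notMem.2 hM, fun ε hε => ⟨1, one_pos, ?_⟩⟩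
    rintro z ⟨hzM, hzS⟩ _
    refine ⟨0, ⟨⟨h0U, sing_zero (df 0 h0U) (dg 0 h0U) hf0 hg0⟩, mem_ball_self hε⟩, ?_⟩
    by_contra hc
    apply hzM
    refine ⟨hzS, fun h => hc ?_, fun h => hc ?_⟩
    · simp [hf0, h]
    · simp [hf0, h]
  let bv : Fin n → E := fun a => e.symm (Pi.single a 1)
  let m : Fin n × Fin n → E → ℂ := fun p z =>
    fderiv ℂ f z (bv p.1) * fderiv ℂ g z (bv p.2) - fderiv ℂ f z (bv p.2) * fderiv ℂ g z (bv p.1)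
  have hmA : ∀ j, AnalyticAt ℂ (m j) 0 := by
    intro j
    have h1 : ∀ v : E, AnalyticAt ℂ (fun z => fderiv ℂ f z v) 0 := fun v =>
      ((ContinuousLinearMap.apply ℂ ℂ v).analyticAt _).comp (AnalyticAt.fderiv (hf 0 h0U))
    have h2 : ∀ v : E, AnalyticAt ℂ (fun z => fderiv ℂ g z v) 0 := fun v =>
      ((ContinuousLinearMap.apply ℂ ℂ v).analyticAt _).comp (AnalyticAt.fderiv (hg 0 h0U))
    exact ((h1 _).mul (h2 _)).sub ((h1 _).mul (h2 _))
  obtain ⟨π, ρ, γ, i₀, hL, hi, hgπ, ⟨β, u, hu, hu0, hfπ⟩, hmm⟩ :=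
    setup e W hW f g (hf 0 h0U) (hg 0 h0U) hg0 hfn hgn m hmA
  have hπt := tendsto0 hL.1 hL.2.1
  have hρt : Tendsto ρ W (𝓝 0) := hL.2.2.1
  let I : Set (Fin n) := {i | ∀ᶠ z in (W : Filter E), ρ z i = 0}
  have hpat : ∀ᶠ z in (W : Filter E), ∀ i, ρ z i = 0 ↔ i ∈ I := by
    rw [eventually_all]
    intro i
    by_cases h : i ∈ I
    · filter_upwards [show ∀ᶠ z in (W : Filter E), ρ z i = 0 from h] with z hz
      simp [hz, h]
    · have h' : ∀ᶠ z in (W : Filter E), ¬ ρ z i = 0 := Ultrafilter.eventually_not.2 h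
      filter_upwards [h'] with z hz
      simp [hz, h]
  have hMe : ∀ᶠ z in (W : Filter E), z ∈ M := hM
  -- exponents vanish on `I`
  have hγI : ∀ i ∈ I, γ i = 0 := by
    intro i hiI
    obtain ⟨z, h1, h2, h3, h4⟩ :=
      (hMe.and (hpat.and ((hρt.eventually hgπ).and hL.2.2.2))).exists
    by_contra hc
    rw [h4] at h3
    exact h1.2.2 (by rw [h3]; exact (mnm_eq_zero γ _).2 ⟨i, (h2 i).2 hiI, hc⟩)
  -- local properties
  have hloc : ∀ᶠ x in 𝓝 (0 : Fin n → ℂ), DifferentiableAt ℂ π x ∧ π x ∈ U ∧ DifferentiableAt ℂ u x ∧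
      ‖u 0‖ / 2 ≤ ‖u x‖ := by
    have h1 := hL.1.eventually_analyticAt
    have h2 := hu.eventually_analyticAt
    have h3 : ∀ᶠ x in 𝓝 (0 : Fin n → ℂ), π x ∈ U := hπt.eventually (hU.mem_nhds h0U)
    have h4 : ∀ᶠ x in 𝓝 (0 : Fin n → ℂ), ‖u 0‖ / 2 < ‖u x‖ := by
      refine hu.continuousAt.norm.eventually (lt_mem_nhds ?_)
      have := norm_pos_iff.2 hu0
      linarith
    filter_upwards [h1, h2, h3, h4] with x k1 k2 k3 k4
    exact ⟨k1.differentiableAt, k3, k2.differentiableAt, k4.le⟩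
  -- minors vanish along the stratum
  have hminv : ∀ᶠ x in 𝓝 (0 : Fin n → ℂ), (∀ i, x i = 0 ↔ i ∈ I) → ∀ j, m j (π x) = 0 := by
    have : ∀ j, ∀ᶠ x in 𝓝 (0 : Fin n → ℂ), (∀ i, x i = 0 ↔ i ∈ I) → m j (π x) = 0 := by
      intro j
      rcases hmm j with h | h
      · filter_upwards [hπt.eventually h] with x hx _
        exact hx
      · obtain ⟨κ, w, hw, hw0, hκ⟩ := h
        have hwn : ∀ᶠ x in 𝓝 (0 : Fin n → ℂ), w x ≠ 0 := hw.continuousAt.eventually_ne hw0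
        obtain ⟨z, h1, h2, h3, h4, h5⟩ :=
          (hMe.and (hpat.and ((hρt.eventually hκ).and (hL.2.2.2.and (hρt.eventually hwn))))).exists
        beta_reduce at h3
        rw [h4] at h3
        obtain ⟨lam, hl, hlv⟩ := sing_to (df z h1.1.1) (dg z h1.1.1) h1.2.1 h1.2.2 h1.1.2
        have hz0 : m j z = 0 := by
          apply mul_left_cancel₀ h1.2.2
          simp only [m]
          linear_combination fderiv ℂ g z (bv j.2) * hlv (bv j.1) - fderiv ℂ g z (bv j.1) * hlv (bv j.2)
        rw [hz0] at h3
        have h6 : mnm κ (ρ z) = 0 := by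
          rcases mul_eq_zero.1 h3.symm with h | h
          · exact h
          · exact absurd h h5
        obtain ⟨i, k1, k2⟩ := (mnm_eq_zero κ _).1 h6
        filter_upwards [hκ] with x hx hxI
        rw [hx, (mnm_eq_zero κ x).2 ⟨i, (hxI i).2 ((h2 i).1 k1), k2⟩, zero_mul]
    filter_upwards [eventually_all.2 this] with x hx hxI j
    exact hx j hxI
  -- equality of exponents
  have hβγ : β = γ := by
    ext i
    have hle : ∀ᶠ z in (W : Filter E), ‖((β i : ℂ) - γ i : ℂ)‖ * ‖u (ρ z)‖ ≤
        ‖fderiv ℂ u (ρ z) (Pi.single i (ρ z i))‖ := by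
      filter_upwards [hMe, hL.2.2.2, hρt.eventually hloc, hρt.eventually hfπ.eventually_nhds,
        hρt.eventually hgπ.eventually_nhds] with z h1 h2 h3 h4 h5
      obtain ⟨lam, hl, hlv⟩ := sing_to (df z h1.1.1) (dg z h1.1.1) h1.2.1 h1.2.2 h1.1.2
      set x := ρ z with hx
      have c1 := mnm_mul_fderiv β u _ x h3.2.2.1 h4 i
      have c2 := mnm_mul_fderiv γ (fun _ => 1) (fun y => g (π y)) x (by fun_prop)
        (h5.mono fun y hy => by rw [hy, mul_one]) i
      rw [fderiv_fun_comp x (df _ h3.2.1) h3.1] at c1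
      rw [fderiv_fun_comp x (dg _ h3.2.1) h3.1] at c2
      have c3 := hlv (fderiv ℂ π x (Pi.single i (x i)))
      have e1 : f z = mnm β x * u x := by rw [← h4.self_of_nhds, h2]
      have e2 : g z = mnm γ x := by rw [← h5.self_of_nhds, h2]
      rw [h2] at c1 c2
      simp only [ContinuousLinearMap.comp_apply, fderiv_const_apply, zero_apply,
        mul_one, add_zero] at c1 c2
      rw [c1, c2] at c3
      have hb : mnm β x ≠ 0 := fun h => h1.2.1 (by rw [e1, h, zero_mul])
      have hc : mnm γ x ≠ 0 := fun h => h1.2.2 (by rw [e2, h])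
      rw [e1, e2] at c3
      have c4 : fderiv ℂ u x (Pi.single i (x i)) = lam * γ i * u x - β i * u x := by
        apply mul_left_cancel₀ (mul_ne_zero hb hc)
        linear_combination c3
      have c5 : fderiv ℂ u x (Pi.single i (x i)) = (lam * γ i - β i) * u x := by rw [c4]; ring
      rw [c5, norm_mul]
      gcongr
      have n1 : ‖lam * γ i‖ = γ i := by rw [norm_mul, hl, one_mul]; simp
      have n2 : ‖(β i : ℂ)‖ = β i := by simp
      have n3 := abs_norm_sub_norm_le (lam * γ i) (β i : ℂ)
      rw [n1, n2] at n3
      have n4 : ‖(β i : ℂ) - γ i‖ = |(β i : ℝ) - γ i| := by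
        rw [← Real.norm_eq_abs, ← Complex.norm_real]; simp
      rw [n4, abs_sub_comm]
      exact n3
    have t1 : Tendsto (fun z => ‖((β i : ℂ) - γ i : ℂ)‖ * ‖u (ρ z)‖) W
        (𝓝 (‖((β i : ℂ) - γ i : ℂ)‖ * ‖u 0‖)) :=
      ((hu.continuousAt.tendsto.comp hρt).norm).const_mul _
    have t2 : Tendsto (fun z => ‖fderiv ℂ u (ρ z) (Pi.single i (ρ z i))‖) W (𝓝 0) := by
      have hc : ContinuousAt (fun x : Fin n → ℂ => ‖fderiv ℂ u x (Pi.single i (x i))‖) 0 := by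
        refine (ContinuousAt.clm_apply hu.fderiv.continuousAt ?_).norm
        have : Continuous (fun x : Fin n → ℂ => (Pi.single i (x i) : Fin n → ℂ)) :=
          (continuous_single i).comp (continuous_apply i)
        exact this.continuousAt
      have := hc.tendsto.comp hρt
      simpa [Function.comp_def] using this
    have hfin := le_of_tendsto_of_tendsto t1 t2 hle
    have hpos := norm_pos_iff.2 hu0
    have h0 : ‖((β i : ℂ) - γ i : ℂ)‖ = 0 := by
      apply le_antisymm _ (norm_nonneg _)
      by_contra hc
      push Not at hc
      nlinarith
    have := sub_eq_zero.1 (norm_eq_zero.1 h0)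
    exact_mod_cast this
  subst hβγ
  obtain ⟨r, hr, hball⟩ := Metric.eventually_nhds_iff_ball.1
    (hloc.and (hminv.and (hfπ.and hgπ)))
  refine ⟨{z | π (ρ z) = z ∧ ρ z ∈ ball (0 : Fin n → ℂ) r ∧ ∀ i, ρ z i = 0 ↔ i ∈ I}, ?_, ?_⟩
  · have : ∀ᶠ z in (W : Filter E), π (ρ z) = z ∧ ρ z ∈ ball (0 : Fin n → ℂ) r ∧ ∀ i, ρ z i = 0 ↔ i ∈ I :=
      hL.2.2.2.and ((hρt.eventually (ball_mem_nhds _ hr)).and hpat)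
    exact this
  · refine core U f g df dg h0U hf0 hg0 π ρ β i₀ hi I hγI u r (‖u 0‖ / 2)
      (half_pos (norm_pos_iff.2 hu0)) hr (fun x hx => (hball x hx).1.1) hL.2.1
      (fun x hx => (hball x hx).1.2.1) (fun x hx => (hball x hx).1.2.2.1)
      (fun x hx => (hball x hx).1.2.2.2) (fun x hx => (hball x hx).2.2.1)
      (fun x hx => (hball x hx).2.2.2) ?_
    intro x hx hxI
    refine minors_all e _ _ fun a b => ?_
    exact sub_eq_zero.1 ((hball x hx).2.1 hxI (a, b))

end partK

/-- For non-constant holomorphic germs `f, g : (ℂⁿ,0) → (ℂ,0)`, the image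
`f·conj g (Sing (f·conj g))` of the singular locus of the real-analytic map
`f·conj g` is well-defined as a set germ at the origin. -/
theorem stmt_6 (n : ℕ) (hn : 2 ≤ n)
    (U : Set (EuclideanSpace ℂ (Fin n))) (hU : IsOpen U)
    (h0U : (0 : EuclideanSpace ℂ (Fin n)) ∈ U)
    (f g : EuclideanSpace ℂ (Fin n) → ℂ)
    (hf : AnalyticOnNhd ℂ f U) (hg : AnalyticOnNhd ℂ g U)
    (hf0 : f 0 = 0) (hg0 : g 0 = 0)
    (hfnc : ¬ ∀ᶠ x in nhds (0 : EuclideanSpace ℂ (Fin n)), f x = 0)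
    (hgnc : ¬ ∀ᶠ x in nhds (0 : EuclideanSpace ℂ (Fin n)), g x = 0) :
    ∃ ε₀ > 0, ∀ ε ε', 0 < ε → ε < ε₀ → 0 < ε' → ε' < ε₀ → ∃ δ > 0,
      (fun x => f x * (starRingEnd ℂ) (g x)) ''
          ({x ∈ U | ¬ Function.Surjective
              (fderiv ℝ (fun x => f x * (starRingEnd ℂ) (g x)) x)} ∩ ball 0 ε)
          ∩ ball (0 : ℂ) δ =
      (fun x => f x * (starRingEnd ℂ) (g x)) ''
          ({x ∈ U | ¬ Function.Surjective
              (fderiv ℝ (fun x => f x * (starRingEnd ℂ) (g x)) x)} ∩ ball 0 ε')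
          ∩ ball (0 : ℂ) δ := by
  exact good_main _ _ fun W hW =>
    main_good (EuclideanSpace.equiv (Fin n) ℂ) U hU h0U f g hf hg hf0 hg0 hfnc hgnc W hW
end

section
/- Let n ≥ 2, let U be an open neighborhood of 0 in ℂ^n, and let f, g : U → ℂ be holomorphic with f(0) = g(0) = 0, neither of which is constant on any neighborhood of 0. Assume there is no invertible factorization, i.e., there do NOT exist an open neighborhood V of 0 in ℂ^n and a holomorphic function u : V → ℂ with u(0) ≠ 0 such that f(x) = u(x)·g(x) for all x ∈ V ∩ U. Then the image of h(z) = f(z)·conj(g(z)) is the full germ (ℂ, 0): for every sufficiently small ε > 0 there exists δ > 0 such that the open ball B_δ ⊆ ℂ is contained in h(U ∩ B_ε). -/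
open Metric Function

open Topology Filter

lemma exp_half_plane (M : ℝ) (x y : ℂ) (hx : x.re ≤ -M) (hy : y.re ≤ -M) :
    ‖Complex.exp x - Complex.exp y‖ ≤ Real.exp (-M) * ‖x - y‖ := by
  have hconv : Convex ℝ {z : ℂ | z.re ≤ -M} := convex_halfSpace_re_le _
  refine hconv.norm_image_sub_le_of_norm_deriv_le (𝕜 := ℂ) (f := Complex.exp)
    (fun z _ => Complex.differentiableAt_exp) (fun z hz => ?_) hy hx
  simp only [Complex.deriv_exp, Complex.norm_exp]
  exact Real.exp_le_exp.2 hz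

lemma log_part (F₁ : ℂ → ℂ) (t₀ : ℂ) (h : AnalyticAt ℂ F₁ t₀) (h0 : F₁ t₀ ≠ 0) :
    ∃ k : ℂ → ℂ, k t₀ = 0 ∧ (∃ C : NNReal, ∃ s ∈ 𝓝 t₀, LipschitzOnWith C k s) ∧
      ∀ᶠ t in 𝓝 t₀, F₁ t = F₁ t₀ * Complex.exp (k t) := by
  refine ⟨fun t => Complex.log (F₁ t / F₁ t₀), by simp [h0], ?_, ?_⟩
  · have : AnalyticAt ℂ (fun t => Complex.log (F₁ t / F₁ t₀)) t₀ := by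
      apply AnalyticAt.clog
      · exact h.div analyticAt_const h0
      · simp [h0]
    have h1 : ContDiffAt ℂ 1 (fun t => Complex.log (F₁ t / F₁ t₀)) t₀ := this.contDiffAt
    obtain ⟨C, s, hs, hl⟩ := h1.exists_lipschitzOnWith
    exact ⟨C, s, hs, hl⟩
  · filter_upwards [h.continuousAt.eventually_ne h0] with t ht
    rw [Complex.exp_log (div_ne_zero ht h0)]
    field_simp

lemma Linv_bound (A B : ℝ) (hA : 1 ≤ |A|) (hB : 1 ≤ |B|) (z : ℂ) :
    ‖(⟨z.re / A, z.im / B⟩ : ℂ)‖ ≤ ‖z‖ := by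
  rw [← sq_le_sq₀ (norm_nonneg _) (norm_nonneg _), Complex.sq_norm, Complex.sq_norm,
    Complex.normSq_apply, Complex.normSq_apply]
  have key : ∀ (A x : ℝ), 1 ≤ |A| → x / A * (x / A) ≤ x * x := by
    intro A x hA
    have h1 : 1 ≤ A * A := by nlinarith [abs_mul_abs_self A]
    rw [div_mul_div_comm]
    exact div_le_self (mul_self_nonneg x) h1
  exact add_le_add (key _ _ hA) (key _ _ hB)

lemma oneDim (F G : ℂ → ℂ) (t₀ : ℂ) (hF : AnalyticAt ℂ F t₀) (hG : AnalyticAt ℂ G t₀)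
    (hFt : analyticOrderAt F t₀ ≠ ⊤) (hGt : analyticOrderAt G t₀ ≠ ⊤)
    (hne : analyticOrderAt F t₀ ≠ analyticOrderAt G t₀) (N : Set ℂ) (hN : N ∈ 𝓝 t₀) :
    ∃ δ > 0, ball (0 : ℂ) δ ⊆ (fun t => F t * (starRingEnd ℂ) (G t)) '' N := by
  obtain ⟨F₁, hF₁, hF₁0, hFe⟩ := (hF.analyticOrderAt_ne_top).1 hFt
  obtain ⟨G₁, hG₁, hG₁0, hGe⟩ := (hG.analyticOrderAt_ne_top).1 hGt
  set a := analyticOrderNatAt F t₀ with ha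
  set b := analyticOrderNatAt G t₀ with hb
  have hab : a ≠ b := by
    intro h
    apply hne
    rw [← Nat.cast_analyticOrderNatAt hFt, ← Nat.cast_analyticOrderNatAt hGt, ← ha, ← hb, h]
  obtain ⟨k₁, hk₁0, ⟨C₁, s₁, hs₁, hl₁⟩, he₁⟩ := log_part F₁ t₀ hF₁ hF₁0
  obtain ⟨k₂, hk₂0, ⟨C₂, s₂, hs₂, hl₂⟩, he₂⟩ := log_part G₁ t₀ hG₁ hG₁0
  have hev : ∀ᶠ t in 𝓝 t₀, t ∈ N ∧ t ∈ s₁ ∧ t ∈ s₂ ∧ F t = (t - t₀) ^ a * (F₁ t₀ * Complex.exp (k₁ t)) ∧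
      G t = (t - t₀) ^ b * (G₁ t₀ * Complex.exp (k₂ t)) := by
    filter_upwards [hN, hs₁, hs₂, hFe, hGe, he₁, he₂] with t h1 h2 h3 h4 h5 h6 h7
    refine ⟨h1, h2, h3, ?_, ?_⟩
    · rw [h4, ← h6, smul_eq_mul]
    · rw [h5, ← h7, smul_eq_mul]
  obtain ⟨ρ, hρ, hball⟩ := Metric.eventually_nhds_iff_ball.1 hev
  set C : ℝ := C₁ + C₂ with hC
  have hC0 : 0 ≤ C := by positivity
  set K : ℂ → ℂ := fun t => k₁ t + (starRingEnd ℂ) (k₂ t) with hK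
  have hK0 : K t₀ = 0 := by simp [hK, hk₁0, hk₂0]
  have hKl : ∀ x ∈ ball t₀ ρ, ∀ y ∈ ball t₀ ρ, ‖K x - K y‖ ≤ C * ‖x - y‖ := by
    intro x hx y hy
    have e1 := hl₁.norm_sub_le (hball x hx).2.1 (hball y hy).2.1
    have e2 := hl₂.norm_sub_le (hball x hx).2.2.1 (hball y hy).2.2.1
    have : K x - K y = (k₁ x - k₁ y) + (starRingEnd ℂ) (k₂ x - k₂ y) := by
      simp only [hK, map_sub]; ring
    rw [this]
    refine (norm_add_le _ _).trans ?_
    rw [RCLike.norm_conj]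
    rw [hC]; linarith
  -- choose M
  obtain ⟨M, hM1, hM2⟩ : ∃ M : ℝ, Real.exp (-M) < ρ ∧ C * Real.exp (-M) ≤ 1 / 2 := by
    have t1 : Tendsto (fun M : ℝ => Real.exp (-M)) atTop (𝓝 0) :=
      Real.tendsto_exp_neg_atTop_nhds_zero
    have t2 : Tendsto (fun M : ℝ => C * Real.exp (-M)) atTop (𝓝 0) := by
      simpa using t1.const_mul C
    have := (t1.eventually (gt_mem_nhds hρ)).and (t2.eventually (ge_mem_nhds (by norm_num : (0:ℝ) < 1 / 2)))
    exact this.exists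
  set D : Set ℂ := {z | z.re ≤ -M} with hD
  have hmem : ∀ z ∈ D, t₀ + Complex.exp z ∈ ball t₀ ρ := by
    intro z hz
    rw [mem_ball, dist_eq_norm, add_sub_cancel_left, Complex.norm_exp]
    exact (Real.exp_le_exp.2 hz).trans_lt hM1
  set k : ℂ → ℂ := fun z => K (t₀ + Complex.exp z) with hk
  have hkl : ∀ x ∈ D, ∀ y ∈ D, ‖k x - k y‖ ≤ 1 / 2 * ‖x - y‖ := by
    intro x hx y hy
    have e1 := hKl _ (hmem x hx) _ (hmem y hy)
    rw [add_sub_add_left_eq_sub] at e1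
    have e2 := exp_half_plane M x y hx hy
    calc ‖k x - k y‖ ≤ _ := e1
      _ ≤ C * (Real.exp (-M) * ‖x - y‖) := by gcongr
      _ = (C * Real.exp (-M)) * ‖x - y‖ := by ring
      _ ≤ _ := by gcongr
  have hkb : ∀ x ∈ D, ‖k x‖ ≤ 1 / 2 := by
    intro x hx
    have e1 := hKl _ (hmem x hx) t₀ (mem_ball_self hρ)
    rw [hK0, sub_zero, add_sub_cancel_left, Complex.norm_exp] at e1
    refine e1.trans (le_trans ?_ hM2)
    gcongr
    exact hx
  set A : ℝ := (a : ℝ) + b with hA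
  set B : ℝ := (a : ℝ) - b with hB
  have hA1 : 1 ≤ A := by
    have : 1 ≤ a + b := by omega
    rw [hA]; exact_mod_cast this
  have hB1 : 1 ≤ |B| := by
    have : (1 : ℤ) ≤ |(a : ℤ) - b| := Int.one_le_abs (by omega)
    rw [hB]; exact_mod_cast this
  have hA1' : 1 ≤ |A| := hA1.trans (le_abs_self _)
  have hB0 : B ≠ 0 := by intro h; rw [h] at hB1; norm_num at hB1
  set w₀ : ℂ := F₁ t₀ * (starRingEnd ℂ) (G₁ t₀) with hw₀
  have hw0 : w₀ ≠ 0 := mul_ne_zero hF₁0 (by simpa using hG₁0)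
  refine ⟨‖w₀‖ * Real.exp (-(M * A) - 1 / 2), by positivity, ?_⟩
  intro c hc
  rw [mem_ball, dist_zero_right] at hc
  by_cases hc0 : c = 0
  · refine ⟨t₀, mem_of_mem_nhds hN, ?_⟩
    have h1 := (hball t₀ (mem_ball_self hρ)).2.2.2.1
    have h2 := (hball t₀ (mem_ball_self hρ)).2.2.2.2
    simp only [h1, h2, hc0, sub_self]
    rcases Nat.eq_zero_or_pos a with h | h
    · have : b ≠ 0 := by omega
      simp [this]
    · simp [h.ne']
  set c' := c / w₀ with hc'
  have hc'0 : c' ≠ 0 := div_ne_zero hc0 hw0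
  have hcn : Real.log ‖c'‖ ≤ -(M * A) - 1 / 2 := by
    rw [Real.log_le_iff_le_exp (norm_pos_iff.2 hc'0), hc', norm_div, div_le_iff₀ (norm_pos_iff.2 hw0)]
    linarith
  set l := Complex.log c' with hl
  set T : ℂ → ℂ := fun z => ⟨(l - k z).re / A, (l - k z).im / B⟩ with hT
  have hTm : Set.MapsTo T D D := by
    intro z hz
    change (l - k z).re / A ≤ -M
    rw [div_le_iff₀ (by linarith), Complex.sub_re, hl, Complex.log_re]
    have := (Complex.abs_re_le_norm (k z)).trans (hkb z hz)
    have := (abs_le.1 this).1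
    linarith
  have hTc : ContractingWith (1 / 2) (hTm.restrict T D D) := by
    refine ⟨by rw [← NNReal.coe_lt_coe]; norm_num, LipschitzWith.of_dist_le_mul ?_⟩
    rintro ⟨x, hx⟩ ⟨y, hy⟩
    rw [Subtype.dist_eq, Subtype.dist_eq, dist_eq_norm, dist_eq_norm]
    simp only [Set.MapsTo.val_restrict_apply]
    have : T x - T y = ⟨(k y - k x).re / A, (k y - k x).im / B⟩ := by
      apply Complex.ext <;> simp [hT] <;> ring
    rw [this]
    refine (Linv_bound A B hA1' hB1 _).trans ?_
    rw [norm_sub_rev]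
    simpa using hkl x hx y hy
  have hDc : IsComplete D := (isClosed_le Complex.continuous_re continuous_const).isComplete
  have hx0 : ((-M : ℝ) : ℂ) ∈ D := by simp [hD]
  obtain ⟨z, hzD, hfix, -, -⟩ := hTc.exists_fixedPoint' hDc hTm hx0 (edist_ne_top _ _)
  have hz : (a : ℂ) * z + b * (starRingEnd ℂ) z + k z = l := by
    have hfix : T z = z := hfix
    have h1 : (l - k z).re / A = z.re := congrArg Complex.re hfix
    have h2 : (l - k z).im / B = z.im := congrArg Complex.im hfix
    rw [div_eq_iff (by linarith)] at h1
    rw [div_eq_iff hB0] at h2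
    simp only [Complex.sub_re, Complex.sub_im] at h1 h2
    apply Complex.ext
    · simp; rw [hA] at h1; linarith
    · simp; rw [hB] at h2; linarith
  have hb' := hball _ (hmem z hzD)
  refine ⟨t₀ + Complex.exp z, hb'.1, ?_⟩
  simp only [hb'.2.2.2.1, hb'.2.2.2.2, add_sub_cancel_left]
  have hcc : c = w₀ * Complex.exp l := by
    rw [hl, Complex.exp_log hc'0, hc']; field_simp
  rw [hcc, ← hz, Complex.exp_add, Complex.exp_add, Complex.exp_nat_mul, Complex.exp_nat_mul]
  simp only [hk, hK, Complex.exp_add, map_mul, map_pow, ← Complex.exp_conj, hw₀]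
  ring

lemma quotient_exists (F G : ℂ → ℂ) (r : ℝ)
    (hF : AnalyticOnNhd ℂ F (closedBall 0 r)) (hG : AnalyticOnNhd ℂ G (closedBall 0 r))
    (hGt : ∀ t ∈ closedBall (0 : ℂ) r, analyticOrderAt G t ≠ ⊤)
    (heq : ∀ t ∈ closedBall (0 : ℂ) r, analyticOrderAt F t = analyticOrderAt G t) :
    ∃ q : ℂ → ℂ, AnalyticOnNhd ℂ q (closedBall 0 r) ∧
      (∀ t ∈ closedBall (0 : ℂ) r, q t ≠ 0) ∧ ∀ t ∈ closedBall (0 : ℂ) r, F t = q t * G t := by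
  set S := closedBall (0 : ℂ) r
  have hm : MeromorphicOn (F / G) S := fun t ht =>
    (hF t ht).meromorphicAt.div (hG t ht).meromorphicAt
  set q := toMeromorphicNFOn (F / G) S with hq
  have hqe : ∀ t ∈ S, q =ᶠ[𝓝[≠] t] F / G := fun t ht => hm.toMeromorphicNFOn_eq_self_on_nhdsNE ht
  have hNF : ∀ t ∈ S, MeromorphicNFAt q t := fun t ht => meromorphicNFOn_toMeromorphicNFOn _ _ ht
  have hord : ∀ t ∈ S, meromorphicOrderAt q t = 0 := by
    intro t ht
    rw [meromorphicOrderAt_congr (hqe t ht), div_eq_mul_inv,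
      meromorphicOrderAt_mul (hF t ht).meromorphicAt (hG t ht).meromorphicAt.inv,
      meromorphicOrderAt_inv, (hF t ht).meromorphicOrderAt_eq, (hG t ht).meromorphicOrderAt_eq,
      heq t ht]
    obtain ⟨m, hm⟩ := ENat.ne_top_iff_exists.1 (hGt t ht)
    rw [← hm]
    simp only [ENat.map_natCast]
    norm_cast
    simp
  have han : AnalyticOnNhd ℂ q S := fun t ht =>
    (hNF t ht).meromorphicOrderAt_nonneg_iff_analyticAt.1 (hord t ht).ge
  refine ⟨q, han, fun t ht => (hNF t ht).meromorphicOrderAt_eq_zero_iff.1 (hord t ht), ?_⟩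
  intro t ht
  have hGne : ∀ᶠ s in 𝓝[≠] t, G s ≠ 0 := by
    rcases (hG t ht).eventually_eq_zero_or_eventually_ne_zero with h | h
    · exact absurd (analyticOrderAt_eq_top.2 h) (hGt t ht)
    · exact h
  have he : F =ᶠ[𝓝[≠] t] q * G := by
    filter_upwards [hGne, hqe t ht] with s h1 h2
    simp only [Pi.mul_apply, h2, Pi.div_apply]
    field_simp
  have h1 : Tendsto F (𝓝[≠] t) (𝓝 (F t)) := (hF t ht).continuousAt.continuousWithinAt
  have h2 : Tendsto (q * G) (𝓝[≠] t) (𝓝 ((q * G) t)) :=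
    ((han t ht).mul (hG t ht)).continuousAt.continuousWithinAt
  exact tendsto_nhds_unique (h1.congr' he) h2

lemma mean_functional (r : ℝ) (hr : 0 < r) :
    ∃ Λ : C(sphere (0 : ℂ) r, ℂ) →L[ℂ] ℂ, ∀ q : ℂ → ℂ, AnalyticOnNhd ℂ q (closedBall 0 r) →
      ∀ φ : C(sphere (0 : ℂ) r, ℂ), (∀ t, φ t = q t) → Λ φ = q 0 := by
  have hmem : ∀ θ, circleMap 0 r θ ∈ sphere (0 : ℂ) r := circleMap_mem_sphere 0 hr.le
  have hc : Continuous (fun θ : ℝ => (⟨circleMap 0 r θ, hmem θ⟩ : sphere (0 : ℂ) r)) :=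
    (continuous_circleMap 0 r).subtype_mk _
  have hci : ∀ φ : C(sphere (0 : ℂ) r, ℂ), IntervalIntegrable
      (fun θ : ℝ => φ ⟨circleMap 0 r θ, hmem θ⟩) MeasureTheory.volume 0 (2 * Real.pi) := fun φ =>
    (φ.continuous.comp hc).intervalIntegrable _ _
  let L : C(sphere (0 : ℂ) r, ℂ) →ₗ[ℂ] ℂ :=
    { toFun := fun φ => ∫ θ in (0 : ℝ)..(2 * Real.pi), φ ⟨circleMap 0 r θ, hmem θ⟩
      map_add' := fun φ ψ => by
        simp only [ContinuousMap.add_apply]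
        exact intervalIntegral.integral_add (hci φ) (hci ψ)
      map_smul' := fun c φ => by
        simp only [ContinuousMap.smul_apply, RingHom.id_apply]
        exact intervalIntegral.integral_smul _ _ }
  let Λ : C(sphere (0 : ℂ) r, ℂ) →L[ℂ] ℂ := L.mkContinuous |2 * Real.pi - 0| (fun φ => by
    rw [mul_comm]
    exact intervalIntegral.norm_integral_le_of_norm_le_const (fun θ _ => φ.norm_coe_le_norm _))
  refine ⟨((2 * Real.pi)⁻¹ : ℝ) • Λ, fun q hq φ hφ => ?_⟩
  have hd : DiffContOnCl ℂ q (ball 0 |r|) := by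
    rw [abs_of_pos hr]
    apply DifferentiableOn.diffContOnCl
    rw [closure_ball _ hr.ne']
    exact hq.differentiableOn
  rw [← hd.circleAverage, Real.circleAverage]
  change (2 * Real.pi)⁻¹ • (∫ θ in (0 : ℝ)..(2 * Real.pi), φ ⟨circleMap 0 r θ, hmem θ⟩) = _
  simp [hφ]

section
variable {E : Type*} [NormedAddCommGroup E] [NormedSpace ℂ E]
  {K : Type*} [TopologicalSpace K] [CompactSpace K]

/-- pointwise application of a continuous multilinear map to continuous functions -/
noncomputable def ptwise {m : ℕ} (p : ContinuousMultilinearMap ℂ (fun _ : Fin m => E) ℂ) :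
    ContinuousMultilinearMap ℂ (fun _ : Fin m => C(K, E)) C(K, ℂ) :=
  MultilinearMap.mkContinuous
    { toFun := fun γ => ⟨fun k => p (fun i => γ i k),
        p.cont.comp (continuous_pi fun i => (γ i).continuous)⟩
      map_update_add' := by
        intro _ γ i x y
        ext k
        have h : ∀ z : C(K, E), (fun j => (update γ i z) j k) = update (fun j => γ j k) i (z k) := by
          intro z; ext j
          by_cases hj : j = i
          · subst hj; simp
          · simp [hj]
        simp only [ContinuousMap.coe_mk, ContinuousMap.add_apply]
        have e : ∀ z : C(K, E), p (fun j => (update γ i z) j k) = p (update (fun j => γ j k) i (z k)) :=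
          fun z => by rw [h]
        convert p.map_update_add (fun j => γ j k) i (x k) (y k) using 1
        · convert e (x + y)
          rfl
        · congr 1
          · convert e x
          · convert e y
      map_update_smul' := by
        intro _ γ i c x
        ext k
        have h : ∀ z : C(K, E), (fun j => (update γ i z) j k) = update (fun j => γ j k) i (z k) := by
          intro z; ext j
          by_cases hj : j = i
          · subst hj; simp
          · simp [hj]
        simp only [ContinuousMap.coe_mk, ContinuousMap.smul_apply]
        have e : ∀ z : C(K, E), p (fun j => (update γ i z) j k) = p (update (fun j => γ j k) i (z k)) :=
          fun z => by rw [h]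
        convert p.map_update_smul (fun j => γ j k) i c (x k) using 1
        · convert e (c • x)
          rfl
        · congr 1
          convert e x }
    ‖p‖ (by
      intro γ
      rw [ContinuousMap.norm_le _ (by positivity)]
      intro k
      refine (p.le_opNorm _).trans ?_
      gcongr with i
      exact (γ i).norm_coe_le_norm k)

lemma ptwise_apply {m : ℕ} (p : ContinuousMultilinearMap ℂ (fun _ : Fin m => E) ℂ)
    (γ : Fin m → C(K, E)) (k : K) : ptwise p γ k = p (fun i => γ i k) := rfl

lemma ptwise_norm {m : ℕ} (p : ContinuousMultilinearMap ℂ (fun _ : Fin m => E) ℂ) :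
    ‖(ptwise p : ContinuousMultilinearMap ℂ (fun _ : Fin m => C(K, E)) C(K, ℂ))‖ ≤ ‖p‖ :=
  MultilinearMap.mkContinuous_norm_le _ (norm_nonneg _) _

/-- translation of an analytic function, as an analytic map to continuous functions -/
lemma lift_analytic (f : E → ℂ) (hf : AnalyticAt ℂ f 0) :
    ∃ ρ > (0 : ℝ), ∀ ι : C(K, E), ‖ι‖ < ρ → ∃ A : E → C(K, ℂ), AnalyticAt ℂ A 0 ∧
      ∀ᶠ x in 𝓝 (0 : E), ∀ k, A x k = f (x + ι k) := by
  obtain ⟨p, R, hp⟩ := hf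
  obtain ⟨ρ, hρ0, hρR⟩ := ENNReal.lt_iff_exists_nnreal_btwn.1 hp.r_pos
  have hρ0 : 0 < ρ := by exact_mod_cast hρ0
  let P : FormalMultilinearSeries ℂ C(K, E) C(K, ℂ) := fun n => ptwise (p n)
  have hrad : p.radius ≤ P.radius := by
    apply FormalMultilinearSeries.radius_le_of_le
    intro n
    exact ptwise_norm _
  have hPR : (ρ : ENNReal) < P.radius := hρR.trans_le (hp.r_le.trans hrad)
  have hPs := P.hasFPowerSeriesOnBall (lt_of_le_of_lt (zero_le) hPR)
  refine ⟨ρ, hρ0, fun ι hι => ⟨fun x => P.sum (ContinuousLinearMap.const ℂ K x + ι), ?_, ?_⟩⟩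
  · have hmem : ι ∈ Metric.eball (0 : C(K, E)) P.radius := by
      rw [Metric.mem_eball, edist_zero_right]
      refine lt_trans ?_ hPR
      rw [enorm_eq_nnnorm]
      exact_mod_cast hι
    have h1 : AnalyticAt ℂ P.sum (ContinuousLinearMap.const ℂ K (0 : E) + ι) := by
      rw [map_zero, zero_add]
      exact hPs.analyticAt_of_mem hmem
    have h2 : AnalyticAt ℂ (fun x : E => ContinuousLinearMap.const ℂ K x + ι) 0 :=
      (ContinuousLinearMap.analyticAt _ _).add analyticAt_const
    exact AnalyticAt.comp (g := P.sum)
      (f := fun x : E => ContinuousLinearMap.const ℂ K x + ι) h1 h2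
  · have hcont : Tendsto (fun x : E => ‖x‖ + ‖ι‖) (𝓝 0) (𝓝 (‖(0 : E)‖ + ‖ι‖)) :=
      (continuous_norm.add continuous_const).tendsto 0
    have hlt : ‖(0 : E)‖ + ‖ι‖ < ρ := by simpa using hι
    filter_upwards [hcont.eventually (gt_mem_nhds hlt)] with x hx k
    have hn : ‖ContinuousLinearMap.const ℂ K x + ι‖ < ρ := by
      refine (norm_add_le _ _).trans_lt (lt_of_le_of_lt ?_ hx)
      gcongr
      rw [ContinuousMap.norm_le _ (norm_nonneg _)]
      intro k; exact le_rfl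
    have hm : ContinuousLinearMap.const ℂ K x + ι ∈ Metric.eball (0 : C(K, E)) P.radius := by
      rw [Metric.mem_eball, edist_zero_right]
      refine lt_trans ?_ hPR
      rw [enorm_eq_nnnorm]
      exact_mod_cast hn
    have hs := hPs.hasSum hm
    rw [zero_add] at hs
    have hs' := hs.mapL (ContinuousMap.evalCLM ℂ k)
    have hk : x + ι k ∈ Metric.eball (0 : E) R := by
      rw [Metric.mem_eball, edist_zero_right]
      refine lt_trans ?_ hρR
      rw [enorm_eq_nnnorm]
      have : ‖x + ι k‖ < ρ := lt_of_le_of_lt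
        ((norm_add_le _ _).trans (by gcongr; exact ι.norm_coe_le_norm k)) hx
      exact_mod_cast this
    have hs2 := hp.hasSum hk
    rw [zero_add] at hs2
    exact hs'.unique hs2
end

lemma exists_dir {E : Type*} [NormedAddCommGroup E] [NormedSpace ℂ E]
    (f g : E → ℂ) (hf : AnalyticAt ℂ f 0) (hg : AnalyticAt ℂ g 0)
    (hfnc : ¬ ∀ᶠ x in 𝓝 (0 : E), f x = 0) (hgnc : ¬ ∀ᶠ x in 𝓝 (0 : E), g x = 0) :
    ∃ v : E, analyticOrderAt (fun t : ℂ => f (t • v)) 0 ≠ ⊤ ∧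
      analyticOrderAt (fun t : ℂ => g (t • v)) 0 ≠ ⊤ := by
  obtain ⟨η, hη, hB⟩ := Metric.eventually_nhds_iff_ball.1
    (hf.eventually_analyticAt.and hg.eventually_analyticAt)
  obtain ⟨v, hv, hfv, hgv⟩ : ∃ v ∈ ball (0 : E) η, f v ≠ 0 ∧ g v ≠ 0 := by
    by_contra! hcon
    obtain ⟨x, hx, hfx⟩ : ∃ x ∈ ball (0 : E) η, f x ≠ 0 := by
      by_contra! h
      exact hfnc (Metric.eventually_nhds_iff_ball.2 ⟨η, hη, h⟩)
    have hgz : g =ᶠ[𝓝 x] 0 := by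
      filter_upwards [(hB x hx).1.continuousAt.eventually_ne hfx, isOpen_ball.mem_nhds hx]
        with y hy hyB
      exact hcon y hyB hy
    have hgB : AnalyticOnNhd ℂ g (ball 0 η) := fun y hy => (hB y hy).2
    have := hgB.eqOn_zero_of_preconnected_of_eventuallyEq_zero
      (convex_ball (0 : E) η).isPreconnected hx hgz
    exact hgnc (Metric.eventually_nhds_iff_ball.2 ⟨η, hη, this⟩)
  have key : ∀ h : E → ℂ, (∀ y ∈ ball (0 : E) η, AnalyticAt ℂ h y) → h v ≠ 0 →
      analyticOrderAt (fun t : ℂ => h (t • v)) 0 ≠ ⊤ := by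
    intro h hh hhv
    have han : AnalyticOnNhd ℂ (fun t : ℂ => h (t • v)) (closedBall 0 1) := by
      intro t ht
      have hm : t • v ∈ ball (0 : E) η := by
        rw [mem_ball_zero_iff] at hv ⊢
        rw [mem_closedBall_zero_iff] at ht
        rw [norm_smul]
        exact lt_of_le_of_lt (mul_le_of_le_one_left (norm_nonneg _) ht) hv
      have h2 : AnalyticAt ℂ (fun t : ℂ => t • v) t := analyticAt_id.smul analyticAt_const
      exact AnalyticAt.comp (g := h) (f := fun t : ℂ => t • v) (hh _ hm) h2
    have h1 : (1 : ℂ) ∈ closedBall (0 : ℂ) 1 := by simp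
    refine han.analyticOrderAt_ne_top_of_isPreconnected
      (convex_closedBall (0 : ℂ) 1).isPreconnected h1 (by simp) ?_
    rw [(han 1 h1).analyticOrderAt_eq_zero.2 (by simpa using hhv)]
    simp
  exact ⟨v, key f (fun y hy => (hB y hy).1) hfv, key g (fun y hy => (hB y hy).2) hgv⟩

lemma factor_of_orders {E : Type*} [NormedAddCommGroup E] [NormedSpace ℂ E]
    (f g : E → ℂ) (η : ℝ) (hη : 0 < η) (hf : AnalyticOnNhd ℂ f (ball 0 η))
    (hg : AnalyticOnNhd ℂ g (ball 0 η)) (v : E)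
    (hfv : analyticOrderAt (fun t : ℂ => f (t • v)) 0 ≠ ⊤)
    (hgv : analyticOrderAt (fun t : ℂ => g (t • v)) 0 ≠ ⊤)
    (H : ∀ (x : E) (t : ℂ), x + t • v ∈ ball (0 : E) η →
      analyticOrderAt (fun s : ℂ => f (x + s • v)) t ≠ ⊤ →
      analyticOrderAt (fun s : ℂ => g (x + s • v)) t ≠ ⊤ →
      analyticOrderAt (fun s : ℂ => f (x + s • v)) t =
        analyticOrderAt (fun s : ℂ => g (x + s • v)) t) :
    ∃ u : E → ℂ, AnalyticAt ℂ u 0 ∧ u 0 ≠ 0 ∧ ∀ᶠ x in 𝓝 (0 : E), f x = u x * g x := by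
  have h0 : (0 : E) ∈ ball (0 : E) η := mem_ball_self hη
  have hcomp : ∀ h : E → ℂ, AnalyticOnNhd ℂ h (ball 0 η) → ∀ (x : E) (t : ℂ),
      x + t • v ∈ ball (0 : E) η → AnalyticAt ℂ (fun s : ℂ => h (x + s • v)) t := by
    intro h hh x t ht
    have h2 : AnalyticAt ℂ (fun t : ℂ => x + t • v) t :=
      analyticAt_const.add (analyticAt_id.smul analyticAt_const)
    exact AnalyticAt.comp (g := h) (f := fun t : ℂ => x + t • v) (hh _ ht) h2
  have hpun : ∀ h : E → ℂ, AnalyticOnNhd ℂ h (ball 0 η) →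
      analyticOrderAt (fun t : ℂ => h (t • v)) 0 ≠ ⊤ →
      ∃ R > 0, ∀ t : ℂ, ‖t‖ < R → t ≠ 0 → h (t • v) ≠ 0 := by
    intro h hh hv
    have ha := hcomp h hh 0 0 (by simpa using hη)
    simp only [zero_add] at ha
    rcases ha.eventually_eq_zero_or_eventually_ne_zero with h1 | h1
    · exact absurd (analyticOrderAt_eq_top.2 h1) hv
    · rw [eventually_nhdsWithin_iff, Metric.eventually_nhds_iff_ball] at h1
      obtain ⟨R, hR, h2⟩ := h1
      exact ⟨R, hR, fun t ht ht0 => h2 t (by simpa using ht) ht0⟩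
  obtain ⟨R₁, hR₁, hp₁⟩ := hpun f hf hfv
  obtain ⟨R₂, hR₂, hp₂⟩ := hpun g hg hgv
  -- the radii for the lifting lemma do not depend on the circle, after rescaling to the unit circle
  obtain ⟨ρ₁, hρ₁, hA₁⟩ := lift_analytic (K := sphere (0 : ℂ) 1) f (hf 0 h0)
  obtain ⟨ρ₂, hρ₂, hA₂⟩ := lift_analytic (K := sphere (0 : ℂ) 1) g (hg 0 h0)
  obtain ⟨r, hr, hrR₁, hrR₂, hrη, hrρ₁, hrρ₂⟩ : ∃ r : ℝ, 0 < r ∧ r < R₁ ∧ r < R₂ ∧ r * ‖v‖ < η ∧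
      r * ‖v‖ < ρ₁ ∧ r * ‖v‖ < ρ₂ := by
    have t1 : Tendsto (fun r : ℝ => r) (𝓝[>] 0) (𝓝 0) := tendsto_nhdsWithin_of_tendsto_nhds tendsto_id
    have t2 : Tendsto (fun r : ℝ => r * ‖v‖) (𝓝[>] 0) (𝓝 0) := by simpa using t1.mul_const ‖v‖
    have e0 : ∀ᶠ r : ℝ in 𝓝[>] 0, 0 < r := eventually_mem_nhdsWithin
    exact (e0.and <| (t1.eventually (gt_mem_nhds hR₁)).and <| (t1.eventually (gt_mem_nhds hR₂)).and <|
      (t2.eventually (gt_mem_nhds hη)).and <| (t2.eventually (gt_mem_nhds hρ₁)).and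
      (t2.eventually (gt_mem_nhds hρ₂))).exists
  set w : E := (r : ℂ) • v with hw
  have hwn : ‖w‖ = r * ‖v‖ := by rw [hw, norm_smul]; simp [abs_of_pos hr]
  let ι : C(sphere (0 : ℂ) 1, E) := ⟨fun t => (t : ℂ) • w, by fun_prop⟩
  have hι : ‖ι‖ ≤ r * ‖v‖ := by
    rw [ContinuousMap.norm_le _ (by positivity)]
    rintro ⟨t, ht⟩
    change ‖t • w‖ ≤ _
    rw [mem_sphere_zero_iff_norm] at ht
    rw [norm_smul, ht, one_mul, hwn]
  obtain ⟨A, hAan, hA⟩ := hA₁ ι (hι.trans_lt hrρ₁)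
  obtain ⟨B, hBan, hB⟩ := hA₂ ι (hι.trans_lt hrρ₂)
  obtain ⟨Λ, hΛ⟩ := mean_functional 1 one_pos
  have hunit : ∀ (h : E → ℂ) (A : E → C(sphere (0 : ℂ) 1, ℂ)) (R : ℝ), r < R →
      (∀ t : ℂ, ‖t‖ < R → t ≠ 0 → h (t • v) ≠ 0) → (∀ k, A 0 k = h (0 + ι k)) → IsUnit (A 0) := by
    intro h A R hrR hR hA
    rw [ContinuousMap.isUnit_iff_forall_ne_zero]
    rintro ⟨t, ht⟩
    rw [hA]
    change h (0 + t • w) ≠ 0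
    rw [mem_sphere_zero_iff_norm] at ht
    rw [zero_add, hw, smul_smul]
    refine hR _ ?_ ?_
    · rw [norm_mul, ht]; simpa [abs_of_pos hr] using hrR
    · refine mul_ne_zero ?_ (by exact_mod_cast hr.ne')
      rw [← norm_ne_zero_iff, ht]; norm_num
  have huA : IsUnit (A 0) := hunit f A R₁ hrR₁ hp₁ hA.self_of_nhds
  have huB : IsUnit (B 0) := hunit g B R₂ hrR₂ hp₂ hB.self_of_nhds
  have hinv : AnalyticAt ℂ (fun x => Ring.inverse (B x)) 0 := by
    have h1 : AnalyticAt ℂ Ring.inverse (B 0) := by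
      have := analyticAt_inverse (𝕜 := ℂ) huB.unit
      simpa using this
    exact AnalyticAt.comp (g := Ring.inverse) (f := B) h1 hBan
  have huan : AnalyticAt ℂ (fun x => Λ (A x * Ring.inverse (B x))) 0 :=
    (Λ.analyticAt _).comp (hAan.mul hinv)
  have hevA : ∀ᶠ x in 𝓝 (0 : E), IsUnit (A x) :=
    hAan.continuousAt.eventually (Units.isOpen.mem_nhds huA)
  have hevB : ∀ᶠ x in 𝓝 (0 : E), IsUnit (B x) :=
    hBan.continuousAt.eventually (Units.isOpen.mem_nhds huB)
  have hevn : ∀ᶠ x in 𝓝 (0 : E), ‖x‖ < η - r * ‖v‖ := by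
    have : Tendsto (fun x : E => ‖x‖) (𝓝 0) (𝓝 0) := by
      simpa using (continuous_norm (E := E)).tendsto 0
    exact this.eventually (gt_mem_nhds (by linarith))
  have hmain : ∀ᶠ x in 𝓝 (0 : E), Λ (A x * Ring.inverse (B x)) ≠ 0 ∧
      f x = Λ (A x * Ring.inverse (B x)) * g x := by
    filter_upwards [hA, hB, hevA, hevB, hevn] with x hAx hBx huAx huBx hx
    rw [ContinuousMap.isUnit_iff_forall_ne_zero] at huAx
    have huBx' := huBx
    rw [ContinuousMap.isUnit_iff_forall_ne_zero] at huBx'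
    set S := closedBall (0 : ℂ) r with hS
    have hin : ∀ t ∈ S, x + t • v ∈ ball (0 : E) η := by
      intro t ht
      rw [hS, mem_closedBall_zero_iff] at ht
      rw [mem_ball_zero_iff]
      have h1 := norm_add_le x (t • v)
      rw [norm_smul] at h1
      have h2 : ‖t‖ * ‖v‖ ≤ r * ‖v‖ := by gcongr
      linarith
    have hF : AnalyticOnNhd ℂ (fun s : ℂ => f (x + s • v)) S := fun t ht => hcomp f hf x t (hin t ht)
    have hG : AnalyticOnNhd ℂ (fun s : ℂ => g (x + s • v)) S := fun t ht => hcomp g hg x t (hin t ht)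
    have hrS : (r : ℂ) ∈ S := by simp [hS, abs_of_pos hr]
    have h1s : (1 : ℂ) ∈ sphere (0 : ℂ) 1 := by simp
    have hSc : IsPreconnected S := (convex_closedBall (0 : ℂ) r).isPreconnected
    have hFt : ∀ t ∈ S, analyticOrderAt (fun s : ℂ => f (x + s • v)) t ≠ ⊤ := by
      intro t ht
      refine hF.analyticOrderAt_ne_top_of_isPreconnected hSc hrS ht ?_
      have := huAx ⟨1, h1s⟩
      rw [hAx] at this
      change f (x + (1 : ℂ) • w) ≠ 0 at this
      rw [one_smul] at this
      rw [(hF _ hrS).analyticOrderAt_eq_zero.2 this]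
      simp
    have hGt : ∀ t ∈ S, analyticOrderAt (fun s : ℂ => g (x + s • v)) t ≠ ⊤ := by
      intro t ht
      refine hG.analyticOrderAt_ne_top_of_isPreconnected hSc hrS ht ?_
      have := huBx' ⟨1, h1s⟩
      rw [hBx] at this
      change g (x + (1 : ℂ) • w) ≠ 0 at this
      rw [one_smul] at this
      rw [(hG _ hrS).analyticOrderAt_eq_zero.2 this]
      simp
    obtain ⟨q, hqan, hq0, hqe⟩ := quotient_exists _ _ r hF hG hGt
      (fun t ht => H x t (hin t ht) (hFt t ht) (hGt t ht))
    have h0S : (0 : ℂ) ∈ S := by simp [hS, hr.le]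
    have hscale : ∀ t ∈ closedBall (0 : ℂ) 1, t * r ∈ S := by
      intro t ht
      rw [mem_closedBall_zero_iff] at ht
      rw [hS, mem_closedBall_zero_iff, norm_mul]
      simpa [abs_of_pos hr] using mul_le_of_le_one_left hr.le ht
    have hq' : AnalyticOnNhd ℂ (fun t : ℂ => q (t * r)) (closedBall 0 1) := by
      intro t ht
      have h2 : AnalyticAt ℂ (fun t : ℂ => t * r) t := analyticAt_id.mul analyticAt_const
      exact AnalyticAt.comp (g := q) (f := fun t : ℂ => t * r) (hqan _ (hscale t ht)) h2
    have hval : Λ (A x * Ring.inverse (B x)) = q 0 := by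
      have := hΛ _ hq' (A x * Ring.inverse (B x)) ?_
      · simpa using this
      · rintro ⟨t, ht⟩
        have e1 : (A x * Ring.inverse (B x)) * B x = A x := by
          rw [mul_assoc, Ring.inverse_mul_cancel _ huBx, mul_one]
        have e2 := congrArg (fun φ => φ ⟨t, ht⟩) e1
        have e3 := hqe (t * r) (hscale t (sphere_subset_closedBall ht))
        have e4 : A x ⟨t, ht⟩ = f (x + (t * (r : ℂ)) • v) := by
          rw [hAx]; change f (x + t • w) = _; rw [hw, smul_smul]
        have e5 : B x ⟨t, ht⟩ = g (x + (t * (r : ℂ)) • v) := by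
          rw [hBx]; change g (x + t • w) = _; rw [hw, smul_smul]
        have e6 : (A x * Ring.inverse (B x)) ⟨t, ht⟩ * B x ⟨t, ht⟩ = A x ⟨t, ht⟩ := e2
        apply mul_right_cancel₀ (huBx' ⟨t, ht⟩)
        rw [e6, e4, e5]
        exact e3
    rw [hval]
    refine ⟨hq0 0 h0S, ?_⟩
    simpa using hqe 0 h0S
  exact ⟨_, huan, hmain.self_of_nhds.1, hmain.mono fun x hx => hx.2⟩

/-- If `f ≠ u·g` for every invertible holomorphic germ `u`, then the image of
`f·conj g` is the full germ `(ℂ, 0)`. -/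
theorem stmt_7 (n : ℕ) (hn : 2 ≤ n)
    (U : Set (EuclideanSpace ℂ (Fin n))) (hU : IsOpen U)
    (h0U : (0 : EuclideanSpace ℂ (Fin n)) ∈ U)
    (f g : EuclideanSpace ℂ (Fin n) → ℂ)
    (hf : AnalyticOnNhd ℂ f U) (hg : AnalyticOnNhd ℂ g U)
    (hf0 : f 0 = 0) (hg0 : g 0 = 0)
    (hfnc : ¬ ∀ᶠ x in nhds (0 : EuclideanSpace ℂ (Fin n)), f x = 0)
    (hgnc : ¬ ∀ᶠ x in nhds (0 : EuclideanSpace ℂ (Fin n)), g x = 0)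
    (hnofact : ¬ ∃ (V : Set (EuclideanSpace ℂ (Fin n))) (u : EuclideanSpace ℂ (Fin n) → ℂ),
      IsOpen V ∧ (0 : EuclideanSpace ℂ (Fin n)) ∈ V ∧ AnalyticOnNhd ℂ u V ∧ u 0 ≠ 0 ∧
      ∀ x ∈ V ∩ U, f x = u x * g x) :
    ∃ ε₀ > 0, ∀ ε, 0 < ε → ε < ε₀ → ∃ δ > 0,
      ball (0 : ℂ) δ ⊆ (fun x => f x * (starRingEnd ℂ) (g x)) '' (U ∩ ball 0 ε) := by
  refine ⟨1, one_pos, fun ε hε _ => ?_⟩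
  obtain ⟨v, hfv, hgv⟩ := exists_dir f g (hf 0 h0U) (hg 0 h0U) hfnc hgnc
  obtain ⟨η, hη, hηU⟩ := Metric.isOpen_iff.1 (hU.inter isOpen_ball) 0 ⟨h0U, mem_ball_self hε⟩
  by_contra hcon
  have hfB : AnalyticOnNhd ℂ f (ball 0 η) := fun y hy => hf y (hηU hy).1
  have hgB : AnalyticOnNhd ℂ g (ball 0 η) := fun y hy => hg y (hηU hy).1
  obtain ⟨u, hu, hu0, hfu⟩ := factor_of_orders f g η hη hfB hgB v hfv hgv (by
    intro x t ht hft hgt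
    by_contra hne
    apply hcon
    have h2 : AnalyticAt ℂ (fun t : ℂ => x + t • v) t :=
      analyticAt_const.add (analyticAt_id.smul analyticAt_const)
    have hN : (fun s : ℂ => x + s • v) ⁻¹' (U ∩ ball 0 ε) ∈ 𝓝 t :=
      h2.continuousAt ((hU.inter isOpen_ball).mem_nhds (hηU ht))
    obtain ⟨δ, hδ, hsub⟩ := oneDim (fun s : ℂ => f (x + s • v)) (fun s : ℂ => g (x + s • v)) t
      (AnalyticAt.comp (g := f) (f := fun t : ℂ => x + t • v) (hfB _ ht) h2)
      (AnalyticAt.comp (g := g) (f := fun t : ℂ => x + t • v) (hgB _ ht) h2) hft hgt hne _ hN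
    refine ⟨δ, hδ, fun c hc => ?_⟩
    obtain ⟨s, hs, rfl⟩ := hsub hc
    exact ⟨x + s • v, hs, rfl⟩)
  obtain ⟨V, hV, hVo, hV0⟩ := _root_.eventually_nhds_iff.1 (hu.eventually_analyticAt.and hfu)
  exact hnofact ⟨V, u, hVo, hV0, fun y hy => (hV y hy).1, hu0, fun y hy => (hV y hy.1).2⟩
end
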